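/- Let δ be a real number with 0.227 ≤ δ ≤ 2.9999 and let n be an integer with n ≥ 158. Then c₃^{(δ)}(n) · c₃^{(δ)}(n+3) > 0. -/

import Mathlib

namespace B3

/-! ## Part A: the kernel computation -/

/-- strict evaluation helper -/
def force {α : Type} (x : ℕ) (f : ℕ → α) : α :=
  Nat.rec (motive := fun _ => α) (f 0) (fun k _ => f (Nat.succ k)) x

theorem force_eq {α : Type} (x : ℕ) (f : ℕ → α) : force x f = f x := by
  cases x <;> rfl

/-- `W mod 2^m` -/
def lowb (W m : ℕ) : ℕ := Nat.land W (Nat.sub (Nat.pow 2 m) 1)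

theorem lowb_eq (W m : ℕ) : lowb W m = W % 2 ^ m := by
  unfold lowb
  exact Nat.and_two_pow_sub_one_eq_mod W m

/-- the `b` bits of `W` above position `a` (truncating first keeps the shift cheap) -/
def midb (W a b : ℕ) : ℕ := Nat.shiftRight (lowb W (Nat.add a b)) a

theorem midb_eq (W a b : ℕ) : midb W a b = lowb (Nat.shiftRight W a) b := by
  change (lowb W (a + b)) >>> a = lowb (W >>> a) b
  rw [lowb_eq, lowb_eq, Nat.shiftRight_eq_div_pow, Nat.shiftRight_eq_div_pow, pow_add,
    Nat.mod_mul_right_div_self]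

/-- `d * ∑_{m=1}^{2^k} X^{d m}`, `X = 2^B` -/
def geo (B d k : ℕ) : ℕ :=
  Nat.rec (motive := fun _ => ℕ) (Nat.shiftLeft d (Nat.mul B d))
    (fun k r => force r fun p => Nat.add p (Nat.shiftLeft p (Nat.mul B (Nat.mul d (Nat.pow 2 k))))) k

/-- sum of `geo` over a dyadic block of `d` -/
def sigP (B kk : ℕ) (k : ℕ) : ℕ → ℕ :=
  Nat.rec (motive := fun _ => ℕ → ℕ)
    (fun d => Bool.rec (motive := fun _ => ℕ) (geo B d kk) 0 (Nat.beq (Nat.mod d 3) 0))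
    (fun k ih d => Nat.add (ih d) (ih (Nat.add d (Nat.pow 2 k)))) k

/-- packed divisor sums -/
def sigA (B K : ℕ) (m : ℕ) : ℕ :=
  Nat.rec (motive := fun _ => ℕ) 0
    (fun l r => Nat.add r (sigP B (Nat.sub K l) l (Nat.pow 2 l))) m

/-- divide the digit with index `i` by `off + i` -/
def ext (B : ℕ) (k : ℕ) : ℕ → ℕ → ℕ :=
  Nat.rec (motive := fun _ => ℕ → ℕ → ℕ) (fun off W => Nat.div W off)
    (fun k ih off W =>
      force (Nat.shiftRight W (Nat.mul B (Nat.pow 2 k))) fun hi =>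
      force (lowb W (Nat.mul B (Nat.pow 2 k))) fun lo =>
      Nat.add (ih off lo)
        (Nat.shiftLeft (ih (Nat.add off (Nat.pow 2 k)) hi) (Nat.mul B (Nat.pow 2 k)))) k

/-- rows of the table -/
def rows {α : Type} (B N K Sg : ℕ) (J : ℕ) : ℕ → List ℕ → (List ℕ → α) → α :=
  Nat.rec (motive := fun _ => ℕ → List ℕ → (List ℕ → α) → α) (fun V acc k => k (V :: acc))
    (fun _ ih V acc k =>
      force (lowb (Nat.mul V Sg) (Nat.mul B (Nat.succ N))) fun W =>
      force (ext B K 0 W) fun V' => ih V' (V :: acc) k) J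

/-- separate even and odd rows -/
def sep {α : Type} (S : ℕ) (l : List ℕ) :
    ℕ → List ℕ → List ℕ → (List ℕ → List ℕ → α) → α :=
  List.rec (motive := fun _ => ℕ → List ℕ → List ℕ → (List ℕ → List ℕ → α) → α)
    (fun _ E O k => k E O)
    (fun V _ ih s E O k => force (Nat.mul V s) fun c => force (Nat.mul s S) fun s' =>
      ih s' (c :: O) E k) l

/-- one merging pass -/
def pass {α : Type} (z : ℕ) (l : List ℕ) : Option ℕ → (List ℕ → α) → α :=
  List.rec (motive := fun _ => Option ℕ → (List ℕ → α) → α)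
    (fun o k => Option.rec (motive := fun _ => α) (k []) (fun a => k [a]) o)
    (fun x _ ih o k => Option.rec (motive := fun _ => α) (ih (some x) k)
      (fun a => force (Nat.add a (Nat.mul z x)) fun v => ih none (fun r => k (v :: r))) o) l

/-- polynomial evaluation -/
def evl (n : ℕ) : ℕ → List ℕ → ℕ :=
  Nat.rec (motive := fun _ => ℕ → List ℕ → ℕ)
    (fun _ l => List.rec (motive := fun _ => ℕ) 0 (fun a _ _ => a) l)
    (fun _ ih z l => pass z l none (fun r => force (Nat.mul z z) fun z2 => ih z2 r)) n

/-- strict map -/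
def mapF {α : Type} (f : ℕ → ℕ) (l : List ℕ) : (List ℕ → α) → α :=
  List.rec (motive := fun _ => (List ℕ → α) → α) (fun k => k [])
    (fun a _ ih k => force (f a) fun v => ih (fun r => k (v :: r))) l

/-- Horner bound -/
def hor (B wn wd : ℕ) (k : ℕ) : ℕ → ℕ → ℕ → ℕ :=
  Nat.rec (motive := fun _ => ℕ → ℕ → ℕ → ℕ)
    (fun e o D => Nat.sub (Nat.add o (Nat.div (Nat.add (Nat.mul wn D) (Nat.sub wd 1)) wd)) e)
    (fun k ih e o D =>
      force (Nat.shiftRight e (Nat.mul B (Nat.pow 2 k))) fun e1 =>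
      force (Nat.shiftRight o (Nat.mul B (Nat.pow 2 k))) fun o1 =>
      force (ih e1 o1 D) fun D1 =>
      force (lowb e (Nat.mul B (Nat.pow 2 k))) fun e0 =>
      force (lowb o (Nat.mul B (Nat.pow 2 k))) fun o0 => ih e0 o0 D1) k

/-- check for one `n`, `l` the list of digits `j = J, J-1, ..., 0` -/
def chk1 (B KJ S d wn wd err : ℕ) (pos : Bool) (l : List ℕ) : Bool :=
  sep S l 1 [] [] fun El Ol =>
  force (Nat.add d (Nat.pow 2 B)) fun z => force (Nat.mul z z) fun z2 =>
  force (evl KJ z2 El) fun E => force (Nat.mul z (evl KJ z2 Ol)) fun O =>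
  Nat.beq (Bool.rec (motive := fun _ => ℕ) (hor B wn wd KJ O (Nat.add E err) 0)
    (hor B wn wd KJ E (Nat.add O err) 0) pos) 0

/-- bounded conjunction -/
def loop (f : ℕ → Bool) (m : ℕ) : Bool :=
  Nat.rec (motive := fun _ => Bool) true
    (fun i ih => Bool.rec (motive := fun _ => Bool) false ih (f i)) m

/-- the whole check for one cell -/
def cell (N K J KJ P B S d wn wd n0 errm nb : ℕ) : Bool :=
  force (lowb (sigA B K K) (Nat.mul B (Nat.succ N))) fun Sg =>
  force (Nat.mul errm (Nat.pow S J)) fun err =>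
  rows B N K Sg J (Nat.pow 2 P) [] fun Vs =>
  loop (fun b => mapF (fun V =>
      midb V (Nat.mul B (Nat.add n0 (Nat.mul 32 b))) (Nat.mul B 32)) Vs fun Ws =>
    loop (fun i => mapF (fun V => midb V (Nat.mul B i) B) Ws fun Ds =>
      Bool.rec (motive := fun _ => Bool) true
       (chk1 B KJ S d wn wd err
        (Nat.beq (Nat.mod (Nat.add (Nat.add n0 (Nat.mul 32 b)) i) 3) 0) Ds)
       (Nat.ble (Nat.add (Nat.add n0 (Nat.mul 32 b)) i) N)) 32) nb



/-! ### correctness of the computation -/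

/-- divisor sum over divisors not divisible by 3 -/
def sg (k : ℕ) : ℕ := ∑ d ∈ k.divisors with ¬ 3 ∣ d, d

/-- rounded table -/
def bh (P : ℕ) : ℕ → ℕ → ℕ
  | 0, n => if n = 0 then 2 ^ P else 0
  | j + 1, n => (∑ k ∈ Finset.range (n + 1), sg k * bh P j (n - k)) / n

/-- descending list -/
def lst (v : ℕ → ℕ) : ℕ → List ℕ
  | 0 => []
  | m + 1 => v m :: lst v m

theorem digits_lt (X : ℕ) (f : ℕ → ℕ) (m : ℕ) (hf : ∀ i < m, f i < X) :
    ∑ i ∈ Finset.range m, f i * X ^ i < X ^ m := by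
  induction m with
  | zero => simp
  | succ m ih =>
    rw [Finset.sum_range_succ, pow_succ]
    have h1 := ih (fun i hi => hf i (by omega))
    have h2 := hf m (by omega)
    calc _ < X ^ m + f m * X ^ m := by omega
      _ = X ^ m * (f m + 1) := by ring
      _ ≤ X ^ m * X := Nat.mul_le_mul_left _ h2

theorem digits_split (X : ℕ) (f : ℕ → ℕ) (a b : ℕ) :
    ∑ i ∈ Finset.range (a + b), f i * X ^ i =
      ∑ i ∈ Finset.range a, f i * X ^ i + X ^ a * ∑ i ∈ Finset.range b, f (a + i) * X ^ i := by
  rw [Finset.sum_range_add, Finset.mul_sum]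
  congr 1
  apply Finset.sum_congr rfl
  intro i _
  rw [pow_add]; ring

theorem digits_mod (X : ℕ) (f : ℕ → ℕ) (a b : ℕ) (hf : ∀ i < a, f i < X) :
    (∑ i ∈ Finset.range (a + b), f i * X ^ i) % X ^ a = ∑ i ∈ Finset.range a, f i * X ^ i := by
  rw [digits_split, Nat.add_mul_mod_self_left, Nat.mod_eq_of_lt (digits_lt X f a hf)]

theorem digits_div (X : ℕ) (hX : 0 < X) (f : ℕ → ℕ) (a b : ℕ) (hf : ∀ i < a, f i < X) :
    (∑ i ∈ Finset.range (a + b), f i * X ^ i) / X ^ a =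
      ∑ i ∈ Finset.range b, f (a + i) * X ^ i := by
  rw [digits_split, Nat.add_mul_div_left _ _ (by positivity),
    Nat.div_eq_of_lt (digits_lt X f a hf), zero_add]

theorem ext_succ (B k off W : ℕ) : ext B (k + 1) off W =
    ext B k off (W % 2 ^ (B * 2 ^ k)) +
      (ext B k (off + 2 ^ k) (W / 2 ^ (B * 2 ^ k))) * 2 ^ (B * 2 ^ k) := by
  rw [← Nat.shiftLeft_eq (ext B k (off + 2 ^ k) _), ← Nat.shiftRight_eq_div_pow, ← lowb_eq]
  have h : ext B (k + 1) off W = force (Nat.shiftRight W (Nat.mul B (Nat.pow 2 k))) fun hi =>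
      force (lowb W (Nat.mul B (Nat.pow 2 k))) fun lo =>
      Nat.add (ext B k off lo)
        (Nat.shiftLeft (ext B k (Nat.add off (Nat.pow 2 k)) hi) (Nat.mul B (Nat.pow 2 k))) := rfl
  rw [h, force_eq, force_eq]
  rfl

theorem hor_succ (B wn wd k e o D : ℕ) : hor B wn wd (k + 1) e o D =
    hor B wn wd k (e % 2 ^ (B * 2 ^ k)) (o % 2 ^ (B * 2 ^ k))
      (hor B wn wd k (e / 2 ^ (B * 2 ^ k)) (o / 2 ^ (B * 2 ^ k)) D) := by
  rw [← Nat.shiftRight_eq_div_pow, ← Nat.shiftRight_eq_div_pow, ← lowb_eq, ← lowb_eq]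
  have h : hor B wn wd (k + 1) e o D =
      force (Nat.shiftRight e (Nat.mul B (Nat.pow 2 k))) fun e1 =>
      force (Nat.shiftRight o (Nat.mul B (Nat.pow 2 k))) fun o1 =>
      force (hor B wn wd k e1 o1 D) fun D1 =>
      force (lowb e (Nat.mul B (Nat.pow 2 k))) fun e0 =>
      force (lowb o (Nat.mul B (Nat.pow 2 k))) fun o0 => hor B wn wd k e0 o0 D1 := rfl
  rw [h, force_eq, force_eq, force_eq, force_eq, force_eq]
  rfl

theorem ext_eq (B k : ℕ) : ∀ (off : ℕ) (f : ℕ → ℕ), (∀ i < 2 ^ k, f i < 2 ^ B) →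
    ext B k off (∑ i ∈ Finset.range (2 ^ k), f i * (2 ^ B) ^ i) =
      ∑ i ∈ Finset.range (2 ^ k), (f i / (off + i)) * (2 ^ B) ^ i := by
  induction k with
  | zero =>
    intro off f hf
    simp only [pow_zero, Finset.range_one, Finset.sum_singleton, mul_one, add_zero]
    rfl
  | succ k ih =>
    intro off f hf
    have h2 : 2 ^ (k + 1) = 2 ^ k + 2 ^ k := by ring
    rw [ext_succ]
    rw [pow_mul, h2]
    rw [h2] at hf
    rw [digits_mod _ _ _ _ (fun i hi => hf i (by omega)),
      digits_div _ (by positivity) _ _ _ (fun i hi => hf i (by omega)),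
      ih _ _ (fun i hi => hf i (by omega)), ih _ _ (fun i hi => hf _ (by omega)),
      digits_split _ _ (2 ^ k)]
    simp only [add_assoc, mul_comm]

theorem rows_eq {α : Type} (B N K Sg : ℕ) (v : ℕ → ℕ) (J : ℕ) :
    ∀ (j : ℕ) (k : List ℕ → α),
    (∀ i < j + J, ext B K 0 (lowb (v i * Sg) (B * (N + 1))) = v (i + 1)) →
    rows B N K Sg J (v j) (lst v j) k = k (lst v (j + J + 1)) := by
  induction J with
  | zero => intro j k _; rfl
  | succ J ih =>
    intro j k h
    have h0 : rows B N K Sg (J + 1) (v j) (lst v j) k =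
      force (lowb (Nat.mul (v j) Sg) (Nat.mul B (Nat.succ N))) fun W =>
      force (ext B K 0 W) fun V' => rows B N K Sg J V' (v j :: lst v j) k := rfl
    rw [h0, force_eq, force_eq]
    change rows B N K Sg J (ext B K 0 (lowb (v j * Sg) (B * (N + 1)))) (lst v (j + 1)) k = _
    rw [h j (by omega), ih (j + 1) k (fun i hi => h i (by omega))]
    congr 2; omega

theorem mapF_eq {α : Type} (f : ℕ → ℕ) (l : List ℕ) : ∀ k : List ℕ → α,
    mapF f l k = k (l.map f) := by
  induction l with
  | nil => intro k; rfl
  | cons a l ih =>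
    intro k
    have h0 : mapF f (a :: l) k = force (f a) fun v => mapF f l (fun r => k (v :: r)) := rfl
    rw [h0, force_eq, ih]; rfl

theorem map_lst (f : ℕ → ℕ) (v : ℕ → ℕ) (m : ℕ) : (lst v m).map f = lst (fun j => f (v j)) m := by
  induction m with
  | zero => rfl
  | succ m ih => simp [lst, ih]

theorem lst_congr (v w : ℕ → ℕ) (m : ℕ) (h : ∀ j < m, v j = w j) : lst v m = lst w m := by
  induction m with
  | zero => rfl
  | succ m ih => simp [lst, ih (fun j hj => h j (by omega)), h m (by omega)]

/-- polynomial evaluation of a list -/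
def ev {R : Type} [CommSemiring R] (z : R) : List ℕ → R
  | [] => 0
  | a :: l => (a : R) + z * ev z l

theorem sep_eq {α : Type} (S : ℕ) (c : ℕ → ℕ) (m : ℕ) :
    ∀ (s : ℕ) (E O : List ℕ), ∃ E' O' : List ℕ,
    (∀ k : List ℕ → List ℕ → α, sep S (lst c m) s E O k = k E' O') ∧
    E'.length + O'.length = E.length + O.length + m ∧
    ∀ (R : Type) [CommSemiring R] (z : R),
      ev (z * z) E' + z * ev (z * z) O' =
        ∑ j ∈ Finset.range m, ((c j * (s * S ^ (m - 1 - j)) : ℕ) : R) * z ^ j +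
          z ^ m * (ev (z * z) E + z * ev (z * z) O) := by
  induction m with
  | zero => 
    intro s E O
    exact ⟨E, O, fun k => rfl, by simp, fun R _ z => by simp⟩
  | succ m ih =>
    intro s E O
    obtain ⟨E', O', h1, h2, h3⟩ := ih (s * S) ((c m * s) :: O) E
    refine ⟨E', O', fun k => ?_, ?_, ?_⟩
    · rw [← h1 k]
      have h0 : sep S (lst c (m + 1)) s E O k = force (Nat.mul (c m) s) fun c' =>
        force (Nat.mul s S) fun s' => sep S (lst c m) s' (c' :: O) E k := rfl
      rw [h0, force_eq, force_eq]
      rfl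
    · rw [h2]; simp; omega
    · intro R _ z
      rw [h3, Finset.sum_range_succ, ev]
      have : ∑ j ∈ Finset.range m, ((c j * (s * S * S ^ (m - 1 - j)) : ℕ) : R) * z ^ j =
          ∑ j ∈ Finset.range m, ((c j * (s * S ^ (m + 1 - 1 - j)) : ℕ) : R) * z ^ j := by
        apply Finset.sum_congr rfl
        intro j hj
        have hj := Finset.mem_range.1 hj
        have : m + 1 - 1 - j = (m - 1 - j) + 1 := by omega
        rw [this, pow_succ]; congr 2; ring
      rw [this]
      simp
      ring

theorem pass_eq {α : Type} (z : ℕ) (l : List ℕ) : 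
    ∀ (o : Option ℕ), ∃ l' : List ℕ, (∀ k : List ℕ → α, pass z l o k = k l') ∧
      l'.length * 2 ≤ (o.toList ++ l).length + 1 ∧ 
      ev (z * z) l' = ev z (o.toList ++ l) := by
  induction l with
  | nil =>
    intro o
    cases o with
    | none => exact ⟨[], fun k => rfl, by simp, by simp [ev]⟩
    | some a => exact ⟨[a], fun k => rfl, by simp, by simp [ev]⟩
  | cons x l ih =>
    intro o
    cases o with
    | none => 
      obtain ⟨l', h1, h2, h3⟩ := ih (some x)
      exact ⟨l', fun k => h1 k, h2, h3⟩
    | some a =>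
      obtain ⟨l', h1, h2, h3⟩ := ih none
      refine ⟨(a + z * x) :: l', fun k => ?_, ?_, ?_⟩
      · have h0 : pass z (x :: l) (some a) k = force (Nat.add a (Nat.mul z x)) fun v =>
          pass z l none (fun r => k (v :: r)) := rfl
        rw [h0, force_eq, h1]
        rfl
      · simp at h2 ⊢; omega
      · simp at h3
        simp [ev, h3]; ring

theorem evl_eq (n : ℕ) : ∀ (z : ℕ) (l : List ℕ), l.length ≤ 2 ^ n → evl n z l = ev z l := by
  induction n with
  | zero =>
    intro z l h
    match l, h with
    | [], _ => rfl
    | [a], _ => simp [ev, evl]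
  | succ n ih =>
    intro z l h
    obtain ⟨l', h1, h2, h3⟩ := pass_eq (α := ℕ) z l none
    change pass z l none _ = _
    rw [h1, force_eq]
    change evl n (z * z) l' = _
    rw [ih, h3]; · simp
    simp at h2
    rw [pow_succ] at h
    omega

theorem hor_le (B wn wd : ℕ) (hwd : 0 < wd) (x : ℝ) (hx0 : 0 ≤ x) (hx1 : x * wd ≤ wn) (k : ℕ) :
    ∀ (fe fo : ℕ → ℕ) (D : ℕ), (∀ i < 2 ^ k, fe i < 2 ^ B) → (∀ i < 2 ^ k, fo i < 2 ^ B) →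
    ∑ i ∈ Finset.range (2 ^ k), (fo i : ℝ) * x ^ i + D * x ^ (2 ^ k) ≤
      ∑ i ∈ Finset.range (2 ^ k), (fe i : ℝ) * x ^ i +
      hor B wn wd k (∑ i ∈ Finset.range (2 ^ k), fe i * (2 ^ B) ^ i)
        (∑ i ∈ Finset.range (2 ^ k), fo i * (2 ^ B) ^ i) D := by
  induction k with
  | zero =>
    intro fe fo D he ho
    simp only [pow_zero, Finset.range_one, Finset.sum_singleton, mul_one, pow_one]
    change _ ≤ _ + (((fo 0 + (wn * D + (wd - 1)) / wd) - fe 0 : ℕ) : ℝ)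
    have h1 : (wn * D : ℕ) ≤ ((wn * D + (wd - 1)) / wd) * wd := by
      have := Nat.div_add_mod (wn * D + (wd - 1)) wd
      have h3 := Nat.mod_lt (wn * D + (wd - 1)) hwd
      rw [mul_comm] at this
      omega
    set q := (wn * D + (wd - 1)) / wd
    have h2 : (D : ℝ) * x ≤ q := by
      have h1' : (wn : ℝ) * D ≤ q * wd := by exact_mod_cast h1
      have hw : (0 : ℝ) < wd := by exact_mod_cast hwd
      have : (D : ℝ) * x * wd ≤ q * wd := by
        have := mul_le_mul_of_nonneg_left hx1 (Nat.cast_nonneg (α := ℝ) D)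
        nlinarith
      exact le_of_mul_le_mul_right this hw
    have h3 : (fo 0 + q : ℕ) ≤ fe 0 + (fo 0 + q - fe 0) := by omega
    have h3' : (fo 0 : ℝ) + q ≤ fe 0 + ((fo 0 + q - fe 0 : ℕ) : ℝ) := by exact_mod_cast h3
    linarith
  | succ k ih =>
    intro fe fo D he ho
    have h2 : 2 ^ (k + 1) = 2 ^ k + 2 ^ k := by ring
    rw [hor_succ]
    rw [pow_mul, h2]
    rw [h2] at he ho
    rw [digits_mod _ _ _ _ (fun i hi => he i (by omega)),
      digits_mod _ _ _ _ (fun i hi => ho i (by omega)),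
      digits_div _ (by positivity) _ _ _ (fun i hi => he i (by omega)),
      digits_div _ (by positivity) _ _ _ (fun i hi => ho i (by omega))]
    have i1 := ih (fun i => fe (2 ^ k + i)) (fun i => fo (2 ^ k + i)) D
      (fun i hi => he _ (by omega)) (fun i hi => ho _ (by omega))
    set D1 := hor B wn wd k _ _ D
    have i2 := ih fe fo D1 (fun i hi => he _ (by omega)) (fun i hi => ho _ (by omega))
    have hs : ∀ f : ℕ → ℕ, ∑ i ∈ Finset.range (2 ^ k + 2 ^ k), (f i : ℝ) * x ^ i =
        ∑ i ∈ Finset.range (2 ^ k), (f i : ℝ) * x ^ i +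
          x ^ (2 ^ k) * ∑ i ∈ Finset.range (2 ^ k), (f (2 ^ k + i) : ℝ) * x ^ i := by
      intro f
      rw [Finset.sum_range_add, Finset.mul_sum]
      congr 1
      apply Finset.sum_congr rfl
      intro i _
      rw [pow_add]; ring
    rw [hs, hs, pow_add]
    have i3 := mul_le_mul_of_nonneg_left i1 (pow_nonneg hx0 (2 ^ k))
    nlinarith [i2, i3]



theorem geo_eq (B d k : ℕ) :
    geo B d k = ∑ m ∈ Finset.range (2 ^ k), d * (2 ^ B) ^ (d * (m + 1)) := by
  induction k with
  | zero =>
    simp only [pow_zero, Finset.range_one, Finset.sum_singleton, zero_add, mul_one]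
    change d <<< (B * d) = _
    rw [Nat.shiftLeft_eq, pow_mul]
  | succ k ih =>
    have h0 : geo B d (k + 1) = force (geo B d k) fun p =>
      Nat.add p (Nat.shiftLeft p (Nat.mul B (Nat.mul d (Nat.pow 2 k)))) := rfl
    rw [h0, force_eq]
    change geo B d k + (geo B d k) <<< (B * (d * 2 ^ k)) = _
    rw [Nat.shiftLeft_eq, ih]
    have h2 : 2 ^ (k + 1) = 2 ^ k + 2 ^ k := by ring
    rw [h2, Finset.sum_range_add, Finset.sum_mul]
    congr 1
    apply Finset.sum_congr rfl
    intro i _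
    rw [← pow_mul, ← pow_mul, mul_assoc, ← pow_add]
    congr 2; ring

/-- contribution of one `d` -/
def tt (X N d : ℕ) : ℕ :=
  ∑ k ∈ Finset.range (N + 1), (if d ∣ k ∧ k ≠ 0 ∧ ¬ 3 ∣ d then d else 0) * X ^ k

theorem geo_mod (B d k N : ℕ) (hd : ¬ 3 ∣ d) (h : N < d * 2 ^ k) :
    geo B d k ≡ tt (2 ^ B) N d [MOD (2 ^ B) ^ (N + 1)] := by
  rw [geo_eq]
  have hd0 : 0 < d := by
    rcases Nat.eq_zero_or_pos d with h | h
    · subst h; simp at hd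
    · exact h
  have h1 : tt (2 ^ B) N d = ∑ m ∈ Finset.range (2 ^ k),
      if d * (m + 1) ≤ N then d * (2 ^ B) ^ (d * (m + 1)) else 0 := by
    have h3 : ∀ m ∈ Finset.range (2 ^ k),
        (if d * (m + 1) ≤ N then d * (2 ^ B) ^ (d * (m + 1)) else 0) =
        ∑ j ∈ Finset.range (N + 1), if j = d * (m + 1) then d * (2 ^ B) ^ j else 0 := by
      intro m _
      rw [Finset.sum_ite_eq']
      simp
    rw [Finset.sum_congr rfl h3, Finset.sum_comm]
    unfold tt
    apply Finset.sum_congr rfl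
    intro j hj
    have hj := Finset.mem_range.1 hj
    by_cases hdj : d ∣ j ∧ j ≠ 0
    · obtain ⟨⟨e, rfl⟩, hj0⟩ := hdj
      have he : e ≠ 0 := by rintro rfl; simp at hj0
      obtain ⟨e, rfl⟩ := Nat.exists_eq_succ_of_ne_zero he
      rw [Finset.sum_eq_single e]
      · simp [hd]
      · intro b _ hb
        rw [if_neg]
        intro h
        have := Nat.eq_of_mul_eq_mul_left hd0 h
        omega
      · intro hh
        exfalso
        apply hh
        rw [Finset.mem_range]
        by_contra hc
        have : d * 2 ^ k ≤ d * (e + 1) := Nat.mul_le_mul_left _ (by omega)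
        simp at hj
        omega
    · rw [if_neg (by tauto), zero_mul]
      symm
      apply Finset.sum_eq_zero
      intro m _
      rw [if_neg]
      rintro rfl
      exact hdj ⟨⟨_, rfl⟩, by positivity⟩
  rw [h1]
  apply Nat.ModEq.sum
  intro m _
  split_ifs with h
  · rfl
  · rw [Nat.modEq_zero_iff_dvd]
    apply Dvd.dvd.mul_left
    exact pow_dvd_pow _ (by omega)

theorem sigP_mod (B kk k N : ℕ) : ∀ d : ℕ, N < d * 2 ^ kk →
    sigP B kk k d ≡ ∑ i ∈ Finset.range (2 ^ k), tt (2 ^ B) N (d + i) [MOD (2 ^ B) ^ (N + 1)] := by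
  induction k with
  | zero =>
    intro d h
    simp only [pow_zero, Finset.range_one, Finset.sum_singleton, add_zero]
    have h0 : sigP B kk 0 d = Bool.rec (motive := fun _ => ℕ) (geo B d kk) 0 (Nat.beq (Nat.mod d 3) 0) := rfl
    rw [h0]
    by_cases h3 : 3 ∣ d
    · have : Nat.beq (Nat.mod d 3) 0 = true := by
        rw [Nat.beq_eq]; exact Nat.mod_eq_zero_of_dvd h3
      rw [this]
      have : tt (2 ^ B) N d = 0 := by
        unfold tt
        apply Finset.sum_eq_zero
        intro j _
        rw [if_neg (by tauto), zero_mul]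
      rw [this]
    · have : Nat.beq (Nat.mod d 3) 0 = false := by
        rw [← Bool.not_eq_true, Nat.beq_eq]
        intro hh; exact h3 (Nat.dvd_of_mod_eq_zero hh)
      rw [this]
      exact geo_mod B d kk N h3 h
  | succ k ih =>
    intro d h
    have h2 : 2 ^ (k + 1) = 2 ^ k + 2 ^ k := by ring
    rw [h2, Finset.sum_range_add]
    have h0 : sigP B kk (k + 1) d = sigP B kk k d + sigP B kk k (d + 2 ^ k) := rfl
    rw [h0]
    refine Nat.ModEq.add (ih d h) ?_
    have := ih (d + 2 ^ k) (lt_of_lt_of_le h (Nat.mul_le_mul_right _ (Nat.le_add_right _ _)))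
    simpa only [add_assoc] using this

theorem sigA_mod (B K N : ℕ) (hN : N < 2 ^ K) (m : ℕ) (hm : m ≤ K) :
    sigA B K m ≡ ∑ d ∈ Finset.range (2 ^ m), tt (2 ^ B) N d [MOD (2 ^ B) ^ (N + 1)] := by
  induction m with
  | zero =>
    have : tt (2 ^ B) N 0 = 0 := by
      unfold tt
      apply Finset.sum_eq_zero
      intro j _
      simp
    simp [this, sigA, Nat.ModEq.refl]
  | succ m ih =>
    have h2 : 2 ^ (m + 1) = 2 ^ m + 2 ^ m := by ring
    rw [h2, Finset.sum_range_add]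
    have h0 : sigA B K (m + 1) = sigA B K m + sigP B (K - m) m (2 ^ m) := rfl
    rw [h0]
    refine Nat.ModEq.add (ih (by omega)) (sigP_mod _ _ _ _ _ ?_)
    rw [← pow_add, Nat.add_sub_cancel' (by omega)]
    exact hN

theorem sum_tt (X N M : ℕ) (hN : N < M) :
    ∑ d ∈ Finset.range M, tt X N d = ∑ k ∈ Finset.range (N + 1), sg k * X ^ k := by
  unfold tt
  rw [Finset.sum_comm]
  apply Finset.sum_congr rfl
  intro k hk
  have hk := Finset.mem_range.1 hk
  rw [← Finset.sum_mul]
  congr 1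
  unfold sg
  rw [← Finset.sum_filter]
  apply Finset.sum_congr _ (fun _ _ => rfl)
  ext d
  simp only [Finset.mem_filter, Finset.mem_range, Nat.mem_divisors]
  constructor
  · rintro ⟨h1, h2, h3, h4⟩; exact ⟨⟨h2, h3⟩, h4⟩
  · rintro ⟨⟨h2, h3⟩, h4⟩
    exact ⟨lt_of_le_of_lt (Nat.le_of_dvd (by omega) h2) (by omega), h2, h3, h4⟩

/-- packed product -/
theorem pack_mul (X N : ℕ) (f g : ℕ → ℕ) :
    (∑ k ∈ Finset.range (N + 1), g k * X ^ k) * (∑ k ∈ Finset.range (N + 1), f k * X ^ k) ≡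
      ∑ n ∈ Finset.range (N + 1), (∑ k ∈ Finset.range (n + 1), f k * g (n - k)) * X ^ n
      [MOD X ^ (N + 1)] := by
  have h1 : ∑ n ∈ Finset.range (N + 1), (∑ k ∈ Finset.range (n + 1), f k * g (n - k)) * X ^ n =
      ∑ k ∈ Finset.range (N + 1), ∑ m ∈ Finset.range (N + 1),
        if k + m ≤ N then f k * g m * X ^ (k + m) else 0 := by
    have h2 : ∀ k ∈ Finset.range (N + 1), ∀ m ∈ Finset.range (N + 1),
      (if k + m ≤ N then f k * g m * X ^ (k + m) else 0) = 
      ∑ n ∈ Finset.range (N + 1), if n = k + m then f k * g m * X ^ n else 0 := by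
      intro k _ m _
      rw [Finset.sum_ite_eq']
      simp
    rw [Finset.sum_congr rfl (fun k hk => Finset.sum_congr rfl (h2 k hk))]
    rw [Finset.sum_congr rfl (fun k _ => Finset.sum_comm), Finset.sum_comm]
    apply Finset.sum_congr rfl
    intro n hn
    have hn := Finset.mem_range.1 hn
    rw [Finset.sum_mul]
    have hsub : Finset.range (n + 1) ⊆ Finset.range (N + 1) := by
      intro x; simp; omega
    rw [← Finset.sum_subset hsub]
    · apply Finset.sum_congr rfl
      intro k hk
      have hk := Finset.mem_range.1 hk
      rw [Finset.sum_eq_single (n - k)]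
      · rw [if_pos (by omega)]
      · intro b _ hb; rw [if_neg (by omega)]
      · intro h; simp at h; omega
    · intro k _ hk
      simp at hk
      apply Finset.sum_eq_zero
      intro m _
      rw [if_neg (by omega)]
  rw [h1, mul_comm, Finset.sum_mul]
  apply Nat.ModEq.sum
  intro k _
  rw [Finset.mul_sum]
  apply Nat.ModEq.sum
  intro m _
  split_ifs with h
  · have e : f k * X ^ k * (g m * X ^ m) = f k * g m * X ^ (k + m) := by rw [pow_add]; ring
    rw [e]
  · rw [Nat.modEq_zero_iff_dvd]
    have : f k * X ^ k * (g m * X ^ m) = X ^ (k + m) * (f k * g m) := by rw [pow_add]; ring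
    rw [this]
    apply Dvd.dvd.mul_right
    exact pow_dvd_pow _ (by omega)

/-- one row step -/
theorem row_step (B N K P j : ℕ) (hN : N < 2 ^ K)
    (hb : ∀ n ≤ N, ∑ k ∈ Finset.range (n + 1), sg k * bh P j (n - k) < 2 ^ B) :
    ext B K 0 (lowb ((∑ n ∈ Finset.range (N + 1), bh P j n * (2 ^ B) ^ n) *
      lowb (sigA B K K) (B * (N + 1))) (B * (N + 1))) =
      ∑ n ∈ Finset.range (N + 1), bh P (j + 1) n * (2 ^ B) ^ n := by
  rw [lowb_eq, lowb_eq, pow_mul]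
  have h1 := sigA_mod B K N hN K le_rfl
  rw [sum_tt _ _ _ hN] at h1
  have h2 := pack_mul (2 ^ B) N sg (bh P j)
  set F : ℕ → ℕ := fun n => if n ≤ N then ∑ k ∈ Finset.range (n + 1), sg k * bh P j (n - k) else 0
    with hF
  have hFB : ∀ n, F n < 2 ^ B := by
    intro n
    simp only [hF]
    split_ifs with h
    · exact hb n h
    · positivity
  have hsum : ∀ G : ℕ → ℕ, (∀ n, N < n → G n = 0) → ∑ n ∈ Finset.range (2 ^ K), G n = 
      ∑ n ∈ Finset.range (N + 1), G n := by
    intro G hG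
    symm
    apply Finset.sum_subset
    · intro x; simp; omega
    · intro x _ hx
      simp at hx
      exact hG x (by omega)
  have h3 : ∑ n ∈ Finset.range (N + 1), (∑ k ∈ Finset.range (n + 1), sg k * bh P j (n - k)) *
      (2 ^ B) ^ n = ∑ n ∈ Finset.range (N + 1), F n * (2 ^ B) ^ n := by
    apply Finset.sum_congr rfl
    intro n hn
    have hn := Finset.mem_range.1 hn
    simp only [hF]
    rw [if_pos (by omega)]
  have h4 : ((∑ n ∈ Finset.range (N + 1), bh P j n * (2 ^ B) ^ n) *
      (sigA B K K % (2 ^ B) ^ (N + 1))) % (2 ^ B) ^ (N + 1) =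
      ∑ n ∈ Finset.range (2 ^ K), F n * (2 ^ B) ^ n := by
    rw [hsum (fun n => F n * (2 ^ B) ^ n) (fun n hn => by simp [hF]; omega),
      ← Nat.mod_eq_of_lt (digits_lt (2 ^ B) F (N + 1) (fun i _ => hFB i)), ← h3]
    refine Nat.ModEq.trans ?_ h2
    exact Nat.ModEq.mul_left _ ((Nat.mod_modEq _ _).trans h1)
  rw [h4, ext_eq B K 0 F (fun i _ => hFB i),
    hsum (fun n => F n / (0 + n) * (2 ^ B) ^ n) (fun n hn => by
      have : F n = 0 := by simp [hF]; omega
      simp [this])]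
  apply Finset.sum_congr rfl
  intro n hn
  have hn := Finset.mem_range.1 hn
  simp only [hF]
  rw [if_pos (by omega), zero_add]
  rfl



theorem ev_map {R T : Type} [CommSemiring R] [CommSemiring T] (φ : R →+* T) (z : R) (l : List ℕ) :
    φ (ev z l) = ev (φ z) l := by
  induction l with
  | nil => simp [ev]
  | cons a l ih => simp [ev, ih]

open Polynomial in
theorem chk1_sound (B KJ S d wn wd err J : ℕ) (pos : Bool) (c : ℕ → ℕ) (hwd : 0 < wd)
    (hJ : J < 2 ^ KJ)
    (hbound : ∑ j ∈ Finset.range (J + 1), c j * S ^ (J - j) * (d + 1) ^ j + err < 2 ^ B)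
    (h : chk1 B KJ S d wn wd err pos (lst c (J + 1)) = true)
    (x : ℝ) (hx0 : 0 ≤ x) (hx1 : x * wd ≤ wn) :
    (err : ℝ) ≤ (if pos then 1 else -1) *
      ∑ j ∈ Finset.range (J + 1), (c j : ℝ) * S ^ (J - j) * (-(d + x)) ^ j := by
  obtain ⟨El, Ol, h1, h2, h3⟩ := sep_eq (α := Bool) S c (J + 1) 1 [] []
  unfold chk1 at h
  rw [h1, force_eq, force_eq, force_eq, force_eq] at h
  simp at h2
  rw [evl_eq _ _ _ (by omega), evl_eq _ _ _ (by omega)] at h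
  have h3' : ∀ (R : Type) [CommSemiring R] (z : R),
      ev (z * z) El + z * ev (z * z) Ol =
        ∑ j ∈ Finset.range (J + 1), ((c j * S ^ (J - j) : ℕ) : R) * z ^ j := by
    intro R _ z
    rw [h3 R z]
    simp [ev]
  set z : ℕ[X] := C d + X with hz
  set pE : ℕ[X] := ev (z * z) El with hpE
  set pO : ℕ[X] := z * ev (z * z) Ol with hpO
  have hR : pE + pO = ∑ j ∈ Finset.range (J + 1), ((c j * S ^ (J - j) : ℕ) : ℕ[X]) * z ^ j := by
    rw [hpE, hpO, ← h3' ℕ[X] z]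
  have hdeg : (pE + pO).natDegree ≤ J := by
    rw [hR]
    apply natDegree_sum_le_of_forall_le
    intro j hj
    have hj := Finset.mem_range.1 hj
    refine (natDegree_mul_le).trans ?_
    rw [natDegree_natCast, zero_add]
    refine (natDegree_pow_le).trans ?_
    have : z.natDegree ≤ 1 := by
      rw [hz]
      refine (natDegree_add_le _ _).trans ?_
      simp
    calc j * z.natDegree ≤ j * 1 := Nat.mul_le_mul_left _ this
      _ ≤ J := by omega
  have hev1 : (pE + pO).eval 1 + err < 2 ^ B := by
    rw [hR]
    refine lt_of_eq_of_lt ?_ hbound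
    simp [eval_finsetSum, hz]
  have hco : ∀ p : ℕ[X], p.natDegree < 2 ^ KJ → ∀ y : ℕ, p.eval y = 
      ∑ i ∈ Finset.range (2 ^ KJ), p.coeff i * y ^ i := by
    intro p hp y
    exact eval_eq_sum_range' hp y
  have hdegE : pE.natDegree < 2 ^ KJ := by
    refine lt_of_le_of_lt ?_ hJ
    rw [natDegree_le_iff_coeff_eq_zero] at hdeg ⊢
    intro N hN
    have := hdeg N hN
    rw [coeff_add] at this
    omega
  have hdegO : pO.natDegree < 2 ^ KJ := by
    refine lt_of_le_of_lt ?_ hJ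
    rw [natDegree_le_iff_coeff_eq_zero] at hdeg ⊢
    intro N hN
    have := hdeg N hN
    rw [coeff_add] at this
    omega
  rw [eval_add] at hev1
  have hbE : ∀ i < 2 ^ KJ, pE.coeff i ≤ pE.eval 1 := by
    intro i hi
    rw [hco pE hdegE]
    have := Finset.single_le_sum (f := fun i => pE.coeff i * 1 ^ i) (fun _ _ => Nat.zero_le _) (Finset.mem_range.2 hi)
    simpa using this
  have hbO : ∀ i < 2 ^ KJ, pO.coeff i ≤ pO.eval 1 := by
    intro i hi
    rw [hco pO hdegO]
    have := Finset.single_le_sum (f := fun i => pO.coeff i * 1 ^ i) (fun _ _ => Nat.zero_le _) (Finset.mem_range.2 hi)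
    simpa using this
  have hEn : ev (Nat.mul (Nat.add d (Nat.pow 2 B)) (Nat.add d (Nat.pow 2 B))) El =
      ∑ i ∈ Finset.range (2 ^ KJ), pE.coeff i * (2 ^ B) ^ i := by
    rw [← hco pE hdegE, hpE]
    have := ev_map (evalRingHom (2 ^ B : ℕ)) (z * z) El
    simp only [coe_evalRingHom] at this
    rw [this]
    simp [hz]
  have hOn : Nat.mul (Nat.add d (Nat.pow 2 B)) (ev (Nat.mul (Nat.add d (Nat.pow 2 B)) (Nat.add d (Nat.pow 2 B))) Ol) =
      ∑ i ∈ Finset.range (2 ^ KJ), pO.coeff i * (2 ^ B) ^ i := by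
    rw [← hco pO hdegO, hpO]
    have := ev_map (evalRingHom (2 ^ B : ℕ)) (z * z) Ol
    simp only [coe_evalRingHom] at this
    rw [eval_mul, this]
    simp [hz]
  rw [hEn, hOn] at h
  have hreal : ∀ p : ℕ[X], p.natDegree < 2 ^ KJ → 
      ∑ i ∈ Finset.range (2 ^ KJ), (p.coeff i : ℝ) * x ^ i = p.eval₂ (Nat.castRingHom ℝ) x := by
    intro p hp
    rw [eval₂_eq_sum_range' _ hp]
    simp
  have hEr : pE.eval₂ (Nat.castRingHom ℝ) x = ev ((d + x) * (d + x)) El := by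
    have := ev_map (eval₂RingHom (Nat.castRingHom ℝ) x) (z * z) El
    simp only [coe_eval₂RingHom] at this
    rw [hpE, this]
    simp [hz]
  have hOr : pO.eval₂ (Nat.castRingHom ℝ) x = (d + x) * ev ((d + x) * (d + x)) Ol := by
    have := ev_map (eval₂RingHom (Nat.castRingHom ℝ) x) (z * z) Ol
    simp only [coe_eval₂RingHom] at this
    rw [hpO, eval₂_mul, this]
    simp [hz]
  have hQ : ∑ j ∈ Finset.range (J + 1), (c j : ℝ) * S ^ (J - j) * (-(d + x)) ^ j =
      pE.eval₂ (Nat.castRingHom ℝ) x - pO.eval₂ (Nat.castRingHom ℝ) x := by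
    have := h3' ℝ (-(d + x))
    rw [hEr, hOr]
    rw [neg_mul_neg] at this
    push_cast at this
    rw [← this]
    ring
  rw [hQ]
  -- adding err to the lowest digit
  have hadd : ∀ f : ℕ → ℕ, Nat.add (∑ i ∈ Finset.range (2 ^ KJ), f i * (2 ^ B) ^ i) err =
      ∑ i ∈ Finset.range (2 ^ KJ), (f i + if i = 0 then err else 0) * (2 ^ B) ^ i := by
    intro f
    simp only [add_mul, Finset.sum_add_distrib]
    congr 1
    rw [Finset.sum_eq_single 0]
    · simp
    · intro b _ hb; simp [hb]
    · intro hh; exfalso; apply hh; simp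
  have haddr : ∀ f : ℕ → ℕ, ∑ i ∈ Finset.range (2 ^ KJ), ((f i + if i = 0 then err else 0 : ℕ) : ℝ) * x ^ i =
      ∑ i ∈ Finset.range (2 ^ KJ), (f i : ℝ) * x ^ i + err := by
    intro f
    push_cast
    simp only [add_mul, Finset.sum_add_distrib]
    congr 1
    rw [Finset.sum_eq_single 0]
    · simp
    · intro b _ hb; simp [hb]
    · intro hh; exfalso; apply hh; simp
  rw [Nat.beq_eq, hadd, hadd] at h
  cases pos with
  | true =>
    have h5 := hor_le B wn wd hwd x hx0 hx1 KJ pE.coeff (fun i => pO.coeff i + if i = 0 then err else 0) 0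
      (fun i hi => by have := hbE i hi; omega)
      (fun i hi => by have := hbO i hi; split_ifs <;> omega)
    have h6 : hor B wn wd KJ (∑ i ∈ Finset.range (2 ^ KJ), pE.coeff i * (2 ^ B) ^ i)
      (∑ i ∈ Finset.range (2 ^ KJ), (pO.coeff i + if i = 0 then err else 0) * (2 ^ B) ^ i) 0 = 0 := h
    rw [h6, haddr, hreal _ hdegE, hreal _ hdegO] at h5
    simp at h5 ⊢
    linarith
  | false =>
    have h5 := hor_le B wn wd hwd x hx0 hx1 KJ pO.coeff (fun i => pE.coeff i + if i = 0 then err else 0) 0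
      (fun i hi => by have := hbO i hi; omega)
      (fun i hi => by have := hbE i hi; split_ifs <;> omega)
    have h6 : hor B wn wd KJ (∑ i ∈ Finset.range (2 ^ KJ), pO.coeff i * (2 ^ B) ^ i)
      (∑ i ∈ Finset.range (2 ^ KJ), (pE.coeff i + if i = 0 then err else 0) * (2 ^ B) ^ i) 0 = 0 := h
    rw [h6, haddr, hreal _ hdegE, hreal _ hdegO] at h5
    simp at h5 ⊢
    linarith

theorem loop_sound (f : ℕ → Bool) (m : ℕ) (h : loop f m = true) : ∀ i < m, f i = true := by
  induction m with
  | zero => intro i hi; omega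
  | succ m ih =>
    have h0 : loop f (m + 1) = Bool.rec (motive := fun _ => Bool) false (loop f m) (f m) := rfl
    rw [h0] at h
    intro i hi
    cases hfm : f m with
    | false => rw [hfm] at h; exact absurd h (by simp)
    | true =>
      rw [hfm] at h
      rcases Nat.lt_succ_iff_lt_or_eq.1 hi with h1 | h1
      · exact ih h i h1
      · rw [h1]; exact hfm

theorem digit_get (B N : ℕ) (f : ℕ → ℕ) (hf : ∀ i ≤ N, f i < 2 ^ B) (a i : ℕ) (hi : i < 32)
    (ha : a + i ≤ N) :
    lowb (Nat.shiftRight (lowb (Nat.shiftRight (∑ n ∈ Finset.range (N + 1), f n * (2 ^ B) ^ n)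
      (Nat.mul B a)) (Nat.mul B 32)) (Nat.mul B i)) B = f (a + i) := by
  change lowb ((lowb ((∑ n ∈ Finset.range (N + 1), f n * (2 ^ B) ^ n) >>> (B * a)) (B * 32))
    >>> (B * i)) B = _
  rw [lowb_eq, lowb_eq, Nat.shiftRight_eq_div_pow, Nat.shiftRight_eq_div_pow]
  have hX : 0 < 2 ^ B := by positivity
  rw [pow_mul, pow_mul, pow_mul]
  set X := 2 ^ B
  obtain ⟨r, hr⟩ : ∃ r, N + 1 = a + (i + (1 + r)) := ⟨N - a - i, by omega⟩
  have e32 : X ^ 32 = X ^ i * X ^ (32 - i) := by rw [← pow_add]; congr 1; omega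
  rw [e32, Nat.mod_mul_right_div_self, hr, digits_div X hX f _ _ (fun i hi => hf i (by omega)),
    digits_div X hX _ _ _ (fun i hi => hf _ (by omega))]
  have e1 : X ^ (32 - i) = X ^ 1 * X ^ (31 - i) := by rw [← pow_add]; congr 1; omega
  rw [e1, pow_one, Nat.mod_mul_right_mod]
  have := digits_mod X (fun j => f (a + (i + j))) 1 r (fun i hi => hf _ (by omega))
  rw [pow_one] at this
  rw [this]
  simp

theorem cell_sound (N K J KJ P B S d wn wd n0 errm nb : ℕ) (hN : N < 2 ^ K) (hwd : 0 < wd)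
    (hJ : J < 2 ^ KJ) (hnb : N < n0 + 32 * nb)
    (hb0 : ∀ j ≤ J, ∀ n ≤ N, ∑ k ∈ Finset.range (n + 1), sg k * bh P j (n - k) < 2 ^ B)
    (hb1 : ∀ j ≤ J, ∀ n ≤ N, bh P j n < 2 ^ B)
    (hb2 : ∀ n ≤ N, ∑ j ∈ Finset.range (J + 1), bh P j n * S ^ (J - j) * (d + 1) ^ j
      + errm * S ^ J < 2 ^ B)
    (h : cell N K J KJ P B S d wn wd n0 errm nb = true) (n : ℕ) (hn0 : n0 ≤ n) (hnN : n ≤ N)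
    (x : ℝ) (hx0 : 0 ≤ x) (hx1 : x * wd ≤ wn) :
    (errm * S ^ J : ℝ) ≤ (if n % 3 = 0 then 1 else -1) *
      ∑ j ∈ Finset.range (J + 1), (bh P j n : ℝ) * S ^ (J - j) * (-(d + x)) ^ j := by
  unfold cell at h
  simp only [midb_eq] at h
  rw [force_eq, force_eq] at h
  set v : ℕ → ℕ := fun j => ∑ n ∈ Finset.range (N + 1), bh P j n * (2 ^ B) ^ n with hv
  have hv0 : Nat.pow 2 P = v 0 := by
    simp only [hv]
    rw [Finset.sum_eq_single 0]
    · simp [bh]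
    · intro b _ hb; simp [bh, hb]
    · intro h; simp at h
  have hr := rows_eq (α := Bool) B N K (lowb (sigA B K K) (B * (N + 1))) v J 0
  have hr' := fun k => hr k (fun i hi => row_step B N K P i hN (hb0 i (by omega)))
  rw [hv0] at h
  have h' := (hr' _).symm.trans h
  clear h hr hr'
  have h2 := loop_sound _ _ h'
  have h3 := h2 ((n - n0) / 32) (by omega)
  rw [mapF_eq] at h3
  have h4 := loop_sound _ _ h3 ((n - n0) % 32) (Nat.mod_lt _ (by norm_num))
  have hn : Nat.add (Nat.add n0 (Nat.mul 32 ((n - n0) / 32))) ((n - n0) % 32) = n := by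
    change n0 + 32 * ((n - n0) / 32) + (n - n0) % 32 = n
    omega
  rw [mapF_eq, hn] at h4
  have hble : Nat.ble n N = true := by rw [Nat.ble_eq]; exact hnN
  rw [hble] at h4
  rw [map_lst, map_lst] at h4
  rw [lst_congr _ (fun j => bh P j n)] at h4
  · rw [Nat.zero_add] at h4
    have h4' : chk1 B KJ S d wn wd (errm * S ^ J) (Nat.beq (Nat.mod n 3) 0)
      (lst (fun j => bh P j n) (J + 1)) = true := h4
    have h5 := chk1_sound B KJ S d wn wd (errm * S ^ J) J _ (fun j => bh P j n) hwd hJ (hb2 n hnN) h4' x hx0 hx1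
    have hbeq : (Nat.beq (Nat.mod n 3) 0 = true) = (n % 3 = 0) := by
      rw [Nat.beq_eq]; rfl
    simp only [hbeq] at h5
    push_cast at h5
    exact h5
  · intro j hj
    have h6 := digit_get B N (bh P j) (hb1 j (by omega)) (n0 + 32 * ((n - n0) / 32)) ((n - n0) % 32)
      (Nat.mod_lt _ (by norm_num)) (by omega)
    refine Eq.trans h6 ?_
    congr 1



theorem cell_1 : cell 1462 11 70 7 340 768 9 2 2 1 158 (2 ^ 340) 41 = true := by decide +kernel
theorem cell_2 : cell 746 10 70 7 340 768 9 4 4 1 158 (2 ^ 340) 19 = true := by decide +kernel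
theorem cell_3 : cell 373 9 70 7 340 768 9 8 6 1 158 (2 ^ 340) 7 = true := by decide +kernel
theorem cell_4 : cell 213 8 70 7 340 768 9 14 5 1 158 (2 ^ 340) 2 = true := by decide +kernel
theorem cell_5 : cell 563 10 150 8 890 1248 1 2 9999 10000 158 (2 ^ 890) 13 = true := by
  decide +kernel


/-! ## Part B: the exact table and error bounds -/

/-- coefficients of `-L` -/
noncomputable def mm (k : ℕ) : ℝ := (sg k : ℝ) / k

theorem mm_nonneg (k : ℕ) : 0 ≤ mm k := by unfold mm; positivity

theorem sg_zero : sg 0 = 0 := by simp [sg]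

theorem mm_zero : mm 0 = 0 := by simp [mm]

/-- coefficients of the powers -/
noncomputable def cf (j n : ℕ) : ℝ := PowerSeries.coeff n ((PowerSeries.mk mm) ^ j)

/-- exact table -/
noncomputable def be (j n : ℕ) : ℝ := cf j n / j.factorial

theorem cf_zero (n : ℕ) : cf 0 n = if n = 0 then 1 else 0 := by
  simp [cf, PowerSeries.coeff_one]

theorem cf_succ (j n : ℕ) : cf (j + 1) n = ∑ p ∈ Finset.HasAntidiagonal.antidiagonal n, cf j p.1 * mm p.2 := by
  simp [cf, pow_succ, PowerSeries.coeff_mul]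

theorem cf_nonneg (j n : ℕ) : 0 ≤ cf j n := by
  induction j generalizing n with
  | zero => rw [cf_zero]; split_ifs <;> norm_num
  | succ j ih =>
    rw [cf_succ]
    exact Finset.sum_nonneg fun p _ => mul_nonneg (ih _) (mm_nonneg _)

theorem be_nonneg (j n : ℕ) : 0 ≤ be j n := div_nonneg (cf_nonneg _ _) (by positivity)

theorem cf_eq_zero (j n : ℕ) (h : n < j) : cf j n = 0 := by
  induction j generalizing n with
  | zero => omega
  | succ j ih =>
    rw [cf_succ]
    apply Finset.sum_eq_zero
    intro p hp
    have hp := Finset.HasAntidiagonal.mem_antidiagonal.1 hp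
    by_cases h2 : p.2 = 0
    · rw [h2, mm_zero, mul_zero]
    · rw [ih _ (by omega), zero_mul]

theorem be_rec (j n : ℕ) :
    (n : ℝ) * be (j + 1) n = ∑ k ∈ Finset.range (n + 1), (sg k : ℝ) * be j (n - k) := by
  cases n with
  | zero => simp [sg_zero]
  | succ n =>
    have h1 : PowerSeries.derivative ℝ ((PowerSeries.mk mm) ^ (j + 1)) =
        ((j + 1 : ℕ) : PowerSeries ℝ) * (PowerSeries.mk mm ^ j * PowerSeries.derivative ℝ (PowerSeries.mk mm)) := by
      rw [Derivation.leibniz_pow]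
      simp [nsmul_eq_mul]
    have h2 := congrArg (PowerSeries.coeff n) h1
    rw [PowerSeries.coeff_derivative] at h2
    rw [← nsmul_eq_mul, map_nsmul, PowerSeries.coeff_mul, nsmul_eq_mul] at h2
    have h3 : ∀ k, PowerSeries.coeff k (PowerSeries.derivative ℝ (PowerSeries.mk mm)) = sg (k + 1) := by
      intro k
      rw [PowerSeries.coeff_derivative, PowerSeries.coeff_mk, mm]
      push_cast
      field_simp
    simp only [h3] at h2
    change cf (j + 1) (n + 1) * _ = _ * ∑ p ∈ Finset.HasAntidiagonal.antidiagonal n, cf j p.1 * (sg (p.2 + 1) : ℝ) at h2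
    rw [Finset.sum_range_succ', sg_zero]
    simp only [Nat.cast_zero, zero_mul, add_zero]
    rw [← Finset.Nat.sum_antidiagonal_swap, Finset.Nat.sum_antidiagonal_eq_sum_range_succ_mk] at h2
    simp only [Prod.swap_prod_mk] at h2
    unfold be
    have h4 : ∀ k, (n + 1 - (k + 1)) = n - k := fun k => by omega
    simp only [h4, Nat.factorial_succ]
    have h5 : (j.factorial : ℝ) ≠ 0 := by positivity
    have h6 : ((j : ℝ) + 1) ≠ 0 := by positivity
    push_cast at h2 ⊢
    rw [mul_div_assoc', mul_comm _ (cf _ _), h2]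
    rw [mul_div_mul_left _ _ h6, Finset.sum_div]
    apply Finset.sum_congr rfl
    intro k _
    ring

/-- the truncated sum `Λ` -/
noncomputable def Lam (n : ℕ) (t : ℝ) : ℝ := ∑ k ∈ Finset.range (n + 1), mm k * Real.exp (-(k * t))

theorem Lam_nonneg (n : ℕ) (t : ℝ) : 0 ≤ Lam n t :=
  Finset.sum_nonneg fun k _ => mul_nonneg (mm_nonneg k) (Real.exp_pos _).le

theorem Lam_mono (t : ℝ) {a b : ℕ} (h : a ≤ b) : Lam a t ≤ Lam b t := by
  unfold Lam
  apply Finset.sum_le_sum_of_subset_of_nonneg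
  · intro x; simp; omega
  · intro k _ _; exact mul_nonneg (mm_nonneg k) (Real.exp_pos _).le

theorem cf_le (t : ℝ) (N j n : ℕ) (h : n ≤ N) : cf j n ≤ Real.exp (n * t) * Lam N t ^ j := by
  induction j generalizing n with
  | zero =>
    rw [cf_zero]
    split_ifs with h0
    · simp [h0]
    · positivity
  | succ j ih =>
    rw [cf_succ]
    calc ∑ p ∈ Finset.HasAntidiagonal.antidiagonal n, cf j p.1 * mm p.2
        ≤ ∑ p ∈ Finset.HasAntidiagonal.antidiagonal n, Real.exp (n * t) * Lam N t ^ j * (mm p.2 * Real.exp (-(p.2 * t))) := by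
          apply Finset.sum_le_sum
          intro p hp
          have hp := Finset.HasAntidiagonal.mem_antidiagonal.1 hp
          have h1 := mul_le_mul_of_nonneg_right (ih p.1 (by omega)) (mm_nonneg p.2)
          refine h1.trans (le_of_eq ?_)
          have : Real.exp (p.1 * t) = Real.exp (n * t) * Real.exp (-(p.2 * t)) := by
            rw [← Real.exp_add, ← hp]; congr 1; push_cast; ring
          rw [this]; ring
      _ = Real.exp (n * t) * Lam N t ^ j * Lam n t := by
          rw [← Finset.mul_sum, ← Finset.Nat.sum_antidiagonal_swap,
            Finset.Nat.sum_antidiagonal_eq_sum_range_succ_mk]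
          rfl
      _ ≤ Real.exp (n * t) * Lam N t ^ j * Lam N t := by
          apply mul_le_mul_of_nonneg_left (Lam_mono t h)
          have := Lam_nonneg N t
          positivity
      _ = _ := by ring

theorem be_le (t : ℝ) (N j n : ℕ) (h : n ≤ N) :
    be j n ≤ Real.exp (n * t) * (Lam N t ^ j / j.factorial) := by
  unfold be
  rw [← mul_div_assoc]
  exact div_le_div_of_nonneg_right (cf_le t N j n h) (by positivity)

theorem bh_le (P j n : ℕ) : (bh P j n : ℝ) ≤ 2 ^ P * be j n := by
  induction j generalizing n with
  | zero =>
    simp only [bh, be, cf_zero]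
    split_ifs <;> simp
  | succ j ih =>
    rcases Nat.eq_zero_or_pos n with h0 | h0
    · subst h0
      simp [bh]
      exact be_nonneg _ _
    · have hn : (0 : ℝ) < n := by exact_mod_cast h0
      have h1 : ((bh P (j + 1) n : ℕ) : ℝ) ≤ ((∑ k ∈ Finset.range (n + 1), sg k * bh P j (n - k) : ℕ) : ℝ) / n := by
        rw [bh]
        exact Nat.cast_div_le
      refine h1.trans ?_
      rw [div_le_iff₀ hn, mul_assoc, mul_comm (be _ _), be_rec, Finset.mul_sum]
      push_cast
      apply Finset.sum_le_sum
      intro k _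
      have := mul_le_mul_of_nonneg_left (ih (n - k)) (Nat.cast_nonneg (α := ℝ) (sg k))
      linarith

theorem bh_ge (t : ℝ) (ht : 0 ≤ t) (P N j n : ℕ) (h : n ≤ N) :
    2 ^ P * be j n - bh P j n ≤ Real.exp (n * t) * (1 + Lam N t) ^ j := by
  have hL := Lam_nonneg N t
  induction j generalizing n with
  | zero =>
    simp only [bh, be, cf_zero]
    split_ifs with h0
    · simp; positivity
    · simp; positivity
  | succ j ih =>
    rcases Nat.eq_zero_or_pos n with h0 | h0
    · subst h0
      simp [bh, be, cf_eq_zero (j + 1) 0 (by omega)]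
      positivity
    · have hn : (0 : ℝ) < n := by exact_mod_cast h0
      set Q := ∑ k ∈ Finset.range (n + 1), sg k * bh P j (n - k) with hQ
      have h1 : (Q : ℝ) / n ≤ bh P (j + 1) n + 1 := by
        rw [bh, ← hQ, div_le_iff₀ hn]
        have := Nat.lt_div_mul_add h0 (a := Q)
        have h2 : (Q : ℝ) < (Q / n : ℕ) * n + n := by exact_mod_cast this
        nlinarith
      have h2 : be (j + 1) n = (∑ k ∈ Finset.range (n + 1), (sg k : ℝ) * be j (n - k)) / n := by
        rw [← be_rec]; field_simp
      have h3 : 2 ^ P * be (j + 1) n - (Q : ℝ) / n ≤ Real.exp (n * t) * (1 + Lam N t) ^ j * Lam n t := by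
        rw [h2, hQ]
        push_cast
        rw [← mul_div_assoc, ← sub_div, Finset.mul_sum, ← Finset.sum_sub_distrib, Finset.sum_div, Lam.eq_def n t, Finset.mul_sum]
        apply Finset.sum_le_sum
        intro k hk
        have hk := Finset.mem_range.1 hk
        rcases Nat.eq_zero_or_pos k with hk0 | hk0
        · subst hk0; simp [sg_zero, mm_zero]
        have hkr : (0 : ℝ) < k := by exact_mod_cast hk0
        have hkn : (k : ℝ) ≤ n := by exact_mod_cast (by omega : k ≤ n)
        have e1 := ih (n - k) (by omega)
        have e2 : Real.exp ((n - k : ℕ) * t) = Real.exp (n * t) * Real.exp (-(k * t)) := by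
          rw [← Real.exp_add, Nat.cast_sub (by omega)]; congr 1; ring
        rw [e2] at e1
        have e3 : (2 ^ P * ((sg k : ℝ) * be j (n - k)) - sg k * bh P j (n - k)) / n =
          (sg k : ℝ) / n * (2 ^ P * be j (n - k) - bh P j (n - k)) := by ring
        rw [e3]
        have e4 : (sg k : ℝ) / n ≤ mm k := by
          unfold mm
          exact div_le_div_of_nonneg_left (by positivity) hkr hkn
        calc _ ≤ (sg k : ℝ) / n * (Real.exp (n * t) * Real.exp (-(k * t)) * (1 + Lam N t) ^ j) :=
              mul_le_mul_of_nonneg_left e1 (by positivity)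
          _ ≤ mm k * (Real.exp (n * t) * Real.exp (-(k * t)) * (1 + Lam N t) ^ j) :=
              mul_le_mul_of_nonneg_right e4 (by positivity)
          _ = _ := by ring
      have h4 : Real.exp (n * t) * (1 + Lam N t) ^ j * Lam n t ≤ Real.exp (n * t) * (1 + Lam N t) ^ j * Lam N t :=
        mul_le_mul_of_nonneg_left (Lam_mono t h) (by positivity)
      have h5 : 1 ≤ Real.exp (n * t) * (1 + Lam N t) ^ j := by
        apply one_le_mul_of_one_le_of_one_le
        · exact Real.one_le_exp (by positivity)
        · exact one_le_pow₀ (by linarith)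
      rw [pow_succ]
      nlinarith


theorem mm_eq (k : ℕ) (hk : 0 < k) :
    mm k = ∑ p ∈ k.divisorsAntidiagonal, if 3 ∣ p.1 then (0 : ℝ) else 1 / (p.2 : ℝ) := by
  have h1 : ∀ p ∈ k.divisorsAntidiagonal, (if 3 ∣ p.1 then (0 : ℝ) else 1 / (p.2 : ℝ)) =
      if 3 ∣ p.1 then (0 : ℝ) else (p.1 : ℝ) / k := by
    intro p hp
    obtain ⟨h1, h2⟩ := Nat.mem_divisorsAntidiagonal.1 hp
    have h3 : (p.1 : ℝ) * p.2 = k := by exact_mod_cast h1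
    have h4 : (k : ℝ) ≠ 0 := by positivity
    have h5 : (p.2 : ℝ) ≠ 0 := by
      intro h; rw [h, mul_zero] at h3; exact h4 h3.symm
    split_ifs
    · rfl
    · rw [div_eq_div_iff h5 h4, h3]; ring
  rw [Finset.sum_congr rfl h1,
    Nat.sum_divisorsAntidiagonal (n := k) (f := fun i _ : ℕ => if 3 ∣ i then (0 : ℝ) else (i : ℝ) / (k : ℝ)), mm, sg]
  rw [Nat.cast_sum]
  rw [Finset.sum_filter, Finset.sum_div]
  apply Finset.sum_congr rfl
  intro i _
  split_ifs <;> simp_all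

/-- the double family -/
noncomputable def dbl (q : ℂ) (p : ℕ+ × ℕ+) : ℂ :=
  if 3 ∣ (p.1 : ℕ) then 0 else q ^ ((p.1 : ℕ) * p.2) / (p.2 : ℂ)

/-- the real majorant -/
noncomputable def dbr (t : ℝ) (p : ℕ+ × ℕ+) : ℝ := Real.exp (-t) ^ ((p.1 : ℕ) * p.2) / (p.2 : ℝ)

theorem dbr_fiber (t : ℝ) (ht : 0 < t) (e : ℕ+) :
    HasSum (fun m : ℕ+ => dbr t (m, e)) (1 / ((e : ℝ) * (Real.exp (e * t) - 1))) := by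
  have he : (0 : ℝ) < e := by exact_mod_cast e.pos
  have h1 : Real.exp (-t) ^ (e : ℕ) < 1 := by
    rw [← Real.exp_nat_mul, Real.exp_lt_one_iff]
    nlinarith
  have h0 : 0 ≤ Real.exp (-t) ^ (e : ℕ) := by positivity
  have h2 := (hasSum_geometric_of_lt_one h0 h1).mul_left (Real.exp (-t) ^ (e : ℕ) / (e : ℝ))
  have h3 : Real.exp (-t) ^ (e : ℕ) / (e : ℝ) * (1 - Real.exp (-t) ^ (e : ℕ))⁻¹ =
      1 / ((e : ℝ) * (Real.exp (e * t) - 1)) := by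
    have h4 : Real.exp (-t) ^ (e : ℕ) = (Real.exp (e * t))⁻¹ := by
      rw [← Real.exp_nat_mul, ← Real.exp_neg]; congr 1; ring
    have h5 : 1 < Real.exp (e * t) := Real.one_lt_exp_iff.2 (by positivity)
    rw [h4]
    have h6 : Real.exp (e * t) - 1 ≠ 0 := by linarith
    field_simp
  rw [h3] at h2
  rw [← Equiv.pnatEquivNat.symm.hasSum_iff]
  convert! h2 using 1
  funext n
  simp only [Function.comp, dbr, Equiv.pnatEquivNat_symm_apply, Nat.succPNat_coe]
  rw [Nat.succ_eq_add_one, mul_comm (n + 1), pow_mul, pow_succ]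
  ring

theorem dbr_fiber_le (t : ℝ) (ht : 0 < t) (e : ℕ+) :
    1 / ((e : ℝ) * (Real.exp (e * t) - 1)) ≤ 1 / t * (1 / (e : ℝ) ^ 2) := by
  have he : (0 : ℝ) < e := by exact_mod_cast e.pos
  have h1 := Real.add_one_le_exp (e * t)
  rw [one_div_mul_one_div]
  apply one_div_le_one_div_of_le (by positivity)
  nlinarith

theorem hasSum_pnat_zeta : HasSum (fun e : ℕ+ => 1 / (e : ℝ) ^ 2) (Real.pi ^ 2 / 6) := by
  have h := hasSum_zeta_two
  rw [← Equiv.pnatEquivNat.symm.hasSum_iff]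
  have h2 := (hasSum_nat_add_iff' 1).2 h
  simp at h2
  convert! h2 using 1
  funext n
  simp [Function.comp]

theorem dbr_summable (t : ℝ) (ht : 0 < t) : Summable (dbr t) := by
  rw [← (Equiv.prodComm ℕ+ ℕ+).summable_iff]
  rw [summable_prod_of_nonneg]
  · refine ⟨fun e => ?_, ?_⟩
    · exact (dbr_fiber t ht e).summable
    · refine Summable.of_nonneg_of_le (fun e => ?_) (fun e => ?_)
        (hasSum_pnat_zeta.summable.mul_left (1 / t))
      · exact tsum_nonneg fun m => by simp [dbr]; positivity
      · refine le_trans (le_of_eq ?_) (dbr_fiber_le t ht e)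
        exact (dbr_fiber t ht e).tsum_eq
  · intro p; simp [dbr]; positivity

theorem dbr_tsum_le (t : ℝ) (ht : 0 < t) : ∑' p, dbr t p ≤ 1.645 / t := by
  rw [← (Equiv.prodComm ℕ+ ℕ+).tsum_eq]
  have hs := (Equiv.prodComm ℕ+ ℕ+).summable_iff.2 (dbr_summable t ht)
  change ∑' c : ℕ+ × ℕ+, (dbr t ∘ (Equiv.prodComm ℕ+ ℕ+)) c ≤ _
  rw [Summable.tsum_prod hs]
  have h1 : ∀ e : ℕ+, ∑' m : ℕ+, (dbr t ((Equiv.prodComm ℕ+ ℕ+) (e, m))) ≤ 1 / t * (1 / (e : ℝ) ^ 2) := by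
    intro e
    refine le_trans (le_of_eq ?_) (dbr_fiber_le t ht e)
    exact (dbr_fiber t ht e).tsum_eq
  refine (Summable.tsum_le_tsum h1 hs.prod (hasSum_pnat_zeta.summable.mul_left (1 / t))).trans ?_
  rw [tsum_mul_left, hasSum_pnat_zeta.tsum_eq]
  have hpi : Real.pi ^ 2 / 6 ≤ 1.645 := by
    have := Real.pi_lt_d6
    have := Real.pi_pos
    nlinarith
  rw [one_div_mul_eq_div]
  exact div_le_div_of_nonneg_right hpi ht.le

theorem dbl_norm_le (q : ℂ) (t : ℝ) (hq : ‖q‖ ≤ Real.exp (-t)) (p : ℕ+ × ℕ+) :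
    ‖dbl q p‖ ≤ dbr t p := by
  unfold dbl dbr
  split_ifs
  · simp; positivity
  · rw [norm_div, norm_pow, Complex.norm_natCast]
    gcongr

/-- fibers over the product -/
theorem dbl_fiber (q : ℂ) (k : ℕ+) :
    ∑ x : (k : ℕ).divisorsAntidiagonal, dbl q (divisorsAntidiagonalFactors k x) = (mm k : ℂ) * q ^ (k : ℕ) := by
  rw [mm_eq k k.pos]
  push_cast
  rw [Finset.sum_mul, ← Finset.sum_coe_sort (k : ℕ).divisorsAntidiagonal]
  apply Finset.sum_congr rfl
  intro x _
  have h := (Nat.mem_divisorsAntidiagonal.1 x.2).1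
  simp only [dbl, divisorsAntidiagonalFactors, PNat.mk_coe]
  by_cases h3 : 3 ∣ x.1.1
  · refine (if_pos h3).trans ?_
    rw [if_pos h3]; simp
  · refine (if_neg h3).trans ?_
    rw [if_neg h3, h]; push_cast; ring

theorem dbl_hasSum (q : ℂ) (hs : Summable (dbl q)) :
    HasSum (fun k : ℕ => (mm k : ℂ) * q ^ k) (∑' p, dbl q p) := by
  have h1 := sigmaAntidiagonalEquivProd.hasSum_iff.2 hs.hasSum
  have h2 := h1.sigma (g := fun k : ℕ+ => (mm k : ℂ) * q ^ (k : ℕ)) (fun k => by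
    rw [← dbl_fiber]
    exact hasSum_fintype _)
  rw [← Equiv.pnatEquivNat.symm.hasSum_iff] at h2
  rw [← hasSum_nat_add_iff' 1]
  simp [mm_zero]
  convert! h2 using 1

/-- the logarithm of the product -/
noncomputable def LL (q : ℂ) : ℂ :=
  ∑' m : ℕ, if 3 ∣ (m + 1) then 0 else Complex.log (1 - q ^ (m + 1))

theorem exists_t (q : ℂ) (hq : ‖q‖ < 1) : ∃ t : ℝ, 0 < t ∧ ‖q‖ ≤ Real.exp (-t) := by
  refine ⟨(1 - ‖q‖), by linarith, ?_⟩
  have := Real.add_one_le_exp (-(1 - ‖q‖))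
  linarith

theorem dbl_summable (q : ℂ) (hq : ‖q‖ < 1) : Summable (dbl q) := by
  obtain ⟨t, ht, h⟩ := exists_t q hq
  exact Summable.of_norm_bounded (dbr_summable t ht) (dbl_norm_le q t h)

theorem dbl_fiber_log (q : ℂ) (hq : ‖q‖ < 1) (m : ℕ+) :
    HasSum (fun e : ℕ+ => dbl q (m, e)) (-(if 3 ∣ (m : ℕ) then 0 else Complex.log (1 - q ^ (m : ℕ)))) := by
  by_cases h : 3 ∣ (m : ℕ)
  · simp [dbl, h, hasSum_zero]
  · rw [if_neg h]
    have h1 : ‖q ^ (m : ℕ)‖ < 1 := by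
      rw [norm_pow]; exact pow_lt_one₀ (norm_nonneg _) hq m.ne_zero
    rw [← Equiv.pnatEquivNat.symm.hasSum_iff]
    convert! Complex.hasSum_taylorSeries_neg_log' h1 using 1
    funext n
    simp [Function.comp, dbl, h, pow_mul]

theorem LL_hasSum' (q : ℂ) (hq : ‖q‖ < 1) :
    HasSum (fun m : ℕ => if 3 ∣ (m + 1) then 0 else Complex.log (1 - q ^ (m + 1)))
      (-∑' p, dbl q p) := by
  have h := (dbl_summable q hq).hasSum.prod_fiberwise (dbl_fiber_log q hq)
  rw [← Equiv.pnatEquivNat.symm.hasSum_iff] at h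
  have := h.neg
  convert! this using 1
  funext n
  simp [Function.comp]

theorem LL_eq (q : ℂ) (hq : ‖q‖ < 1) : LL q = -∑' p, dbl q p := (LL_hasSum' q hq).tsum_eq

theorem LL_hasSum (q : ℂ) (hq : ‖q‖ < 1) : HasSum (fun k : ℕ => (mm k : ℂ) * q ^ k) (-LL q) := by
  rw [LL_eq q hq, neg_neg]
  exact dbl_hasSum q (dbl_summable q hq)

/-- real version -/
theorem mm_hasSum (t : ℝ) (ht : 0 < t) : ∃ s : ℝ, s ≤ 1.645 / t ∧
    HasSum (fun k : ℕ => mm k * Real.exp (-(k * t))) s := by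
  have hq : ‖((Real.exp (-t) : ℝ) : ℂ)‖ < 1 := by
    rw [Complex.norm_real, Real.norm_of_nonneg (Real.exp_pos _).le, Real.exp_lt_one_iff]; linarith
  have h := LL_hasSum _ hq
  have hterm : ∀ k : ℕ, (mm k : ℂ) * ((Real.exp (-t) : ℝ) : ℂ) ^ k = ((mm k * Real.exp (-(k * t)) : ℝ) : ℂ) := by
    intro k
    push_cast
    rw [← Complex.exp_nat_mul]
    congr 2; ring
  simp only [hterm] at h
  have h2 := Complex.hasSum_re h
  simp only [Complex.ofReal_re] at h2
  refine ⟨_, ?_, h2⟩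
  refine (Complex.re_le_norm _).trans ?_
  rw [LL_eq _ hq, neg_neg]
  refine (norm_tsum_le_tsum_norm ?_).trans ?_
  · exact (dbl_summable _ hq).norm
  · refine le_trans ?_ (dbr_tsum_le t ht)
    refine Summable.tsum_le_tsum (dbl_norm_le _ t ?_) (dbl_summable _ hq).norm (dbr_summable t ht)
    rw [Complex.norm_real, Real.norm_of_nonneg (Real.exp_pos _).le]

theorem Lam_le (n : ℕ) (t : ℝ) (ht : 0 < t) : Lam n t ≤ 1.645 / t := by
  obtain ⟨s, h1, h2⟩ := mm_hasSum t ht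
  refine le_trans ?_ h1
  exact sum_le_hasSum _ (fun k _ => mul_nonneg (mm_nonneg k) (Real.exp_pos _).le) h2


/-- point of the disc -/
noncomputable def qq (x y : ℝ) : ℂ := Complex.exp (2 * Real.pi * Complex.I * (x + Complex.I * y))

theorem qq_norm (x y : ℝ) : ‖qq x y‖ = Real.exp (-(2 * Real.pi * y)) := by
  rw [qq, Complex.norm_exp]
  congr 1
  simp [Complex.mul_re, Complex.mul_im]

theorem qq_norm_lt (x y : ℝ) (hy : 0 < y) : ‖qq x y‖ < 1 := by
  rw [qq_norm, Real.exp_lt_one_iff]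
  have := Real.pi_pos
  have : 0 < 2 * Real.pi * y := by positivity
  linarith

theorem qq_pow (x y : ℝ) (m : ℕ) : qq x y ^ m =
    (Real.exp (-(2 * Real.pi * y)) ^ m : ℝ) * Complex.exp ((2 * Real.pi * Complex.I * m) * x) := by
  rw [qq, ← Complex.exp_nat_mul]
  push_cast
  rw [← Complex.exp_nat_mul, ← Complex.exp_add]
  congr 1
  linear_combination (2 * (Real.pi : ℂ) * m * y) * Complex.I_sq

theorem int_char (k : ℤ) : ∫ x in (0 : ℝ)..1, Complex.exp ((2 * Real.pi * Complex.I * k) * x) =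
    if k = 0 then 1 else 0 := by
  split_ifs with h
  · simp [h]
  · have h1 : (2 * Real.pi * Complex.I * k : ℂ) ≠ 0 := by
      have : (k : ℂ) ≠ 0 := by exact_mod_cast h
      have h3 := Complex.I_ne_zero
      have h4 : (Real.pi : ℂ) ≠ 0 := by exact_mod_cast Real.pi_ne_zero
      simp [h3, h4, h]
    rw [integral_exp_mul_complex h1]
    have h2 : Complex.exp (2 * Real.pi * Complex.I * k) = 1 := by
      rw [Complex.exp_eq_one_iff]
      exact ⟨k, by ring⟩
    simp [h2]

theorem coef_int (a : ℕ → ℂ) (F : ℂ → ℂ)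
    (h : ∀ q : ℂ, ‖q‖ < 1 → HasSum (fun m => a m * q ^ m) (F q)) (y : ℝ) (hy : 0 < y) (n : ℕ) :
    a n * (Real.exp (-(2 * Real.pi * y)) ^ n : ℝ) =
      ∫ x in (0 : ℝ)..1, F (qq x y) * Complex.exp (-(2 * Real.pi * Complex.I * n) * x) := by
  set r := Real.exp (-(2 * Real.pi * y)) with hr
  have hr0 : 0 < r := Real.exp_pos _
  have hr1 : r < 1 := by
    rw [hr, Real.exp_lt_one_iff]
    have := Real.pi_pos
    have : 0 < 2 * Real.pi * y := by positivity
    linarith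
  have hs : Summable (fun m => ‖a m‖ * r ^ m) := by
    have := (h (r : ℂ) (by rw [Complex.norm_real, Real.norm_of_nonneg hr0.le]; exact hr1)).summable.norm
    simpa [abs_of_pos hr0] using this
  let f : ℕ → C(ℝ, ℂ) := fun m => ⟨fun x => a m * (r ^ m : ℝ) *
    Complex.exp ((2 * Real.pi * Complex.I * ((m : ℤ) - (n : ℤ) : ℤ)) * x), by fun_prop⟩
  have hnorm : ∀ m x, ‖f m x‖ = ‖a m‖ * r ^ m := by
    intro m x
    simp only [f, ContinuousMap.coe_mk]
    rw [norm_mul, norm_mul, Complex.norm_real, Real.norm_of_nonneg (by positivity), Complex.norm_exp]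
    simp [Complex.mul_re, Complex.mul_im]
  have hInteg := intervalIntegral.hasSum_intervalIntegral_of_summable_norm (a := 0) (b := 1) (f := f) (by
    refine Summable.of_nonneg_of_le (fun m => norm_nonneg _) (fun m => ?_) hs
    rw [ContinuousMap.norm_le _ (by positivity)]
    intro x
    exact le_of_eq (hnorm m _))
  have h1 : ∀ m, ∫ x in (0 : ℝ)..1, f m x = if m = n then a n * (r ^ n : ℝ) else 0 := by
    intro m
    simp only [f, ContinuousMap.coe_mk]
    rw [intervalIntegral.integral_const_mul, int_char]
    by_cases hm : m = n
    · subst hm; simp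
    · rw [if_neg (by omega), if_neg hm, mul_zero]
  have h2 : ∀ x : ℝ, ∑' m, f m x = F (qq x y) * Complex.exp (-(2 * Real.pi * Complex.I * n) * x) := by
    intro x
    have := ((h (qq x y) (qq_norm_lt x y hy)).mul_right
      (Complex.exp (-(2 * Real.pi * Complex.I * n) * x))).tsum_eq
    rw [← this]
    congr 1
    ext m
    simp only [f, ContinuousMap.coe_mk]
    rw [qq_pow]
    have e : Complex.exp ((2 * Real.pi * Complex.I * ((m : ℤ) - (n : ℤ) : ℤ)) * x) =
        Complex.exp ((2 * Real.pi * Complex.I * m) * x) *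
        Complex.exp (-(2 * Real.pi * Complex.I * n) * x) := by
      rw [← Complex.exp_add]
      congr 1
      push_cast
      ring
    rw [e]
    ring
  simp only [h1, h2] at hInteg
  have h3 := hInteg.unique (hasSum_ite_eq n (a n * (r ^ n : ℝ)))
  exact h3.symm

theorem coef_unique (a b : ℕ → ℂ) (F : ℂ → ℂ)
    (ha : ∀ q : ℂ, ‖q‖ < 1 → HasSum (fun m => a m * q ^ m) (F q))
    (hb : ∀ q : ℂ, ‖q‖ < 1 → HasSum (fun m => b m * q ^ m) (F q)) : a = b := by
  funext n
  have h1 := coef_int a F ha 1 one_pos n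
  rw [← coef_int b F hb 1 one_pos n] at h1
  refine mul_right_cancel₀ ?_ h1
  exact_mod_cast (pow_pos (Real.exp_pos _) n).ne'

theorem cf_hasSum (q : ℂ) (hq : ‖q‖ < 1) (j : ℕ) :
    HasSum (fun n => (cf j n : ℂ) * q ^ n) ((-LL q) ^ j) := by
  induction j with
  | zero =>
    simp only [cf_zero, pow_zero]
    convert! hasSum_ite_eq (0 : ℕ) (1 : ℂ) using 1
    funext n
    by_cases h : n = 0 <;> simp [h]
  | succ j ih =>
    have hm := LL_hasSum q hq
    have h1 := tsum_mul_tsum_eq_tsum_sum_antidiagonal_of_summable_norm ih.summable.norm hm.summable.norm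
    have h2 := (summable_norm_sum_mul_antidiagonal_of_summable_norm ih.summable.norm hm.summable.norm).of_norm.hasSum
    rw [← h1, ih.tsum_eq, hm.tsum_eq] at h2
    rw [pow_succ]
    convert! h2 using 1
    funext n
    rw [cf_succ]
    push_cast
    rw [Finset.sum_mul]
    apply Finset.sum_congr rfl
    intro p hp
    rw [← Finset.HasAntidiagonal.mem_antidiagonal.1 hp, pow_add]
    ring

theorem cf_hasSum_real (t : ℝ) (ht : 0 < t) : ∃ s : ℝ, 0 ≤ s ∧ ∀ j,
    HasSum (fun n => cf j n * Real.exp (-t) ^ n) (s ^ j) := by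
  have hq : ‖((Real.exp (-t) : ℝ) : ℂ)‖ < 1 := by
    rw [Complex.norm_real, Real.norm_of_nonneg (Real.exp_pos _).le, Real.exp_lt_one_iff]; linarith
  have h1 := LL_hasSum _ hq
  have h2 : HasSum (fun k : ℕ => mm k * Real.exp (-t) ^ k) (∑' k : ℕ, mm k * Real.exp (-t) ^ k) := by
    apply Summable.hasSum
    have := h1.summable
    have h3 : ∀ k : ℕ, (mm k : ℂ) * ((Real.exp (-t) : ℝ) : ℂ) ^ k = ((mm k * Real.exp (-t) ^ k : ℝ) : ℂ) := by
      intro k; push_cast; rfl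
    simp only [h3] at this
    exact_mod_cast this
  set s := ∑' k : ℕ, mm k * Real.exp (-t) ^ k
  have hs : 0 ≤ s := tsum_nonneg fun k => mul_nonneg (mm_nonneg k) (by positivity)
  have h4 : -LL ((Real.exp (-t) : ℝ) : ℂ) = (s : ℂ) := by
    apply h1.unique
    have := Complex.hasSum_ofReal.2 h2
    push_cast at this ⊢
    exact this
  refine ⟨s, hs, fun j => ?_⟩
  have h5 := cf_hasSum _ hq j
  rw [h4] at h5
  have h6 : HasSum (fun n => ((cf j n * Real.exp (-t) ^ n : ℝ) : ℂ)) ((s ^ j : ℝ) : ℂ) := by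
    push_cast
    push_cast at h5
    exact h5
  exact Complex.hasSum_ofReal.1 h6

theorem exp_series (δ : ℝ) (q : ℂ) (hq : ‖q‖ < 1) :
    HasSum (fun n => ((∑ j ∈ Finset.range (n + 1), (-δ) ^ j * be j n : ℝ) : ℂ) * q ^ n)
      (Complex.exp (δ * LL q)) := by
  obtain ⟨t, ht, hqt⟩ := exists_t q hq
  obtain ⟨s, hs0, hs⟩ := cf_hasSum_real t ht
  let u : ℕ × ℕ → ℂ := fun p => (((-δ) ^ p.1 * be p.1 p.2 : ℝ) : ℂ) * q ^ p.2
  let v : ℕ × ℕ → ℝ := fun p => |δ| ^ p.1 * be p.1 p.2 * Real.exp (-t) ^ p.2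
  have hv : Summable v := by
    rw [summable_prod_of_nonneg]
    · have hj : ∀ j, HasSum (fun n => v (j, n)) ((|δ| * s) ^ j / j.factorial) := by
        intro j
        have := (hs j).mul_left (|δ| ^ j / j.factorial)
        convert! this using 1
        · funext n; simp only [v, be]; ring
        · ring
      refine ⟨fun j => (hj j).summable, ?_⟩
      simp only [(hj _).tsum_eq]
      exact Real.summable_pow_div_factorial _
    · intro p
      have := be_nonneg p.1 p.2
      simp only [v]
      positivity
  have hu : Summable u := by
    refine Summable.of_norm_bounded hv (fun p => ?_)
    simp only [u, v]
    rw [norm_mul, Complex.norm_real, norm_mul, norm_pow, norm_neg, Real.norm_eq_abs,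
      Real.norm_of_nonneg (be_nonneg _ _), norm_pow]
    have := be_nonneg p.1 p.2
    gcongr
  have h1 : HasSum (fun j : ℕ => (δ * LL q) ^ j / j.factorial) (∑' p, u p) := by
    refine hu.hasSum.prod_fiberwise (fun j => ?_)
    have := (cf_hasSum q hq j).mul_left ((-δ : ℂ) ^ j / j.factorial)
    convert! this using 1
    · funext n; simp only [u, be]; push_cast; ring
    · rw [div_mul_eq_mul_div, ← mul_pow, neg_mul_neg]
  have h2 : Complex.exp (δ * LL q) = ∑' p, u p := by
    refine HasSum.unique ?_ h1
    rw [Complex.exp_eq_exp_ℂ]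
    exact NormedSpace.expSeries_div_hasSum_exp _
  rw [h2]
  have h3 := (Equiv.prodComm ℕ ℕ).hasSum_iff.2 hu.hasSum
  refine h3.prod_fiberwise (fun n => ?_)
  have h4 := hasSum_sum_of_ne_finset_zero (s := Finset.range (n + 1))
    (f := fun j => u (j, n)) (L := .unconditional ℕ) (fun j hj => by
      have : n < j := by simpa using hj
      simp [u, be, cf_eq_zero j n this])
  convert! h4 using 1
  simp only [u]
  push_cast
  rw [Finset.sum_mul]

theorem c_eq (δ : ℝ) (c : ℕ → ℝ) (hc : ∀ q : ℂ, ‖q‖ < 1 →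
      HasSum (fun m : ℕ => (c m : ℂ) * q ^ m) (Complex.exp ((δ : ℂ) * LL q))) (n : ℕ) :
    c n = ∑ j ∈ Finset.range (n + 1), (-δ) ^ j * be j n := by
  have := coef_unique _ _ _ hc (exp_series δ)
  have := congrFun this n
  exact_mod_cast this


theorem exp_le_two_pow (x : ℝ) (k : ℕ) (h : x ≤ k * 0.6931471803) : Real.exp x ≤ 2 ^ k := by
  have h1 := Real.log_two_gt_d9
  have h2 : x ≤ k * Real.log 2 := by
    refine h.trans (mul_le_mul_of_nonneg_left ?_ (Nat.cast_nonneg k))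
    linarith
  calc Real.exp x ≤ Real.exp (k * Real.log 2) := Real.exp_le_exp.2 h2
    _ = 2 ^ k := by rw [Real.exp_nat_mul, Real.exp_log (by norm_num)]

theorem bh_digit (N P a j n : ℕ) (t : ℝ) (ht : 0 < t) (h : n ≤ N)
    (ha : N * t + 1.645 / t ≤ a * 0.6931471803) : bh P j n ≤ 2 ^ (P + a) := by
  have h1 := bh_le P j n
  have h2 := be_le t N j n h
  have h3 : Lam N t ^ j / j.factorial ≤ Real.exp (1.645 / t) :=
    (Real.pow_div_factorial_le_exp _ (Lam_nonneg N t) j).trans (Real.exp_le_exp.2 (Lam_le N t ht))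
  have h4 : Real.exp (n * t) ≤ Real.exp (N * t) := by
    apply Real.exp_le_exp.2
    have : (n : ℝ) ≤ N := by exact_mod_cast h
    exact mul_le_mul_of_nonneg_right this ht.le
  have h5 := exp_le_two_pow _ a ha
  rw [Real.exp_add] at h5
  have h6 : be j n ≤ 2 ^ a := by
    refine h2.trans (le_trans ?_ h5)
    have := Lam_nonneg N t
    gcongr
  have h7 : (bh P j n : ℝ) ≤ ((2 ^ (P + a) : ℕ) : ℝ) := by
    push_cast
    rw [pow_add]
    refine h1.trans (mul_le_mul_of_nonneg_left h6 (by positivity))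
  exact_mod_cast h7

theorem bh_sum (N P a j n B : ℕ) (h : n ≤ N) (h1 : bh P (j + 1) n ≤ 2 ^ (P + a))
    (hB : N * (2 ^ (P + a) + 1) < 2 ^ B) :
    ∑ k ∈ Finset.range (n + 1), sg k * bh P j (n - k) < 2 ^ B := by
  rcases Nat.eq_zero_or_pos n with h0 | h0
  · subst h0; simp [sg_zero]
  · set Q := ∑ k ∈ Finset.range (n + 1), sg k * bh P j (n - k) with hQ
    have h2 := Nat.lt_div_mul_add h0 (a := Q)
    have h3 : bh P (j + 1) n = Q / n := by rw [bh]
    rw [← h3] at h2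
    calc Q ≤ (bh P (j + 1) n + 1) * n := by nlinarith
      _ ≤ (2 ^ (P + a) + 1) * N := Nat.mul_le_mul (by omega) h
      _ < 2 ^ B := by rw [mul_comm]; exact hB

theorem bh_poly (J P a n M S d B : ℕ) (hS : S ≤ M) (hd : d + 1 ≤ M)
    (h1 : ∀ j, bh P j n ≤ 2 ^ (P + a))
    (hB : (J + 1) * (2 ^ (P + a) * M ^ J) + 2 ^ P * S ^ J < 2 ^ B) :
    ∑ j ∈ Finset.range (J + 1), bh P j n * S ^ (J - j) * (d + 1) ^ j + 2 ^ P * S ^ J < 2 ^ B := by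
  refine lt_of_le_of_lt (Nat.add_le_add_right ?_ _) hB
  calc _ ≤ ∑ j ∈ Finset.range (J + 1), 2 ^ (P + a) * M ^ J := by
        apply Finset.sum_le_sum
        intro j hj
        have hj := Finset.mem_range.1 hj
        have : M ^ J = M ^ (J - j) * M ^ j := by rw [← pow_add]; congr 1; omega
        rw [this, ← mul_assoc]
        exact Nat.mul_le_mul (Nat.mul_le_mul (h1 j) (Nat.pow_le_pow_left hS _)) (Nat.pow_le_pow_left hd _)
    _ = _ := by simp

theorem err_bound (δ t a b ρ E : ℝ) (hδ : 0 < δ) (ht : 0 < t) (P J n : ℕ) (hJ : J ≤ n)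
    (ha : δ * (1 + Lam n t) ≤ a) (hb : δ * Lam n t ≤ b) (hρ : 0 < ρ) (hbρ : b < ρ)
    (hE : Real.exp (n * t) ≤ E) :
    |∑ j ∈ Finset.range (J + 1), (bh P j n : ℝ) * (-δ) ^ j -
      2 ^ P * ∑ j ∈ Finset.range (n + 1), (-δ) ^ j * be j n| ≤
    E * ∑ j ∈ Finset.range (J + 1), a ^ j + 2 ^ P * (E * (Real.exp ρ * ((b / ρ) ^ (J + 1) / (1 - b / ρ)))) := by
  have hL := Lam_nonneg n t
  have hb0 : 0 ≤ b := le_trans (by positivity) hb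
  have hE0 : 0 ≤ E := (Real.exp_pos _).le.trans hE
  have hsplit : ∑ j ∈ Finset.range (n + 1), (-δ) ^ j * be j n =
      ∑ j ∈ Finset.range (J + 1), (-δ) ^ j * be j n +
      ∑ i ∈ Finset.range (n - J), (-δ) ^ (J + 1 + i) * be (J + 1 + i) n := by
    rw [← Finset.sum_range_add]; congr 2; omega
  have h1 : |∑ j ∈ Finset.range (J + 1), (bh P j n : ℝ) * (-δ) ^ j -
      2 ^ P * ∑ j ∈ Finset.range (J + 1), (-δ) ^ j * be j n| ≤ E * ∑ j ∈ Finset.range (J + 1), a ^ j := by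
    rw [Finset.mul_sum, ← Finset.sum_sub_distrib, Finset.mul_sum]
    refine (Finset.abs_sum_le_sum_abs _ _).trans (Finset.sum_le_sum fun j _ => ?_)
    have e : (bh P j n : ℝ) * (-δ) ^ j - 2 ^ P * ((-δ) ^ j * be j n) =
      -((-δ) ^ j * (2 ^ P * be j n - bh P j n)) := by ring
    rw [e, abs_neg, abs_mul, abs_pow, abs_neg, abs_of_pos hδ, abs_of_nonneg (by linarith [bh_le P j n])]
    have h2 := bh_ge t ht.le P n j n le_rfl
    calc _ ≤ δ ^ j * (Real.exp (n * t) * (1 + Lam n t) ^ j) := mul_le_mul_of_nonneg_left h2 (by positivity)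
      _ = Real.exp (n * t) * (δ * (1 + Lam n t)) ^ j := by rw [mul_pow]; ring
      _ ≤ E * a ^ j := by gcongr
  have h2 : |∑ i ∈ Finset.range (n - J), (-δ) ^ (J + 1 + i) * be (J + 1 + i) n| ≤
      E * (Real.exp ρ * ((b / ρ) ^ (J + 1) / (1 - b / ρ))) := by
    have hz0 : 0 ≤ b / ρ := by positivity
    have hz1 : b / ρ < 1 := (div_lt_one hρ).2 hbρ
    have hg : ∑ i ∈ Finset.range (n - J), (b / ρ) ^ i ≤ (1 - b / ρ)⁻¹ :=
      sum_le_hasSum _ (fun i _ => by positivity) (hasSum_geometric_of_lt_one hz0 hz1)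
    calc _ ≤ ∑ i ∈ Finset.range (n - J), |(-δ) ^ (J + 1 + i) * be (J + 1 + i) n| := Finset.abs_sum_le_sum_abs _ _
      _ ≤ ∑ i ∈ Finset.range (n - J), E * (Real.exp ρ * (b / ρ) ^ (J + 1)) * (b / ρ) ^ i := by
        apply Finset.sum_le_sum
        intro i _
        set j := J + 1 + i with hj
        rw [abs_mul, abs_pow, abs_neg, abs_of_pos hδ, abs_of_nonneg (be_nonneg _ _)]
        calc _ ≤ δ ^ j * (Real.exp (n * t) * (Lam n t ^ j / j.factorial)) :=
              mul_le_mul_of_nonneg_left (be_le t n j n le_rfl) (by positivity)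
          _ = Real.exp (n * t) * ((δ * Lam n t) ^ j / j.factorial) := by rw [mul_pow]; ring
          _ ≤ E * (b ^ j / j.factorial) := by gcongr
          _ = E * ((ρ ^ j / j.factorial) * (b / ρ) ^ j) := by
              rw [div_pow]; field_simp
          _ ≤ E * (Real.exp ρ * (b / ρ) ^ j) := by
              gcongr
              exact Real.pow_div_factorial_le_exp _ hρ.le j
          _ = _ := by rw [hj, pow_add]; ring
      _ = E * (Real.exp ρ * (b / ρ) ^ (J + 1)) * ∑ i ∈ Finset.range (n - J), (b / ρ) ^ i := by
        rw [Finset.mul_sum]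
      _ ≤ E * (Real.exp ρ * (b / ρ) ^ (J + 1)) * (1 - b / ρ)⁻¹ := by gcongr
      _ = _ := by ring
  rw [hsplit]
  have e2 : ∀ x y z : ℝ, x - 2 ^ P * (y + z) = (x - 2 ^ P * y) - 2 ^ P * z := by intros; ring
  rw [e2]
  refine (abs_sub _ _).trans (add_le_add h1 ?_)
  rw [abs_mul, abs_of_pos (by positivity)]
  exact mul_le_mul_of_nonneg_left h2 (by positivity)

/-- sign from a successful cell -/
theorem cell_sign (N K J KJ P B S d wn wd nb a M : ℕ) (t : ℝ) (ht : 0 < t)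
    (hN : N < 2 ^ K) (hwd : 0 < wd) (hJ : J < 2 ^ KJ) (hnb : N < 158 + 32 * nb) (hS0 : 0 < S)
    (ha : N * t + 1.645 / t ≤ a * 0.6931471803)
    (hS : S ≤ M) (hd : d + 1 ≤ M)
    (hB1 : N * (2 ^ (P + a) + 1) < 2 ^ B)
    (hB2 : (J + 1) * (2 ^ (P + a) * M ^ J) + 2 ^ P * S ^ J < 2 ^ B)
    (hB3 : 2 ^ (P + a) < 2 ^ B)
    (h : cell N K J KJ P B S d wn wd 158 (2 ^ P) nb = true) (n : ℕ) (hn0 : 158 ≤ n) (hnN : n ≤ N)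
    (δ : ℝ) (hδ0 : d ≤ S * δ) (hδ1 : (S * δ - d) * wd ≤ wn) (cn : ℝ)
    (herr : |∑ j ∈ Finset.range (J + 1), (bh P j n : ℝ) * (-δ) ^ j - 2 ^ P * cn| < 2 ^ P) :
    0 < (if n % 3 = 0 then 1 else -1) * cn := by
  have hdig : ∀ j, ∀ n ≤ N, bh P j n ≤ 2 ^ (P + a) := fun j n hn => bh_digit N P a j n t ht hn ha
  have h1 := cell_sound N K J KJ P B S d wn wd 158 (2 ^ P) nb hN hwd hJ hnb
    (fun j _ n hn => bh_sum N P a j n B hn (hdig _ n hn) hB1)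
    (fun j _ n hn => lt_of_le_of_lt (hdig j n hn) hB3)
    (fun n hn => bh_poly J P a n M S d B hS hd (fun j => hdig j n hn) hB2)
    h n hn0 hnN (S * δ - d) (by linarith) hδ1
  have hSr : (0 : ℝ) < S := by exact_mod_cast hS0
  have h2 : ∑ j ∈ Finset.range (J + 1), (bh P j n : ℝ) * S ^ (J - j) * (-((d : ℝ) + (S * δ - d))) ^ j =
      S ^ J * ∑ j ∈ Finset.range (J + 1), (bh P j n : ℝ) * (-δ) ^ j := by
    rw [Finset.mul_sum]
    apply Finset.sum_congr rfl
    intro j hj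
    have hj := Finset.mem_range.1 hj
    have e1 : -((d : ℝ) + (S * δ - d)) = S * (-δ) := by ring
    have e2 : (S : ℝ) ^ J = S ^ (J - j) * S ^ j := by rw [← pow_add]; congr 1; omega
    rw [e1, mul_pow, e2]; ring
  rw [h2] at h1
  set T := ∑ j ∈ Finset.range (J + 1), (bh P j n : ℝ) * (-δ) ^ j
  have h3 : (2 : ℝ) ^ P ≤ (if n % 3 = 0 then 1 else -1) * T := by
    push_cast at h1
    have hSJ : (0 : ℝ) < S ^ J := by positivity
    refine le_of_mul_le_mul_right (h1.trans (le_of_eq ?_)) hSJ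
    ring
  rw [abs_lt] at herr
  have hP : (0 : ℝ) < 2 ^ P := by positivity
  split_ifs at h3 ⊢
  · have : 0 < 2 ^ P * cn := by linarith [herr.2]
    rw [one_mul]
    exact pos_of_mul_pos_right this hP.le
  · have : 0 < 2 ^ P * (-1 * cn) := by linarith [herr.1]
    exact pos_of_mul_pos_right this hP.le

set_option exponentiation.threshold 2000 in
theorem err_1 (δ : ℝ) (hδ : 0 < δ) (hδ2 : δ ≤ 2.11) (n : ℕ) (hn : 158 ≤ n) (hδn : δ * n ≤ 332) :
    |∑ j ∈ Finset.range (70 + 1), (bh 340 j n : ℝ) * (-δ) ^ j -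
      2 ^ 340 * ∑ j ∈ Finset.range (n + 1), (-δ) ^ j * be j n| < 2 ^ 340 := by
  have hL := Lam_le n (0.2 * δ) (by positivity)
  have hL2 : δ * Lam n (0.2 * δ) ≤ 8.225 := by
    rw [le_div_iff₀ (by positivity)] at hL
    linarith
  have h := err_bound δ (0.2 * δ) 10.4 8.225 70 (2 ^ 96) hδ (by positivity) 340 70 n (by omega)
    (by linarith) hL2 (by norm_num) (by norm_num) (exp_le_two_pow _ 96 (by norm_num; linarith))
  refine lt_of_le_of_lt h ?_
  have h70 := exp_le_two_pow 70 101 (by norm_num)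
  have : (2 : ℝ) ^ 340 * (2 ^ 96 * (Real.exp 70 * ((8.225 / 70) ^ (70 + 1) / (1 - 8.225 / 70)))) ≤
    (2 : ℝ) ^ 340 * (2 ^ 96 * (2 ^ 101 * ((8.225 / 70) ^ (70 + 1) / (1 - 8.225 / 70)))) := by
    have : (0 : ℝ) ≤ (8.225 / 70) ^ (70 + 1) / (1 - 8.225 / 70) := by norm_num
    gcongr
  refine lt_of_le_of_lt (add_le_add_right this _) ?_
  rw [geom_sum_eq (by norm_num)]
  norm_num

set_option exponentiation.threshold 2000 in
theorem err_2 (δ : ℝ) (hδ : 0 < δ) (hδ2 : δ ≤ 3) (n : ℕ) (hn : 158 ≤ n) (hδn : δ * n ≤ 1689) :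
    |∑ j ∈ Finset.range (150 + 1), (bh 890 j n : ℝ) * (-δ) ^ j -
      2 ^ 890 * ∑ j ∈ Finset.range (n + 1), (-δ) ^ j * be j n| < 2 ^ 890 := by
  have hL := Lam_le n (0.1 * δ) (by positivity)
  have hL2 : δ * Lam n (0.1 * δ) ≤ 16.45 := by
    rw [le_div_iff₀ (by positivity)] at hL
    linarith
  have h := err_bound δ (0.1 * δ) 19.45 16.45 150 (2 ^ 244) hδ (by positivity) 890 150 n (by omega)
    (by linarith) hL2 (by norm_num) (by norm_num) (exp_le_two_pow _ 244 (by norm_num; linarith))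
  refine lt_of_le_of_lt h ?_
  have h70 := exp_le_two_pow 150 217 (by norm_num)
  have : (2 : ℝ) ^ 890 * (2 ^ 244 * (Real.exp 150 * ((16.45 / 150) ^ (150 + 1) / (1 - 16.45 / 150)))) ≤
    (2 : ℝ) ^ 890 * (2 ^ 244 * (2 ^ 217 * ((16.45 / 150) ^ (150 + 1) / (1 - 16.45 / 150)))) := by
    have : (0 : ℝ) ≤ (16.45 / 150) ^ (150 + 1) / (1 - 16.45 / 150) := by norm_num
    gcongr
  refine lt_of_le_of_lt (add_le_add_right this _) ?_
  rw [geom_sum_eq (by norm_num)]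
  norm_num

theorem sign_small_1 (δ : ℝ) (hδ0 : 0.227 ≤ δ) (n : ℕ) (hn : 158 ≤ n) (hδn : δ * n < 332) :
    0 < (if n % 3 = 0 then 1 else -1) * ∑ j ∈ Finset.range (n + 1), (-δ) ^ j * be j n := by
  have hnr : (158 : ℝ) ≤ n := by exact_mod_cast hn
  have hδ2 : δ ≤ 2.11 := by nlinarith
  have herr := err_1 δ (by linarith) hδ2 n hn hδn.le
  have hN : ∀ (u : ℝ) (N : ℕ), 0 < u → u ≤ δ → (332 : ℝ) ≤ u * (N + 1) → n ≤ N := by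
    intro u N hu0 hu hN
    by_contra hc
    have hc : N + 1 ≤ n := by omega
    have hc' : (N : ℝ) + 1 ≤ n := by exact_mod_cast hc
    have h1 : u * (N + 1) ≤ δ * n := mul_le_mul hu hc' (by positivity) (by linarith)
    linarith
  rcases le_total δ (4 / 9) with h1 | h1
  · exact cell_sign 1462 11 70 7 340 768 9 2 2 1 41 144 9 0.04 (by norm_num) (by norm_num) (by norm_num)
      (by norm_num) (by norm_num) (by norm_num) (by norm_num) (by norm_num) (by norm_num)
      (by decide +kernel) (by decide +kernel) (by decide +kernel) cell_1 n hn
      (hN 0.227 1462 (by norm_num) hδ0 (by norm_num)) δ (by push_cast; linarith) (by push_cast; linarith) _ herr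
  rcases le_total δ (8 / 9) with h2 | h2
  · exact cell_sign 746 10 70 7 340 768 9 4 4 1 19 144 9 0.04 (by norm_num) (by norm_num) (by norm_num)
      (by norm_num) (by norm_num) (by norm_num) (by norm_num) (by norm_num) (by norm_num)
      (by decide +kernel) (by decide +kernel) (by decide +kernel) cell_2 n hn
      (hN (4 / 9) 746 (by norm_num) h1 (by norm_num)) δ (by push_cast; linarith) (by push_cast; linarith) _ herr
  rcases le_total δ (14 / 9) with h3 | h3
  · exact cell_sign 373 9 70 7 340 768 9 8 6 1 7 144 9 0.04 (by norm_num) (by norm_num) (by norm_num)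
      (by norm_num) (by norm_num) (by norm_num) (by norm_num) (by norm_num) (by norm_num)
      (by decide +kernel) (by decide +kernel) (by decide +kernel) cell_3 n hn
      (hN (8 / 9) 373 (by norm_num) h2 (by norm_num)) δ (by push_cast; linarith) (by push_cast; linarith) _ herr
  · exact cell_sign 213 8 70 7 340 768 9 14 5 1 2 144 15 0.04 (by norm_num) (by norm_num) (by norm_num)
      (by norm_num) (by norm_num) (by norm_num) (by norm_num) (by norm_num) (by norm_num)
      (by decide +kernel) (by decide +kernel) (by decide +kernel) cell_4 n hn
      (hN (14 / 9) 213 (by norm_num) h3 (by norm_num)) δ (by push_cast; linarith) (by push_cast; linarith) _ herr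

theorem sign_small_2 (δ : ℝ) (hδ0 : 2.8 ≤ δ) (hδ1 : δ ≤ 2.9999) (n : ℕ) (hn : 158 ≤ n) (hδn : δ * n < 1577) :
    0 < (if n % 3 = 0 then 1 else -1) * ∑ j ∈ Finset.range (n + 1), (-δ) ^ j * be j n := by
  have hN : n ≤ 563 := by
    by_contra hc
    have hc : 564 ≤ n := by omega
    have hc' : (564 : ℝ) ≤ n := by exact_mod_cast hc
    nlinarith
  have herr := err_2 δ (by linarith) (by linarith) n hn (by linarith)
  exact cell_sign 563 10 150 8 890 1248 1 2 9999 10000 13 90 3 0.054 (by norm_num) (by norm_num) (by norm_num)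
      (by norm_num) (by norm_num) (by norm_num) (by norm_num) (by norm_num) (by norm_num)
      (by decide +kernel) (by decide +kernel) (by decide +kernel) cell_5 n hn
      hN δ (by push_cast; linarith) (by push_cast; linarith) _ herr


/-- the nome -/
noncomputable def nq (z : ℂ) : ℂ := Complex.exp (2 * Real.pi * Complex.I * z)

/-- Euler product -/
noncomputable def PP (q : ℂ) : ℂ := ∏' n : ℕ, (1 - q ^ (n + 1))

/-- discriminant as a function on complex numbers -/
noncomputable def DD (z : ℂ) : ℂ := nq z * PP (nq z) ^ 24

theorem nq_norm (z : ℂ) : ‖nq z‖ = Real.exp (-(2 * Real.pi * z.im)) := by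
  rw [nq, Complex.norm_exp]
  congr 1
  simp [Complex.mul_re, Complex.mul_im]

theorem nq_norm_lt (z : ℂ) (hz : 0 < z.im) : ‖nq z‖ < 1 := by
  rw [nq_norm, Real.exp_lt_one_iff]
  have := Real.pi_pos
  have : 0 < 2 * Real.pi * z.im := by positivity
  linarith

theorem nq_three (z : ℂ) : nq (3 * z) = nq z ^ 3 := by
  rw [nq, nq, ← Complex.exp_nat_mul]
  congr 1
  push_cast
  ring

theorem PP_hasProd (q : ℂ) (hq : ‖q‖ < 1) : HasProd (fun n : ℕ => (1 - q ^ (n + 1))) (PP q) :=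
  (ModularForm.multipliable_one_sub_pow hq).hasProd

theorem one_sub_pow_ne (q : ℂ) (hq : ‖q‖ < 1) (m : ℕ) : 1 - q ^ (m + 1) ≠ 0 := by
  intro h
  have h2 : ‖q ^ (m + 1)‖ < 1 := by
    rw [norm_pow]; exact pow_lt_one₀ (norm_nonneg _) hq (by omega)
  rw [← sub_eq_zero.1 h] at h2
  simp at h2

theorem PP_eq (q : ℂ) (hq : ‖q‖ < 1) : PP q = Complex.exp (LL q) * PP (q ^ 3) := by
  have h1 : HasProd (fun m : ℕ => if 3 ∣ (m + 1) then 1 else 1 - q ^ (m + 1)) (Complex.exp (LL q)) := by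
    have h := LL_hasSum' q hq
    rw [← LL_eq q hq] at h
    have h := h.cexp
    convert! h using 1
    funext m
    simp only [Function.comp]
    split_ifs
    · simp
    · rw [Complex.exp_log (one_sub_pow_ne q hq m)]
  have hq3 : ‖q ^ 3‖ < 1 := by rw [norm_pow]; exact pow_lt_one₀ (norm_nonneg _) hq (by norm_num)
  have h2 : HasProd (fun m : ℕ => if 3 ∣ (m + 1) then 1 - q ^ (m + 1) else 1) (PP (q ^ 3)) := by
    have h := PP_hasProd (q ^ 3) hq3
    have hi : Function.Injective (fun k : ℕ => 3 * k + 2) := by intro a b h; simp at h; exact h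
    rw [← hi.hasProd_iff]
    · convert! h using 1
      funext k
      simp only [Function.comp]
      rw [if_pos (by omega), ← pow_mul]
      congr 2
    · intro m hm
      rw [if_neg]
      intro h3
      apply hm
      refine ⟨(m - 2) / 3, ?_⟩
      simp only
      omega
  have h3 := h1.mul h2
  refine (PP_hasProd q hq).unique ?_
  convert! h3 using 1
  funext m
  split_ifs <;> simp

theorem DD_rel (z : ℂ) (hz : 0 < z.im) :
    Complex.exp (24 * LL (nq z)) * DD (3 * z) = nq z ^ 2 * DD z := by
  rw [DD, DD, nq_three, PP_eq (nq z) (nq_norm_lt z hz)]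
  rw [mul_pow, ← Complex.exp_nat_mul]
  push_cast
  ring

theorem DD_coe (z : UpperHalfPlane) : ModularForm.discriminant z = DD z := by
  rw [ModularForm.discriminant_eq_q_prod, DD]
  congr 1
  · simp [Function.Periodic.qParam, nq]
  · rw [PP, ← (ModularForm.multipliable_one_sub_pow (nq_norm_lt _ z.2)).tprod_pow]
    apply tprod_congr
    intro n
    rw [ModularForm.eta_q_eq_pow]
    rfl

theorem DD_ne (z : ℂ) (hz : 0 < z.im) : DD z ≠ 0 := by
  have := ModularForm.discriminant_ne_zero ⟨z, hz⟩
  rwa [DD_coe] at this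

theorem DD_smul (g : Matrix.SpecialLinearGroup (Fin 2) ℤ) (z : UpperHalfPlane) :
    DD ((g • z : UpperHalfPlane) : ℂ) = ((g 1 0 : ℂ) * z + (g 1 1 : ℂ)) ^ 12 * DD z := by
  have h := SlashInvariantForm.slash_action_generators_SL2Z ModularForm.discriminant_S_invariant ModularForm.discriminant_T_invariant g
  have h2 := congrFun h z
  rw [ModularForm.SL_slash_apply, DD_coe, DD_coe] at h2
  have h3 := UpperHalfPlane.denom_ne_zero g z
  rw [zpow_neg, mul_inv_eq_iff_eq_mul₀ (zpow_ne_zero _ h3)] at h2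
  rw [h2, ModularGroup.denom_apply, mul_comm]
  norm_cast

/-- the invariant function -/
noncomputable def FF (z : ℂ) : ℝ := ‖DD z‖ * z.im ^ 6

theorem FF_smul (g : Matrix.SpecialLinearGroup (Fin 2) ℤ) (z : UpperHalfPlane) :
    FF ((g • z : UpperHalfPlane) : ℂ) = FF z ∧
    ((g • z : UpperHalfPlane) : ℂ).im = (z : ℂ).im / Complex.normSq ((g 1 0 : ℂ) * z + (g 1 1 : ℂ)) := by
  have h1 : ((g • z : UpperHalfPlane) : ℂ).im = (z : ℂ).im / Complex.normSq ((g 1 0 : ℂ) * z + (g 1 1 : ℂ)) := by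
    have := ModularGroup.im_smul_eq_div_normSq g z
    rw [ModularGroup.denom_apply] at this
    exact this
  refine ⟨?_, h1⟩
  have h3 := UpperHalfPlane.denom_ne_zero g z
  rw [ModularGroup.denom_apply] at h3
  rw [FF, FF, DD_smul, h1, norm_mul, norm_pow, Complex.normSq_eq_norm_sq]
  have h4 := norm_ne_zero_iff.2 h3
  field_simp

/-- invariance with a prescribed bottom row -/
theorem FF_row (c d : ℤ) (h : IsCoprime c d) (z : ℂ) (hz : 0 < z.im) :
    ∃ z' : ℂ, FF z' = FF z ∧ z'.im = z.im / Complex.normSq (c * z + d) := by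
  obtain ⟨g, -, hg⟩ := ModularGroup.bottom_row_surj (R := ℤ) (show ![c, d] ∈ {cd : Fin 2 → ℤ | IsCoprime (cd 0) (cd 1)} from h)
  have := FF_smul g ⟨z, hz⟩
  refine ⟨_, this.1, ?_⟩
  rw [this.2]
  have h0 : g 1 0 = c := congrFun hg 0
  have h1 : g 1 1 = d := congrFun hg 1
  rw [h0, h1]

/-- reduction to the fundamental domain -/
theorem FF_red (z : ℂ) (hz : 0 < z.im) : ∃ (c d : ℤ) (z' : ℂ), IsCoprime c d ∧ FF z' = FF z ∧
    z'.im = z.im / Complex.normSq (c * z + d) ∧ 3 ≤ 4 * z'.im ^ 2 ∧ 0 < z'.im := by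
  obtain ⟨g, hg⟩ := ModularGroup.exists_smul_mem_fd ⟨z, hz⟩
  have := FF_smul g ⟨z, hz⟩
  refine ⟨g 1 0, g 1 1, _, ?_, this.1, this.2, ?_, (g • (⟨z, hz⟩ : UpperHalfPlane)).2⟩
  · exact ModularGroup.bottom_row_coprime g
  · exact ModularGroup.three_le_four_mul_im_sq_of_mem_fd hg

theorem FF_rel (z : ℂ) (hz : 0 < z.im) :
    Real.exp (24 * (LL (nq z)).re) * FF (3 * z) = 729 * Real.exp (-(4 * Real.pi * z.im)) * FF z := by
  have h := congrArg norm (DD_rel z hz)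
  rw [norm_mul, norm_mul, Complex.norm_exp, norm_pow, nq_norm, ← Real.exp_nat_mul] at h
  have e1 : (24 * LL (nq z)).re = 24 * (LL (nq z)).re := by simp
  rw [e1] at h
  have e2 : (3 * z).im = 3 * z.im := by simp
  rw [FF, FF, e2]
  have e3 : Real.exp (-(4 * Real.pi * z.im)) = Real.exp ((2:ℕ) * -(2 * Real.pi * z.im)) := by
    congr 1; push_cast; ring
  rw [e3]
  linear_combination (729 * z.im ^ 6) * h


theorem PP_bounds (q : ℂ) (hq : ‖q‖ ≤ 0.0044) :
    ‖PP q‖ ≤ Real.exp 0.00445 ∧ Real.exp (-0.00445) ≤ ‖PP q‖ := by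
  set r := ‖q‖ with hr
  have hr0 : 0 ≤ r := norm_nonneg _
  have hq1 : ‖q‖ < 1 := by linarith
  have hT := ((PP_hasProd q hq1).norm).tendsto_prod_nat
  have hgs : ∀ n, ∑ i ∈ Finset.range n, r ^ (i + 1) ≤ 0.0044195 := by
    intro n
    have h1 : ∀ i, r ^ (i + 1) = r * r ^ i := fun i => by ring
    simp_rw [h1]
    rw [← Finset.mul_sum]
    have h2 : ∑ i ∈ Finset.range n, r ^ i ≤ (1 - r)⁻¹ := by
      rw [← tsum_geometric_of_lt_one hr0 hq1]
      exact (summable_geometric_of_lt_one hr0 hq1).sum_le_tsum _ (fun i _ => by positivity)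
    have h3 : (1 - r)⁻¹ ≤ (0.9956 : ℝ)⁻¹ := inv_anti₀ (by norm_num) (by linarith)
    calc r * _ ≤ 0.0044 * (0.9956 : ℝ)⁻¹ := by gcongr; linarith
      _ ≤ _ := by norm_num
  have hpow : ∀ i, ‖q ^ (i + 1)‖ = r ^ (i + 1) := fun i => norm_pow _ _
  have hpl : ∀ i : ℕ, r ^ (i + 1) ≤ 0.0044 := by
    intro i
    calc r ^ (i + 1) = r ^ i * r := pow_succ _ _
      _ ≤ 1 * r := by gcongr; exact pow_le_one₀ hr0 hq1.le
      _ ≤ _ := by linarith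
  constructor
  · refine le_of_tendsto' hT (fun n => ?_)
    calc ∏ i ∈ Finset.range n, ‖1 - q ^ (i + 1)‖ ≤ ∏ i ∈ Finset.range n, Real.exp (r ^ (i + 1)) := by
          apply Finset.prod_le_prod (fun _ _ => norm_nonneg _)
          intro i _
          have h1 := norm_sub_le (1 : ℂ) (q ^ (i + 1))
          rw [hpow, norm_one] at h1
          have := Real.add_one_le_exp (r ^ (i + 1))
          linarith
      _ = Real.exp (∑ i ∈ Finset.range n, r ^ (i + 1)) := (Real.exp_sum _ _).symm
      _ ≤ _ := Real.exp_le_exp.2 (by have := hgs n; linarith)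
  · refine ge_of_tendsto' hT (fun n => ?_)
    calc Real.exp (-0.00445) ≤ Real.exp (∑ i ∈ Finset.range n, -(1.005 * r ^ (i + 1))) := by
          apply Real.exp_le_exp.2
          rw [Finset.sum_neg_distrib, ← Finset.mul_sum]
          have := hgs n
          linarith
      _ = ∏ i ∈ Finset.range n, Real.exp (-(1.005 * r ^ (i + 1))) := Real.exp_sum _ _
      _ ≤ _ := by
          apply Finset.prod_le_prod (fun _ _ => (Real.exp_pos _).le)
          intro i _
          have h1 := norm_sub_norm_le (1 : ℂ) (q ^ (i + 1))
          rw [hpow, norm_one] at h1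
          refine le_trans ?_ h1
          set s := r ^ (i + 1) with hs
          have hs0 : 0 ≤ s := by positivity
          have hs1 : s ≤ 0.0044 := hpl i
          rw [Real.exp_neg, inv_le_comm₀ (Real.exp_pos _) (by linarith)]
          refine le_trans ?_ (Real.add_one_le_exp _)
          rw [inv_le_iff_one_le_mul₀ (by linarith)]
          nlinarith

theorem exp_small : Real.exp (-5.44) ≤ 0.0044 := by
  rw [Real.exp_neg]
  have h : (0.0044 : ℝ)⁻¹ ≤ Real.exp 5.44 := by
    have h1 := Real.exp_one_gt_d9
    have h2 : Real.exp 5.44 = Real.exp 1 ^ 5 * Real.exp 0.44 := by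
      rw [← Real.exp_nat_mul, ← Real.exp_add]; norm_num
    have h3 := Real.quadratic_le_exp_of_nonneg (show (0:ℝ) ≤ 0.44 by norm_num)
    rw [h2]
    calc (0.0044 : ℝ)⁻¹ ≤ 2.7182818283 ^ 5 * (1 + 0.44 + 0.44 ^ 2 / 2) := by norm_num
      _ ≤ _ := by gcongr
  rw [inv_le_comm₀ (Real.exp_pos _) (by norm_num)]
  exact h

theorem FF_bounds (z : ℂ) (hz : 0 < z.im) (h : 3 ≤ 4 * z.im ^ 2) :
    FF z ≤ Real.exp (0.11 - 2 * Real.pi * z.im) * z.im ^ 6 ∧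
    Real.exp (-0.11 - 2 * Real.pi * z.im) * z.im ^ 6 ≤ FF z := by
  have hv : 0.866 ≤ z.im := by nlinarith
  have hp := Real.pi_gt_d4
  have hq : ‖nq z‖ ≤ 0.0044 := by
    rw [nq_norm]
    refine le_trans (Real.exp_le_exp.2 ?_) exp_small
    nlinarith
  obtain ⟨h1, h2⟩ := PP_bounds _ hq
  have e : FF z = ‖PP (nq z)‖ ^ 24 * Real.exp (-(2 * Real.pi * z.im)) * z.im ^ 6 := by
    rw [FF, DD, norm_mul, norm_pow, nq_norm]; ring
  rw [e]
  constructor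
  · gcongr
    rw [sub_eq_add_neg, Real.exp_add]
    gcongr
    calc ‖PP (nq z)‖ ^ 24 ≤ Real.exp 0.00445 ^ 24 := by gcongr
      _ = Real.exp ((24 : ℕ) * 0.00445) := (Real.exp_nat_mul _ _).symm
      _ ≤ _ := Real.exp_le_exp.2 (by norm_num)
  · gcongr
    rw [sub_eq_add_neg, Real.exp_add]
    gcongr
    calc Real.exp (-0.11) ≤ Real.exp ((24 : ℕ) * -0.00445) := Real.exp_le_exp.2 (by norm_num)
      _ = Real.exp (-0.00445) ^ 24 := (Real.exp_nat_mul _ _)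
      _ ≤ _ := by gcongr


theorem normSq_lin (c d x y : ℝ) :
    Complex.normSq ((c : ℂ) * (x + Complex.I * y) + d) = (c * x + d) ^ 2 + (c * y) ^ 2 := by
  rw [Complex.normSq_apply]
  simp
  ring

theorem int_abs_ge (d : ℤ) (h : d ≠ 0) : (1 : ℝ) ≤ (d : ℝ) ^ 2 := by
  have : 1 ≤ d ^ 2 := by
    have := sq_pos_of_ne_zero h
    omega
  exact_mod_cast this

theorem off_den_pos (x y : ℝ) (hy : 0 < y) (hy2 : y ≤ 0.015) (hx0 : 0 ≤ x) (hx1 : x ≤ 1 / 2)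
    (hoff : 3 * y ^ 2 ≤ (x - 1 / 3) ^ 2) (d : ℤ) (hd : ¬ (3 ∣ d)) :
    36 * y ^ 2 ≤ (3 * x + d) ^ 2 + (3 * y) ^ 2 := by
  have hyy : y ^ 2 ≤ 0.000225 := by nlinarith
  have : d ≤ -2 ∨ d = -1 ∨ d = 0 ∨ 1 ≤ d := by omega
  rcases this with h | h | h | h
  · have h' : (d : ℝ) ≤ -2 := by exact_mod_cast h
    nlinarith
  · subst h; push_cast; nlinarith
  · subst h; simp at hd
  · have h' : (1 : ℝ) ≤ d := by exact_mod_cast h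
    nlinarith

theorem off_den (x y : ℝ) (hy : 0 < y) (hy2 : y ≤ 0.015) (hx0 : 0 ≤ x) (hx1 : x ≤ 1 / 2)
    (hoff : 3 * y ^ 2 ≤ (x - 1 / 3) ^ 2) (c d : ℤ) (hd : ¬ (3 ∣ d)) :
    36 * y ^ 2 ≤ (3 * c * x + d) ^ 2 + (3 * c * y) ^ 2 := by
  have hyy : y ^ 2 ≤ 0.000225 := by nlinarith
  have : c ≤ -2 ∨ c = -1 ∨ c = 0 ∨ c = 1 ∨ 2 ≤ c := by omega
  rcases this with h | h | h | h | h
  · have h' : (c : ℝ) ≤ -2 := by exact_mod_cast h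
    have : (4:ℝ) ≤ c ^ 2 := by nlinarith
    nlinarith [mul_nonneg (sub_nonneg.2 this) (sq_nonneg y), sq_nonneg (3 * c * x + d)]
  · subst h
    have := off_den_pos x y hy hy2 hx0 hx1 hoff (-d) (by rwa [dvd_neg])
    push_cast at this ⊢
    linarith
  · subst h
    have := int_abs_ge d (by rintro rfl; simp at hd)
    push_cast
    nlinarith
  · subst h
    have := off_den_pos x y hy hy2 hx0 hx1 hoff d hd
    push_cast
    linarith
  · have h' : (2 : ℝ) ≤ c := by exact_mod_cast h
    have : (4:ℝ) ≤ c ^ 2 := by nlinarith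
    nlinarith [mul_nonneg (sub_nonneg.2 this) (sq_nonneg y), sq_nonneg (3 * c * x + d)]

theorem FF_le_const (z : ℂ) (hz : 0 < z.im) : FF z ≤ Real.exp (-5.89) := by
  obtain ⟨c, d, z', -, h1, -, h2, h3⟩ := FF_red z hz
  rw [← h1]
  refine le_trans (FF_bounds z' h3 h2).1 ?_
  have h4 : z'.im ≤ Real.exp (z'.im - 1) := by
    have := Real.add_one_le_exp (z'.im - 1); linarith
  calc _ ≤ Real.exp (0.11 - 2 * Real.pi * z'.im) * Real.exp (z'.im - 1) ^ 6 := by gcongr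
    _ = Real.exp ((0.11 - 2 * Real.pi * z'.im) + (6 : ℕ) * (z'.im - 1)) := by
      rw [Real.exp_add, Real.exp_nat_mul]
    _ ≤ _ := by
      apply Real.exp_le_exp.2
      have := Real.pi_gt_d4
      push_cast
      nlinarith

theorem off_key (x y : ℝ) (hy : 0 < y) (hy2 : y ≤ 0.015) (hx0 : 0 ≤ x) (hx1 : x ≤ 1 / 2)
    (hoff : 3 * y ^ 2 ≤ (x - 1 / 3) ^ 2) :
    729 * FF (x + Complex.I * y) ≤ Real.exp (0.22 + Real.pi / (9 * y)) * FF (3 * (x + Complex.I * y)) := by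
  set τ : ℂ := x + Complex.I * y with hτ
  have him : τ.im = y := by simp [hτ]
  have him3 : (3 * τ).im = 3 * y := by simp [him]
  have hτ0 : 0 < τ.im := by rw [him]; exact hy
  have hp := Real.pi_gt_d4
  have hp2 := Real.pi_lt_d4
  obtain ⟨c, d, z, hcd, h1, h2, h3, h4⟩ := FF_red (3 * τ) (by rw [him3]; linarith)
  have hB := (FF_bounds z h4 h3).2
  rw [h1] at hB
  set v := z.im with hv
  have hv0 : 0.866 ≤ v := by nlinarith
  have hN : Complex.normSq ((c : ℂ) * (3 * τ) + d) = (3 * c * x + d) ^ 2 + (3 * c * y) ^ 2 := by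
    rw [← normSq_lin]
    congr 1
    push_cast
    rw [hτ]; ring
  rw [hN, him3] at h2
  set N := (3 * c * x + d) ^ 2 + (3 * c * y) ^ 2 with hNd
  have hN0 : 0 < N := by
    by_contra hcon
    have : 3 * y / N ≤ 0 := div_nonpos_of_nonneg_of_nonpos (by linarith) (by linarith)
    linarith
  have hvN : v * N = 3 * y := by rw [h2]; field_simp
  have hπy : 23 ≤ Real.pi / (9 * y) := by
    rw [le_div_iff₀ (by linarith)]; linarith
  by_cases hv3 : v < 3
  · -- bounded height
    have hF := FF_le_const τ hτ0
    have hv6 : (0.421 : ℝ) ≤ v ^ 6 := by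
      calc (0.421 : ℝ) ≤ 0.866 ^ 6 := by norm_num
        _ ≤ _ := by gcongr
    have e1 : (1732 : ℝ) ≤ Real.exp 7.5 := by
      have h1 := Real.exp_one_gt_d9
      have h2 : Real.exp 7.5 = Real.exp 1 ^ 7 * Real.exp 0.5 := by
        rw [← Real.exp_nat_mul, ← Real.exp_add]; norm_num
      have h3 := Real.quadratic_le_exp_of_nonneg (show (0:ℝ) ≤ 0.5 by norm_num)
      rw [h2]
      calc (1732 : ℝ) ≤ 2.7182818283 ^ 7 * (1 + 0.5 + 0.5 ^ 2 / 2) := by norm_num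
        _ ≤ _ := by gcongr
    calc 729 * FF τ ≤ (Real.exp 7.5 * 0.421) * Real.exp (-5.89) := by
          have h729 : (729 : ℝ) ≤ Real.exp 7.5 * 0.421 := by linarith
          have hF0 : 0 ≤ FF τ := by rw [FF]; positivity
          exact mul_le_mul h729 hF hF0 (by positivity)
      _ = Real.exp (1.61) * 0.421 := by
          rw [mul_right_comm, ← Real.exp_add]; norm_num
      _ ≤ (Real.exp (0.22 + Real.pi / (9 * y)) * Real.exp (-0.11 - 2 * Real.pi * v)) * v ^ 6 := by
          gcongr
          rw [← Real.exp_add]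
          apply Real.exp_le_exp.2
          nlinarith
      _ = Real.exp (0.22 + Real.pi / (9 * y)) * (Real.exp (-0.11 - 2 * Real.pi * v) * v ^ 6) := by ring
      _ ≤ _ := by gcongr
  push Not at hv3
  by_cases hd : (3 : ℤ) ∣ d
  · obtain ⟨e, rfl⟩ := hd
    have hce : IsCoprime c e := hcd.of_mul_right_right
    obtain ⟨z', hz1, hz2⟩ := FF_row c e hce τ hτ0
    have hN' : Complex.normSq ((c : ℂ) * τ + e) = N / 9 := by
      have := normSq_lin c e x y
      rw [← hτ] at this
      push_cast at this
      rw [this, hNd]; push_cast; ring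
    have hz3 : z'.im = 3 * v := by
      rw [hz2, hN', him, h2]; field_simp; norm_num
    have hF := (FF_bounds z' (by rw [hz3]; linarith) (by rw [hz3]; nlinarith)).1
    rw [hz1, hz3] at hF
    have e1 : (531441 : ℝ) ≤ Real.exp 16 := by
      have h1 := Real.exp_one_gt_d9
      have h2 : Real.exp 16 = Real.exp 1 ^ 16 := by
        rw [← Real.exp_nat_mul]; norm_num
      rw [h2]
      calc (531441 : ℝ) ≤ 2.7182818283 ^ 16 := by norm_num
        _ ≤ _ := by gcongr
    calc 729 * FF τ ≤ 729 * (Real.exp (0.11 - 2 * Real.pi * (3 * v)) * (3 * v) ^ 6) := by gcongr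
      _ = (531441 * Real.exp (0.11 - 2 * Real.pi * (3 * v))) * v ^ 6 := by ring
      _ ≤ (Real.exp 16 * Real.exp (0.11 - 2 * Real.pi * (3 * v))) * v ^ 6 := by gcongr
      _ ≤ (Real.exp (0.22 + Real.pi / (9 * y)) * Real.exp (-0.11 - 2 * Real.pi * v)) * v ^ 6 := by
          apply mul_le_mul_of_nonneg_right _ (by positivity)
          rw [← Real.exp_add, ← Real.exp_add]
          apply Real.exp_le_exp.2
          nlinarith
      _ = Real.exp (0.22 + Real.pi / (9 * y)) * (Real.exp (-0.11 - 2 * Real.pi * v) * v ^ 6) := by ring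
      _ ≤ _ := by gcongr
  · have h3d : IsCoprime (3 : ℤ) d := (Int.prime_three.coprime_iff_not_dvd).2 hd
    have hce : IsCoprime (3 * c) d := h3d.mul_left hcd
    obtain ⟨z', hz1, hz2⟩ := FF_row (3 * c) d hce τ hτ0
    have hN' : Complex.normSq (((3 * c : ℤ) : ℂ) * τ + d) = N := by
      have := normSq_lin (3 * c) d x y
      rw [← hτ] at this
      push_cast at this ⊢
      rw [this, hNd]
    have hz3 : z'.im = v / 3 := by
      rw [hz2, hN', him, h2]; field_simp
    have hF := (FF_bounds z' (by rw [hz3]; linarith) (by rw [hz3]; nlinarith)).1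
    rw [hz1, hz3] at hF
    have hN36 := off_den x y hy hy2 hx0 hx1 hoff c d hd
    have hvy : v * (12 * y) ≤ 1 := by
      have : v * (36 * y ^ 2) ≤ 3 * y := by
        rw [← hvN]; gcongr
      have h5 : (v * (12 * y)) * (3 * y) ≤ 1 * (3 * y) := by linarith
      exact le_of_mul_le_mul_right h5 (by linarith)
    have hvy2 : 4 * Real.pi * v / 3 ≤ Real.pi / (9 * y) := by
      rw [le_div_iff₀ (by linarith)]
      have h5 : (v * (12 * y)) * Real.pi ≤ 1 * Real.pi :=
        mul_le_mul_of_nonneg_right hvy Real.pi_pos.le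
      linarith
    calc 729 * FF τ ≤ 729 * (Real.exp (0.11 - 2 * Real.pi * (v / 3)) * (v / 3) ^ 6) := by gcongr
      _ = (Real.exp (0.11 - 2 * Real.pi * (v / 3))) * v ^ 6 := by ring
      _ ≤ (Real.exp (0.22 + Real.pi / (9 * y)) * Real.exp (-0.11 - 2 * Real.pi * v)) * v ^ 6 := by
          gcongr
          rw [← Real.exp_add]
          apply Real.exp_le_exp.2
          linarith
      _ = Real.exp (0.22 + Real.pi / (9 * y)) * (Real.exp (-0.11 - 2 * Real.pi * v) * v ^ 6) := by ring
      _ ≤ _ := by gcongr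

theorem off_arc (x y : ℝ) (hy : 0 < y) (hy2 : y ≤ 0.015) (hx0 : 0 ≤ x) (hx1 : x ≤ 1 / 2)
    (hoff : 3 * y ^ 2 ≤ (x - 1 / 3) ^ 2) :
    24 * (LL (qq x y)).re ≤ 0.22 - 4 * Real.pi * y + Real.pi / (9 * y) := by
  have h1 := off_key x y hy hy2 hx0 hx1 hoff
  have him : (x + Complex.I * y : ℂ).im = y := by simp
  have h2 := FF_rel (x + Complex.I * y) (by rw [him]; exact hy)
  rw [him] at h2
  have h3 : 0 < FF (3 * (x + Complex.I * y)) := by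
    have h30 : 0 < (3 * (x + Complex.I * y) : ℂ).im := by simp; exact hy
    rw [FF]
    have := norm_pos_iff.2 (DD_ne _ h30)
    positivity
  have h4 : Real.exp (24 * (LL (qq x y)).re) * FF (3 * (x + Complex.I * y)) ≤
      Real.exp (0.22 - 4 * Real.pi * y + Real.pi / (9 * y)) * FF (3 * (x + Complex.I * y)) := by
    have e : LL (qq x y) = LL (nq (x + Complex.I * y)) := rfl
    rw [e, h2]
    calc _ = Real.exp (-(4 * Real.pi * y)) * (729 * FF (x + Complex.I * y)) := by ring
      _ ≤ Real.exp (-(4 * Real.pi * y)) * (Real.exp (0.22 + Real.pi / (9 * y)) * FF (3 * (x + Complex.I * y))) := by gcongr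
      _ = _ := by rw [← mul_assoc, ← Real.exp_add]; congr 2; ring
  exact Real.exp_le_exp.1 (le_of_mul_le_mul_right h4 h3)


theorem mm_le (k : ℕ) : mm k ≤ k := by
  rcases Nat.eq_zero_or_pos k with rfl | hk
  · simp [mm_zero]
  rw [mm_eq k hk]
  calc _ ≤ ∑ p ∈ k.divisorsAntidiagonal, (1 : ℝ) := by
        apply Finset.sum_le_sum
        intro p hp
        obtain ⟨h1, h2⟩ := Nat.mem_divisorsAntidiagonal.1 hp
        split_ifs
        · norm_num
        · have : 0 < p.2 := Nat.pos_of_ne_zero (by rintro h; rw [h] at h1; simp at h1; omega)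
          have : (1 : ℝ) ≤ p.2 := by exact_mod_cast this
          rw [div_le_one (by linarith)]
          exact this
    _ = (k.divisors.card : ℝ) := by
        rw [Finset.sum_const, nsmul_eq_mul, mul_one, ← Nat.map_div_right_divisors, Finset.card_map]
    _ ≤ k := by exact_mod_cast Nat.card_divisors_le_self k

theorem mm_one : mm 1 = 1 := by
  rw [mm_eq 1 one_pos]; simp

theorem LL_add_le (q : ℂ) (hq : ‖q‖ < 1) : ‖LL q + q‖ ≤ ‖q‖ / (1 - ‖q‖) ^ 2 - ‖q‖ := by
  set r := ‖q‖ with hr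
  have hr0 : 0 ≤ r := norm_nonneg _
  have h1 := (hasSum_nat_add_iff' 2).2 (LL_hasSum q hq)
  have h2 : HasSum (fun n : ℕ => (n : ℝ) * r ^ n) (r / (1 - r) ^ 2) := 
    hasSum_coe_mul_geometric_of_norm_lt_one (by rwa [Real.norm_of_nonneg hr0])
  have h3 := (hasSum_nat_add_iff' 2).2 h2
  have e1 : -LL q - ∑ i ∈ Finset.range 2, (mm i : ℂ) * q ^ i = -(LL q + q) := by
    simp [Finset.sum_range_succ, mm_zero, mm_one]; ring
  have e2 : r / (1 - r) ^ 2 - ∑ i ∈ Finset.range 2, (i : ℝ) * r ^ i = r / (1 - r) ^ 2 - r := by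
    simp [Finset.sum_range_succ]
  rw [e1] at h1
  rw [e2] at h3
  rw [← norm_neg]
  refine h1.norm_le_of_bounded h3 (fun k => ?_)
  rw [norm_mul, norm_pow, Complex.norm_real, Real.norm_of_nonneg (mm_nonneg _)]
  gcongr
  exact mm_le _

theorem LL_continuousAt (q : ℂ) (hq : ‖q‖ < 1) : ContinuousAt LL q := by
  obtain ⟨r, h1, h2⟩ := exists_between hq
  have hr0 : 0 ≤ r := le_trans (norm_nonneg _) h1.le
  have hs : Summable (fun k : ℕ => (k : ℝ) * r ^ k) := 
    (hasSum_coe_mul_geometric_of_norm_lt_one (r := r) (by rwa [Real.norm_of_nonneg hr0])).summable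
  have h3 : ContinuousOn (fun q : ℂ => ∑' k : ℕ, (mm k : ℂ) * q ^ k) (Metric.ball 0 r) := by
    refine continuousOn_tsum (fun k => by fun_prop) hs (fun k x hx => ?_)
    rw [norm_mul, norm_pow, Complex.norm_real, Real.norm_of_nonneg (mm_nonneg _)]
    have hx : ‖x‖ < r := by simpa using hx
    gcongr
    exact mm_le _
  have h4 : ContinuousOn LL (Metric.ball 0 r) := by
    refine h3.neg.congr (fun x hx => ?_)
    have hx : ‖x‖ < r := by simpa using hx
    have := (LL_hasSum x (hx.trans h2)).tsum_eq
    rw [Pi.neg_apply, this, neg_neg]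
  exact h4.continuousAt (Metric.isOpen_ball.mem_nhds (by simpa using h1))

theorem LL_conj (q : ℂ) (hq : ‖q‖ < 1) : LL (starRingEnd ℂ q) = starRingEnd ℂ (LL q) := by
  have h1 := LL_hasSum (starRingEnd ℂ q) (by simpa using hq)
  have h3 : (fun k => starRingEnd ℂ ((mm k : ℂ) * q ^ k)) = fun k => (mm k : ℂ) * (starRingEnd ℂ q) ^ k := by
    funext k; simp
  have h4 : HasSum (fun k => (mm k : ℂ) * (starRingEnd ℂ q) ^ k) (starRingEnd ℂ (-LL q)) := by
    rw [← h3, Complex.hasSum_conj']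
    exact LL_hasSum q hq
  have := h1.unique h4
  rw [map_neg, neg_inj] at this
  exact this

/-- image of `1/3 + w` -/
noncomputable def tw (w : ℂ) : ℂ := -1 / 3 - 1 / (9 * w)

theorem tw_im (w : ℂ) : (tw w).im = w.im / (9 * Complex.normSq w) := by
  have : (1 / (9 * w)).im = - w.im / (9 * Complex.normSq w) := by
    rw [one_div, mul_inv, show (9 : ℂ)⁻¹ = ((9⁻¹ : ℝ) : ℂ) by push_cast; rfl, Complex.im_ofReal_mul, Complex.inv_im]
    ring
  have h2 : (-1 / 3 : ℂ).im = 0 := by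
    rw [show (-1 / 3 : ℂ) = ((-1 / 3 : ℝ) : ℂ) by push_cast; rfl, Complex.ofReal_im]
  rw [tw, Complex.sub_im, this, h2]
  ring

theorem tw_pos (w : ℂ) (hw : 0 < w.im) : 0 < (tw w).im := by
  rw [tw_im]
  have : 0 < Complex.normSq w := Complex.normSq_pos.2 (by rintro rfl; simp at hw)
  positivity

theorem DD_spec (g : Matrix.SpecialLinearGroup (Fin 2) ℤ) (z z' : ℂ) (hz : 0 < z.im)
    (h : z' * ((g 1 0 : ℂ) * z + (g 1 1 : ℂ)) = (g 0 0 : ℂ) * z + (g 0 1 : ℂ)) :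
    DD z' = ((g 1 0 : ℂ) * z + (g 1 1 : ℂ)) ^ 12 * DD z := by
  have h1 := DD_smul g ⟨z, hz⟩
  have h3 := UpperHalfPlane.denom_ne_zero g ⟨z, hz⟩
  rw [ModularGroup.denom_apply] at h3
  rw [UpperHalfPlane.specialLinearGroup_apply] at h1
  rw [← h1]
  congr 1
  simp only [algebraMap_int_eq, eq_intCast] at *
  push_cast at *
  rw [eq_div_iff h3]
  exact h

/-- the phase -/
noncomputable def KK (w : ℂ) : ℂ :=
  LL (nq (1 / 3 + w)) - LL (nq (tw w)) - Real.pi * Complex.I / 6 * (1 / 3 + w - tw w)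

theorem KK_exp (w : ℂ) (hw : 0 < w.im) : Complex.exp (24 * KK w) = 1 := by
  have hw0 : w ≠ 0 := by rintro rfl; simp at hw
  set τ := 1 / 3 + w with hτ
  have hτi : 0 < τ.im := by
    have h2 : (1 / 3 : ℂ).im = 0 := by
      rw [show (1 / 3 : ℂ) = ((1 / 3 : ℝ) : ℂ) by push_cast; rfl, Complex.ofReal_im]
    rw [hτ, Complex.add_im, h2]; linarith
  have hti := tw_pos w hw
  have h1 : DD (tw w) = (3 * w) ^ 12 * DD τ := by
    have := DD_spec ⟨!![-1, 0; 3, -1], by simp [Matrix.det_fin_two]⟩ τ (tw w) hτi (by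
      simp [tw, hτ]; field_simp; ring)
    rw [this]
    simp [hτ]
    left; ring
  have h2 : DD (3 * tw w) = (3 * w) ^ 12 * DD (3 * τ) := by
    have := DD_spec ⟨!![-1, 0; 1, -1], by simp [Matrix.det_fin_two]⟩ (3 * τ) (3 * tw w) (by simp; exact hτi) (by
      simp [tw, hτ]; field_simp; ring)
    rw [this]
    simp [hτ]
    left; ring
  have h3 := DD_rel τ hτi
  have h4 := DD_rel (tw w) hti
  rw [h1, h2] at h4
  have hD1 := DD_ne τ hτi
  have hD3 := DD_ne (3 * τ) (by simp; exact hτi)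
  have h5 : Complex.exp (24 * LL (nq τ)) * nq (tw w) ^ 2 = Complex.exp (24 * LL (nq (tw w))) * nq τ ^ 2 := by
    have h3w : (3 * w) ^ 12 ≠ 0 := pow_ne_zero _ (by simpa using hw0)
    have : (Complex.exp (24 * LL (nq τ)) * nq (tw w) ^ 2 - Complex.exp (24 * LL (nq (tw w))) * nq τ ^ 2) *
       (((3 * w) ^ 12 * DD (3 * τ)) * DD τ) = 0 := by
      linear_combination ((3 * w) ^ 12 * DD τ * nq (tw w) ^ 2) * h3 - (nq τ ^ 2 * DD τ) * h4
    have h6 := (mul_eq_zero.1 this).resolve_right (mul_ne_zero (mul_ne_zero h3w hD3) hD1)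
    exact sub_eq_zero.1 h6
  have e : 24 * KK w = 24 * LL (nq τ) + (2 : ℕ) * (2 * Real.pi * Complex.I * tw w) -
     (24 * LL (nq (tw w)) + (2 : ℕ) * (2 * Real.pi * Complex.I * τ)) := by
    rw [KK]; push_cast; ring
  rw [e, Complex.exp_sub, Complex.exp_add, Complex.exp_add, Complex.exp_nat_mul, Complex.exp_nat_mul]
  change Complex.exp (24 * LL (nq τ)) * nq (tw w) ^ 2 / (Complex.exp (24 * LL (nq (tw w))) * nq τ ^ 2) = 1
  rw [h5, div_self]
  exact mul_ne_zero (Complex.exp_ne_zero _) (pow_ne_zero _ (Complex.exp_ne_zero _))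

theorem third_im (w : ℂ) : (1 / 3 + w : ℂ).im = w.im := by
  have h2 : (1 / 3 : ℂ).im = 0 := by
    rw [show (1 / 3 : ℂ) = ((1 / 3 : ℝ) : ℂ) by push_cast; rfl, Complex.ofReal_im]
  rw [Complex.add_im, h2, zero_add]

theorem KK_cont : ContinuousOn KK {w : ℂ | 0 < w.im} := by
  intro w hw
  have hw0 : w ≠ 0 := by rintro rfl; simp at hw
  apply ContinuousAt.continuousWithinAt
  have ht : ContinuousAt tw w := by
    unfold tw
    have : (9 * w) ≠ 0 := by simpa using hw0
    fun_prop (disch := assumption)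
  have hn : Continuous nq := by unfold nq; fun_prop
  have h1 : ContinuousAt (fun w => LL (nq (1 / 3 + w))) w :=
    ContinuousAt.comp (f := fun w => nq (1 / 3 + w)) (g := LL)
      (LL_continuousAt _ (nq_norm_lt _ (by rw [third_im]; exact hw)))
      (by fun_prop)
  have h2 : ContinuousAt (fun w => LL (nq (tw w))) w :=
    ContinuousAt.comp (f := fun w => nq (tw w)) (g := LL)
      (LL_continuousAt _ (nq_norm_lt _ (tw_pos w hw)))
      (hn.continuousAt.comp ht)
  unfold KK
  fun_prop

theorem KK_int (w : ℂ) (hw : 0 < w.im) : ∃ k : ℤ, KK w = k * (Real.pi * Complex.I / 12) := by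
  obtain ⟨k, hk⟩ := Complex.exp_eq_one_iff.1 (KK_exp w hw)
  exact ⟨k, by linear_combination hk / 24⟩

theorem KK_const (w w' : ℂ) (hw : 0 < w.im) (hw' : 0 < w'.im) : KK w = KK w' := by
  obtain ⟨k, hk⟩ := KK_int w hw
  obtain ⟨k', hk'⟩ := KK_int w' hw'
  by_contra hne
  have hpre : IsPreconnected {w : ℂ | 0 < w.im} := (convex_halfSpace_im_gt 0).isPreconnected
  have hp := Real.pi_pos
  have hval : ∀ w k, KK w = (k : ℤ) * (Real.pi * Complex.I / 12) → (KK w).im * 12 / Real.pi = k := by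
    intro w k h
    have : KK w = ((k * Real.pi / 12 : ℝ) : ℂ) * Complex.I := by rw [h]; push_cast; ring
    rw [this, Complex.im_ofReal_mul, Complex.I_im]
    field_simp
  set f : ℂ → ℝ := fun w => (KK w).im * 12 / Real.pi with hf
  have hc : ContinuousOn f {w : ℂ | 0 < w.im} := by
    have := Complex.continuous_im.comp_continuousOn KK_cont
    exact (this.mul continuousOn_const).div_const _
  have hkk : k ≠ k' := by rintro rfl; exact hne (hk.trans hk'.symm)
  have key : ∀ a b : ℂ, ∀ i j : ℤ, 0 < a.im → 0 < b.im → f a = i → f b = j → i < j → False := by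
    intro a b i j ha hb hi hj hij
    have hij' : (i : ℝ) + 1 ≤ j := by exact_mod_cast hij
    have := hpre.intermediate_value ha hb hc
    have h2 : (i : ℝ) + 1 / 2 ∈ Set.Icc (f a) (f b) := by
      rw [hi, hj]; constructor <;> linarith
    obtain ⟨c, hc1, hc2⟩ := this h2
    obtain ⟨l, hl⟩ := KK_int c hc1
    have h3 := hval c l hl
    have h4 : (l : ℝ) = i + 1 / 2 := by rw [← h3, ← hc2]
    have h5 : ((2 * l : ℤ) : ℝ) = ((2 * i + 1 : ℤ) : ℝ) := by push_cast; linarith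
    have h6 : 2 * l = 2 * i + 1 := by exact_mod_cast h5
    omega
  rcases lt_or_gt_of_ne hkk with h | h
  · exact key w w' k k' hw hw' (hval _ _ hk) (hval _ _ hk') h
  · exact key w' w k' k hw' hw (hval _ _ hk') (hval _ _ hk) h

theorem KK_val (w : ℂ) (hw : 0 < w.im) : KK w = -(Real.pi * Complex.I / 6) := by
  have hp := Real.pi_gt_d4
  have hp2 := Real.pi_lt_d4
  have hi : (0:ℝ) < (Complex.I / 3).im := by
    rw [show Complex.I / 3 = ((1 / 3 : ℝ) : ℂ) * Complex.I by push_cast; ring, Complex.im_ofReal_mul, Complex.I_im]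
    norm_num
  rw [KK_const w (Complex.I / 3) hw hi]
  obtain ⟨k, hk⟩ := KK_int _ hi
  set q := nq (1 / 3 + Complex.I / 3) with hq
  have hqn : ‖q‖ ≤ 1 / 8 := by
    rw [hq, nq_norm, third_im, show Complex.I / 3 = ((1 / 3 : ℝ) : ℂ) * Complex.I by push_cast; ring,
      Complex.im_ofReal_mul, Complex.I_im, Real.exp_neg, show (1 / 8 : ℝ) = (8 : ℝ)⁻¹ by norm_num]
    apply inv_anti₀ (by norm_num)
    calc (8 : ℝ) ≤ 2.7182818283 ^ 2 * (0.0943 + 1) := by norm_num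
      _ ≤ Real.exp 1 ^ 2 * Real.exp 0.0943 := by
        gcongr
        · exact Real.exp_one_gt_d9.le
        · exact Real.add_one_le_exp _
      _ = Real.exp 2.0943 := by rw [← Real.exp_nat_mul, ← Real.exp_add]; norm_num
      _ ≤ _ := Real.exp_le_exp.2 (by linarith)
  have hqi : 0 ≤ q.im := by
    have e : q = Complex.exp (((-(2 * Real.pi / 3) : ℝ) : ℂ) + ((2 * Real.pi / 3 : ℝ) : ℂ) * Complex.I) := by
      rw [hq, nq]
      congr 1
      push_cast
      linear_combination (2 * Real.pi / 3) * Complex.I_sq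
    rw [e, Complex.exp_add, ← Complex.ofReal_exp, Complex.im_ofReal_mul, Complex.exp_ofReal_mul_I_im]
    apply mul_nonneg (Real.exp_pos _).le
    exact Real.sin_nonneg_of_nonneg_of_le_pi (by linarith) (by linarith)
  have hconj : nq (tw (Complex.I / 3)) = starRingEnd ℂ q := by
    rw [hq, nq, nq, ← Complex.exp_conj]
    congr 1
    simp only [map_mul, map_add, map_div₀, Complex.conj_I, Complex.conj_ofReal, map_ofNat, map_one, tw]
    have : (1 : ℂ) / (9 * (Complex.I / 3)) = - Complex.I / 3 := by
      rw [show 9 * (Complex.I / 3) = 3 * Complex.I by ring, one_div, mul_inv, Complex.inv_I]; ring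
    rw [this]; ring
  have hdiff : (1 / 3 + Complex.I / 3 - tw (Complex.I / 3) : ℂ) = 2 / 3 := by
    have : (1 : ℂ) / (9 * (Complex.I / 3)) = - Complex.I / 3 := by
      rw [show 9 * (Complex.I / 3) = 3 * Complex.I by ring, one_div, mul_inv, Complex.inv_I]; ring
    rw [tw, this]; ring
  have hK : KK (Complex.I / 3) = ((2 * (LL q).im - Real.pi / 9 : ℝ) : ℂ) * Complex.I := by
    rw [KK, hconj, LL_conj q (by linarith), hdiff, ← hq, Complex.sub_conj]
    push_cast
    ring
  have hL := LL_add_le q (by linarith)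
  have hL2 : |(LL q).im + q.im| ≤ 0.0384 := by
    rw [← Complex.add_im]
    refine le_trans (Complex.abs_im_le_norm _) (le_trans hL ?_)
    have h0 := norm_nonneg q
    have : ‖q‖ / (1 - ‖q‖) ^ 2 ≤ ‖q‖ / (1 - 1 / 8) ^ 2 := by
      gcongr
    have h8 : ‖q‖ / (1 - 1 / 8) ^ 2 = ‖q‖ * (64 / 49) := by norm_num; ring
    rw [h8] at this
    linarith
  have hq2 := le_trans (Complex.abs_im_le_norm q) hqn
  rw [abs_le] at hL2 hq2
  have hk2 : (k : ℝ) * (Real.pi / 12) = 2 * (LL q).im - Real.pi / 9 := by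
    have h1 : (((k : ℝ) * (Real.pi / 12) : ℝ) : ℂ) * Complex.I = ((2 * (LL q).im - Real.pi / 9 : ℝ) : ℂ) * Complex.I := by
      rw [← hK, hk]; push_cast; ring
    have := mul_right_cancel₀ Complex.I_ne_zero h1
    exact_mod_cast this
  have hk3 : k = -2 := by
    have a1 : (k : ℝ) < -1 := by
      by_contra hcon
      push Not at hcon
      nlinarith
    have a2 : (-3 : ℝ) < k := by
      by_contra hcon
      push Not at hcon
      nlinarith
    have a1 : k < -1 := by exact_mod_cast a1
    have a2 : -3 < k := by exact_mod_cast a2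
    omega
  rw [hk, hk3]
  push_cast
  ring

theorem main_rel (w : ℂ) (hw : 0 < w.im) : LL (nq (1 / 3 + w)) =
    LL (nq (tw w)) + Real.pi * Complex.I / 6 * (w + 1 / (9 * w)) - Real.pi * Complex.I / 18 := by
  have := KK_val w hw
  rw [KK] at this
  rw [tw] at this ⊢
  linear_combination this


theorem moment6 (b : ℝ) (hb : 0 < b) : ∫ u in (0:ℝ)..(1/2), u ^ 6 * Real.exp (-b * u ^ 2) ≤
    15 / 16 * √Real.pi / (b ^ 3 * √b) := by
  have h1 := integral_rpow_mul_exp_neg_mul_rpow (p := 2) (q := 6) (b := b) (by norm_num) (by norm_num) hb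
  have h2 := integrableOn_rpow_mul_exp_neg_mul_sq (b := b) (s := 6) hb (by norm_num)
  have e : ∀ x : ℝ, x ^ (6 : ℝ) * Real.exp (-b * x ^ (2 : ℝ)) = x ^ 6 * Real.exp (-b * x ^ 2) := by
    intro x
    have e6 : x ^ (6 : ℝ) = x ^ 6 := by exact_mod_cast Real.rpow_natCast x 6
    rw [e6, Real.rpow_two]
  have e' : ∀ x : ℝ, x ^ (6 : ℝ) * Real.exp (-b * x ^ 2) = x ^ 6 * Real.exp (-b * x ^ 2) := by
    intro x
    have e6 : x ^ (6 : ℝ) = x ^ 6 := by exact_mod_cast Real.rpow_natCast x 6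
    rw [e6]
  simp only [e] at h1
  simp only [e'] at h2
  have hG : Real.Gamma ((6 + 1) / 2) = 15 / 8 * √Real.pi := by
    have := Real.Gamma_nat_add_half 3
    rw [show ((6 + 1) / 2 : ℝ) = ((3 : ℕ) : ℝ) + 1 / 2 by norm_num, this]
    norm_num [Nat.doubleFactorial]
    ring
  have hb7 : b ^ (-(6 + 1) / 2 : ℝ) = 1 / (b ^ 3 * √b) := by
    rw [show (-(6 + 1) / 2 : ℝ) = -(((3 : ℕ) : ℝ) + 1 / 2) by norm_num, Real.rpow_neg hb.le, Real.rpow_add hb,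
      Real.rpow_natCast, ← Real.sqrt_eq_rpow, one_div]
  rw [hG, hb7] at h1
  calc _ = ∫ u in Set.Ioc (0:ℝ) (1/2), u ^ 6 * Real.exp (-b * u ^ 2) := by
        rw [intervalIntegral.integral_of_le (by norm_num)]
    _ ≤ ∫ u in Set.Ioi (0:ℝ), u ^ 6 * Real.exp (-b * u ^ 2) := by
        apply MeasureTheory.setIntegral_mono_set h2
        · filter_upwards with u
          simp only [Pi.zero_apply]
          positivity
        · exact (Set.Ioc_subset_Ioi_self).eventuallyLE
    _ = _ := by rw [h1]; ring

theorem gauss_half (A : ℝ) (hA : 0 < A) : √(Real.pi / A) / 2 - Real.exp (-A / 4) / A ≤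
    ∫ u in (0:ℝ)..(1/2), Real.exp (-A * u ^ 2) := by
  have h1 := integral_gaussian_Ioi A
  have hi := (integrable_exp_neg_mul_sq hA)
  have h2 : ∫ u in (0:ℝ)..(1/2), Real.exp (-A * u ^ 2) = ∫ u in Set.Ioc (0:ℝ) (1/2), Real.exp (-A * u ^ 2) := by
    rw [intervalIntegral.integral_of_le (by norm_num)]
  have h3 : ∫ u in Set.Ioi (0:ℝ), Real.exp (-A * u ^ 2) = (∫ u in Set.Ioc (0:ℝ) (1/2), Real.exp (-A * u ^ 2)) +
      ∫ u in Set.Ioi (1/2 : ℝ), Real.exp (-A * u ^ 2) := by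
    rw [← MeasureTheory.setIntegral_union (Set.Ioc_disjoint_Ioi le_rfl) measurableSet_Ioi hi.integrableOn hi.integrableOn,
      Set.Ioc_union_Ioi_eq_Ioi (by norm_num)]
  have hd : ∀ x ∈ Set.Ici (1/2 : ℝ), HasDerivAt (fun u => -(Real.exp (-A * u ^ 2) / A)) (2 * x * Real.exp (-A * x ^ 2)) x := by
    intro x _
    have h := ((((hasDerivAt_id x).pow 2).const_mul (-A)).exp.div_const A).neg
    convert! h using 1
    simp
    field_simp
  have hlim : Filter.Tendsto (fun u : ℝ => -(Real.exp (-A * u ^ 2) / A)) Filter.atTop (nhds 0) := by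
    have : Filter.Tendsto (fun u : ℝ => Real.exp (-A * u ^ 2)) Filter.atTop (nhds 0) := by
      apply Real.tendsto_exp_atBot.comp
      exact (Filter.tendsto_pow_atTop (by norm_num)).const_mul_atTop_of_neg (by linarith)
    have := (this.div_const A).neg
    simpa using this
  have hpos : ∀ x ∈ Set.Ioi (1/2 : ℝ), 0 ≤ 2 * x * Real.exp (-A * x ^ 2) := by
    intro x hx
    have : (1/2 : ℝ) < x := hx
    positivity
  have h4 := MeasureTheory.integral_Ioi_of_hasDerivAt_of_nonneg' hd hpos hlim
  have h5 := MeasureTheory.integrableOn_Ioi_deriv_of_nonneg' hd hpos hlim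
  have h6 : ∫ u in Set.Ioi (1/2 : ℝ), Real.exp (-A * u ^ 2) ≤ ∫ u in Set.Ioi (1/2 : ℝ), 2 * u * Real.exp (-A * u ^ 2) := by
    apply MeasureTheory.setIntegral_mono_on hi.integrableOn h5 measurableSet_Ioi
    intro x hx
    have : (1/2 : ℝ) < x := hx
    have := Real.exp_pos (-A * x ^ 2)
    nlinarith
  have h7 : (-A * (1/2 : ℝ) ^ 2) = -A / 4 := by ring
  rw [h4, h7] at h6
  rw [h2]
  linarith

theorem int_lower (f : ℝ → ℝ) (hf : Continuous f) (a b m : ℝ) (hab : a ≤ b) (h : ∀ u ∈ Set.Icc a b, -m ≤ f u) :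
    -(m * (b - a)) ≤ ∫ u in a..b, f u := by
  have := intervalIntegral.integral_mono_on hab (f := fun _ => -m) (g := f) (μ := MeasureTheory.volume) (by simp) (hf.intervalIntegrable _ _) h
  simp at this
  linarith

/-- the real part of the main integrand -/
noncomputable def kr (A u : ℝ) : ℝ := Real.exp (-(A * u ^ 2 / (1 + u ^ 2))) * Real.cos (A * u ^ 3 / (1 + u ^ 2))

theorem kr_cont (A : ℝ) : Continuous (kr A) := by
  unfold kr
  have : ∀ u : ℝ, 1 + u ^ 2 ≠ 0 := fun u => by positivity
  fun_prop (disch := assumption)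

theorem kr_ge (A u s : ℝ) (hA : 0 < A) (hs : s * (1 + u ^ 2) ≤ u ^ 2) : -Real.exp (-(A * s)) ≤ kr A u := by
  have h1 : Real.exp (-(A * u ^ 2 / (1 + u ^ 2))) ≤ Real.exp (-(A * s)) := by
    apply Real.exp_le_exp.2
    apply neg_le_neg
    rw [le_div_iff₀ (by positivity)]
    nlinarith
  have h2 := Real.neg_one_le_cos (A * u ^ 3 / (1 + u ^ 2))
  have h3 := Real.exp_pos (-(A * u ^ 2 / (1 + u ^ 2)))
  unfold kr
  nlinarith

theorem kr_half (A : ℝ) (hA : 0 < A) (u : ℝ) (hu : u ∈ Set.Icc (0:ℝ) (1/2)) :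
    Real.exp (-A * u ^ 2) - A ^ 2 / 2 * (u ^ 6 * Real.exp (-(0.8 * A) * u ^ 2)) ≤ kr A u := by
  obtain ⟨h0, h1⟩ := hu
  have hu2 : u ^ 2 ≤ 1 / 4 := by nlinarith
  have hp : 0 < 1 + u ^ 2 := by positivity
  unfold kr
  set v := A * u ^ 3 / (1 + u ^ 2) with hv
  have hc := Real.one_sub_sq_div_two_le_cos (x := v)
  have e1 : Real.exp (-A * u ^ 2) ≤ Real.exp (-(A * u ^ 2 / (1 + u ^ 2))) := by
    apply Real.exp_le_exp.2
    rw [neg_mul]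
    apply neg_le_neg
    apply div_le_self (by positivity)
    nlinarith
  have e2 : Real.exp (-(A * u ^ 2 / (1 + u ^ 2))) ≤ Real.exp (-(0.8 * A) * u ^ 2) := by
    apply Real.exp_le_exp.2
    rw [neg_mul]
    apply neg_le_neg
    rw [le_div_iff₀ hp]
    have : 0 ≤ A * u ^ 2 := by positivity
    nlinarith
  have e3 : v ^ 2 ≤ A ^ 2 * u ^ 6 := by
    have : v ≤ A * u ^ 3 := div_le_self (by positivity) (by nlinarith)
    have h0v : 0 ≤ v := by positivity
    calc v ^ 2 ≤ (A * u ^ 3) ^ 2 := by gcongr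
      _ = _ := by ring
  set E := Real.exp (-(A * u ^ 2 / (1 + u ^ 2))) with hE
  have hE0 : 0 < E := Real.exp_pos _
  have e4 : E * (v ^ 2 / 2) ≤ Real.exp (-(0.8 * A) * u ^ 2) * (A ^ 2 * u ^ 6 / 2) := by
    gcongr
  have e5 : E * (1 - v ^ 2 / 2) ≤ E * Real.cos v := by gcongr
  linarith

theorem kr_int (A : ℝ) (hA : 0 < A) :
    √(Real.pi / A) / 2 - Real.exp (-A / 4) / A - A ^ 2 / 2 * (15 / 16 * √Real.pi / ((0.8 * A) ^ 3 * √(0.8 * A)))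
      - Real.exp (-(A * (1/5))) / 4 - Real.exp (-(A * 0.36)) / 4 - Real.exp (-(A * (1/2))) * (√3 - 1) ≤
    ∫ u in (0:ℝ)..√3, kr A u := by
  have hc := kr_cont A
  have h3 : (1 : ℝ) ≤ √3 := by rw [Real.one_le_sqrt]; norm_num
  have i1 := int_lower (kr A) hc (1/2) (3/4) (Real.exp (-(A * (1/5)))) (by norm_num) (fun u hu => by
    apply kr_ge A u _ hA
    nlinarith [hu.1])
  have i2 := int_lower (kr A) hc (3/4) 1 (Real.exp (-(A * 0.36))) (by norm_num) (fun u hu => by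
    apply kr_ge A u _ hA
    nlinarith [hu.1])
  have i3 := int_lower (kr A) hc 1 (√3) (Real.exp (-(A * (1/2)))) h3 (fun u hu => by
    apply kr_ge A u _ hA
    nlinarith [hu.1])
  have hs : ∫ u in (0:ℝ)..√3, kr A u = (∫ u in (0:ℝ)..(1/2), kr A u) + (∫ u in (1/2:ℝ)..(3/4), kr A u) + 
     (∫ u in (3/4:ℝ)..1, kr A u) + ∫ u in (1:ℝ)..√3, kr A u := by
    rw [intervalIntegral.integral_add_adjacent_intervals, intervalIntegral.integral_add_adjacent_intervals,
      intervalIntegral.integral_add_adjacent_intervals] <;> exact hc.intervalIntegrable _ _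
  have g1 := gauss_half A hA
  have g2 := moment6 (0.8 * A) (by positivity)
  have c1 : Continuous (fun u : ℝ => Real.exp (-A * u ^ 2)) := by fun_prop
  have c2 : Continuous (fun u : ℝ => (u ^ 6 * Real.exp (-(0.8 * A) * u ^ 2))) := by fun_prop
  have i0 : (∫ u in (0:ℝ)..(1/2), Real.exp (-A * u ^ 2)) - A ^ 2 / 2 * (∫ u in (0:ℝ)..(1/2), u ^ 6 * Real.exp (-(0.8 * A) * u ^ 2))
      ≤ ∫ u in (0:ℝ)..(1/2), kr A u := by
    rw [← intervalIntegral.integral_const_mul, ← intervalIntegral.integral_sub (c1.intervalIntegrable _ _)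
      ((c2.const_mul _).intervalIntegrable _ _)]
    apply intervalIntegral.integral_mono_on (by norm_num)
    · exact (c1.sub (continuous_const.mul c2)).intervalIntegrable _ _
    · exact hc.intervalIntegrable _ _
    · exact kr_half A hA
  have g3 := mul_le_mul_of_nonneg_left g2 (show 0 ≤ A ^ 2 / 2 by positivity)
  rw [hs]
  linarith


theorem exp_neg_le (a b c : ℝ) (hb : 0 < b) (ha : 0 ≤ a) (h : 1 ≤ b * c) (hc : c ≤ 1 + a + a ^ 2 / 2) : Real.exp (-a) ≤ b := by
  rw [Real.exp_neg]
  have h1 := Real.quadratic_le_exp_of_nonneg ha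
  rw [inv_le_iff_one_le_mul₀ (Real.exp_pos _)]
  nlinarith

theorem exp_neg_le' (a b : ℝ) (k : ℕ) (h : Real.exp (-a) ≤ b) : Real.exp (-(k * a)) ≤ b ^ k := by
  rw [show -(k * a) = k * -a by ring, Real.exp_nat_mul]
  gcongr

theorem kr_int_num (A : ℝ) (hA : 11 ≤ A) : 0.525 / √A ≤ ∫ u in (0:ℝ)..√3, kr A u := by
  have hA0 : 0 < A := by linarith
  refine le_trans ?_ (kr_int A hA0)
  set r := √A with hr
  have hr0 : 0 < r := Real.sqrt_pos.2 hA0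
  have hrr : r * r = A := Real.mul_self_sqrt hA0.le
  set p := √Real.pi with hp
  have hp0 : 1.772 ≤ p := by
    apply Real.le_sqrt_of_sq_le
    have := Real.pi_gt_d4
    linarith
  have e1 : √(Real.pi / A) = p / r := Real.sqrt_div Real.pi_pos.le _
  have h8 : 0.894 ≤ √(0.8 : ℝ) := by
    apply Real.le_sqrt_of_sq_le
    norm_num
  have e2 : √(0.8 * A) = √0.8 * r := Real.sqrt_mul (by norm_num) _
  have hs3 : √3 ≤ 1.7321 := by
    rw [Real.sqrt_le_left (by norm_num)]; norm_num
  -- moment term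
  have m1 : A ^ 2 / 2 * (15 / 16 * p / ((0.8 * A) ^ 3 * √(0.8 * A))) ≤ p / (2 * r) * (2.05 / A) := by
    rw [e2]
    have : A ^ 2 / 2 * (15 / 16 * p / ((0.8 * A) ^ 3 * (√0.8 * r))) = p / (2 * r) * (15 / 16 / (0.8 ^ 3 * √0.8) / A) := by
      field_simp
    rw [this]
    gcongr
    rw [div_le_iff₀ (by positivity)]
    nlinarith
  -- exponential tails
  set X := Real.exp (-(A * (1 / 5))) with hX
  have hX0 : 0 < X := Real.exp_pos _
  have x1 : Real.exp (-A / 4) ≤ 0.6 * X := by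
    have : Real.exp (-A / 4) = Real.exp (-(A / 20)) * X := by rw [hX, ← Real.exp_add]; congr 1; ring
    rw [this]
    gcongr
    refine le_trans (Real.exp_le_exp.2 (show -(A / 20) ≤ -0.55 by linarith)) ?_
    exact exp_neg_le _ _ 1.7 (by norm_num) (by norm_num) (by norm_num) (by norm_num)
  have x2 : Real.exp (-(A * 0.36)) ≤ 0.2 * X := by
    have : Real.exp (-(A * 0.36)) = Real.exp (-(A * 0.16)) * X := by rw [hX, ← Real.exp_add]; congr 1; ring
    rw [this]
    gcongr
    refine le_trans (Real.exp_le_exp.2 (show -(A * 0.16) ≤ -(((2 : ℕ) : ℝ) * 0.88) by push_cast; linarith)) ?_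
    refine le_trans (exp_neg_le' _ _ _ (exp_neg_le 0.88 0.443 2.26 (by norm_num) (by norm_num) (by norm_num) (by norm_num))) ?_
    norm_num
  have x3 : Real.exp (-(A * (1/2))) ≤ 0.05 * X := by
    have : Real.exp (-(A * (1/2))) = Real.exp (-(A * 0.3)) * X := by rw [hX, ← Real.exp_add]; congr 1; ring
    rw [this]
    gcongr
    refine le_trans (Real.exp_le_exp.2 (show -(A * 0.3) ≤ -(((4 : ℕ) : ℝ) * 0.825) by push_cast; linarith)) ?_
    refine le_trans (exp_neg_le' _ _ _ (exp_neg_le 0.825 0.463 2.16 (by norm_num) (by norm_num) (by norm_num) (by norm_num))) ?_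
    norm_num
  have x4 : X ≤ 1.285 / A := by
    have h : A / 11 ≤ Real.exp (A / 11 - 1) := by
      have := Real.add_one_le_exp (A / 11 - 1); linarith
    have h22 : Real.exp (-2.2) ≤ 0.1168 := by
      have := exp_neg_le' 0.44 0.6508 5 (exp_neg_le 0.44 0.6508 1.5368 (by norm_num) (by norm_num) (by norm_num) (by norm_num))
      refine le_trans (le_of_eq ?_) (le_trans this (by norm_num))
      norm_num
    rw [le_div_iff₀ hA0]
    calc X * A = 11 * (X * (A / 11)) := by ring
      _ ≤ 11 * (X * Real.exp (A / 11 - 1)) := by gcongr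
      _ = 11 * Real.exp (A / 11 - 1 - A * (1/5)) := by
        rw [hX, ← Real.exp_add]; congr 2; ring
      _ ≤ 11 * Real.exp (-2.2) := by
        gcongr; linarith
      _ ≤ _ := by linarith
  rw [e1]
  have hAi : 1 / A ≤ 1 / 11 := one_div_le_one_div_of_le (by norm_num) hA
  have x5 : Real.exp (-A / 4) / A ≤ 0.0546 * X := by
    calc Real.exp (-A / 4) / A = Real.exp (-A / 4) * (1 / A) := by ring
      _ ≤ (0.6 * X) * (1 / 11) := by gcongr
      _ ≤ _ := by linarith
  have x6 : Real.exp (-(A * (1/2))) * (√3 - 1) ≤ 0.0367 * X := by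
    have : (1 : ℝ) ≤ √3 := by rw [Real.one_le_sqrt]; norm_num
    calc _ ≤ (0.05 * X) * 0.7321 := by gcongr; linarith
      _ ≤ _ := by linarith
  have x7 : X ≤ 0.3875 / r := by
    refine le_trans x4 ?_
    rw [← hrr, ← div_div]
    gcongr
    rw [div_le_iff₀ hr0]
    have : 3.3166 ≤ r := by
      apply Real.le_sqrt_of_sq_le; linarith
    linarith
  have x8 : p / (2 * r) * (2.05 / A) ≤ p / (2 * r) * (2.05 / 11) := by gcongr
  have x9 : 1.772 / r ≤ p / r := by gcongr
  have e5 : p / (2 * r) * (2.05 / 11) = (p / r) * (2.05 / 22) := by field_simp; norm_num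
  have e6 : (0.525 : ℝ) / r = 0.525 * (1 / r) := by ring
  have e7 : (1.772 : ℝ) / r = 1.772 * (1 / r) := by ring
  have e8 : (0.3875 : ℝ) / r = 0.3875 * (1 / r) := by ring
  have hri : 0 < 1 / r := by positivity
  rw [e6]; rw [e7] at x9; rw [e8] at x7
  linarith


/-- the Cauchy integrand -/
noncomputable def Psi (δ y : ℝ) (n : ℕ) (x : ℝ) : ℂ :=
  Complex.exp (δ * LL (qq x y) + 2 * Real.pi * n * y - 2 * Real.pi * Complex.I * n * x)

theorem Psi_cont (δ y : ℝ) (hy : 0 < y) (n : ℕ) : Continuous (Psi δ y n) := by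
  have h1 : Continuous (fun x : ℝ => LL (qq x y)) := by
    rw [continuous_iff_continuousAt]
    intro x
    have hq : Continuous (fun x : ℝ => qq x y) := by unfold qq; fun_prop
    exact ContinuousAt.comp (f := fun x : ℝ => qq x y) (g := LL) (LL_continuousAt _ (qq_norm_lt x y hy)) hq.continuousAt
  unfold Psi
  fun_prop

theorem Psi_symm (δ y : ℝ) (hy : 0 < y) (n : ℕ) (x : ℝ) : (Psi δ y n (1 - x)).re = (Psi δ y n x).re := by
  have hq : qq (1 - x) y = starRingEnd ℂ (qq x y) := by
    rw [qq, qq, ← Complex.exp_conj]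
    simp only [map_mul, map_add, Complex.conj_I, Complex.conj_ofReal, map_ofNat]
    rw [Complex.exp_eq_exp_iff_exists_int]
    refine ⟨1, ?_⟩
    push_cast
    ring
  have : Psi δ y n (1 - x) = starRingEnd ℂ (Psi δ y n x) := by
    rw [Psi, Psi, ← Complex.exp_conj, hq, LL_conj _ (qq_norm_lt x y hy)]
    simp only [map_mul, map_add, map_sub, Complex.conj_I, Complex.conj_ofReal, map_ofNat, map_natCast]
    rw [Complex.exp_eq_exp_iff_exists_int]
    refine ⟨-n, ?_⟩
    push_cast
    ring
  rw [this, Complex.conj_re]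

theorem cauchy_half (δ : ℝ) (c : ℕ → ℝ) (hc : ∀ q : ℂ, ‖q‖ < 1 →
      HasSum (fun m : ℕ => (c m : ℂ) * q ^ m) (Complex.exp ((δ : ℂ) * LL q))) (n : ℕ) (y : ℝ) (hy : 0 < y) :
    c n = 2 * ∫ x in (0:ℝ)..(1/2), (Psi δ y n x).re := by
  have h1 := coef_int (fun m => (c m : ℂ)) (fun q => Complex.exp ((δ : ℂ) * LL q)) hc y hy n
  have hcont := Psi_cont δ y hy n
  have h2 : (c n : ℂ) = ∫ x in (0:ℝ)..1, Psi δ y n x := by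
    have e : ∀ x : ℝ, Psi δ y n x = Complex.exp (2 * Real.pi * n * y) * 
        (Complex.exp ((δ : ℂ) * LL (qq x y)) * Complex.exp (-(2 * Real.pi * Complex.I * n) * x)) := by
      intro x
      rw [Psi, ← Complex.exp_add, ← Complex.exp_add]
      congr 1
      ring
    simp_rw [e]
    rw [intervalIntegral.integral_const_mul, ← h1]
    push_cast
    rw [← Complex.exp_nat_mul, mul_left_comm, ← Complex.exp_add]
    rw [show (2 * Real.pi * n * y + n * -(2 * Real.pi * y) : ℂ) = 0 by ring]
    simp
  have h3 : c n = ∫ x in (0:ℝ)..1, (Psi δ y n x).re := by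
    have := Complex.reCLM.intervalIntegral_comp_comm (hcont.intervalIntegrable (μ := MeasureTheory.volume) 0 1)
    rw [← h2] at this
    simp only [Complex.reCLM_apply, Complex.ofReal_re] at this
    exact this.symm
  have hre : Continuous (fun x => (Psi δ y n x).re) := Complex.continuous_re.comp hcont
  have h4 : ∫ x in (1/2:ℝ)..1, (Psi δ y n x).re = ∫ x in (0:ℝ)..(1/2), (Psi δ y n x).re := by
    have := intervalIntegral.integral_comp_sub_left (a := 0) (b := 1/2) (fun x => (Psi δ y n x).re) 1
    simp_rw [Psi_symm δ y hy n] at this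
    rw [this]
    norm_num
  rw [h3, ← intervalIntegral.integral_add_adjacent_intervals (hre.intervalIntegrable 0 (1/2)) (hre.intervalIntegrable (1/2) 1), h4]
  ring

theorem abs_int_le (f : ℝ → ℝ) (a b M : ℝ) (hab : a ≤ b) (h : ∀ x ∈ Set.Icc a b, |f x| ≤ M) :
    |∫ x in a..b, f x| ≤ M * (b - a) := by
  have := intervalIntegral.norm_integral_le_of_norm_le_const (a := a) (b := b) (f := f) (C := M) (fun x hx => by
    rw [Set.uIoc_of_le hab] at hx
    exact h x ⟨hx.1.le, hx.2⟩)
  rwa [abs_of_nonneg (by linarith), Real.norm_eq_abs] at this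

/-- the parameters -/
structure Par (δ : ℝ) (n : ℕ) (y A : ℝ) : Prop where
  d0 : 0 < δ
  d3 : δ ≤ 3
  y0 : 0 < y
  y1 : y ≤ 0.015
  A0 : 11 ≤ A
  Ay : A = Real.pi * δ / (54 * y)
  An : A = 2 * Real.pi * (n - δ / 12) * y

theorem off_bound {δ : ℝ} {n : ℕ} {y A : ℝ} (h : Par δ n y A) (x : ℝ) (hx0 : 0 ≤ x) (hx1 : x ≤ 1 / 2)
    (hoff : 3 * y ^ 2 ≤ (x - 1 / 3) ^ 2) : |(Psi δ y n x).re| ≤ Real.exp (0.0275 + 5 * A / 4) := by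
  refine le_trans (Complex.abs_re_le_norm _) ?_
  have h1 := off_arc x y h.y0 h.y1 hx0 hx1 hoff
  have hy := h.y0
  rw [Psi, Complex.norm_exp]
  apply Real.exp_le_exp.2
  have e : (δ * LL (qq x y) + 2 * Real.pi * n * y - 2 * Real.pi * Complex.I * n * x : ℂ).re = 
     δ * (LL (qq x y)).re + 2 * Real.pi * n * y := by
    have e1 : (2 * Real.pi * n * y : ℂ) = ((2 * Real.pi * n * y : ℝ) : ℂ) := by push_cast; ring
    have e2 : (2 * Real.pi * Complex.I * n * x : ℂ) = ((2 * Real.pi * n * x : ℝ) : ℂ) * Complex.I := by push_cast; ring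
    rw [e1, e2, Complex.sub_re, Complex.add_re, Complex.re_ofReal_mul, Complex.re_ofReal_mul, Complex.ofReal_re, Complex.I_re]
    ring
  rw [e]
  have h2 := mul_le_mul_of_nonneg_left h1 (show 0 ≤ δ / 24 by linarith [h.d0])
  have e3 : δ / 24 * (0.22 - 4 * Real.pi * y + Real.pi / (9 * y)) = δ / 24 * 0.22 - 2 * Real.pi * (δ / 12) * y + A / 4 := by
    rw [h.Ay]; field_simp; ring
  have h3 := h.An
  have h4 := h.d3
  rw [e3] at h2
  linarith

theorem wq_norm (y u : ℝ) (hy : 0 < y) : ‖nq (tw (y * (u + Complex.I)))‖ = Real.exp (-(2 * Real.pi / (9 * y * (1 + u ^ 2)))) := by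
  rw [nq_norm, tw_im]
  have e1 : ((y : ℂ) * (u + Complex.I)).im = y := by simp
  have e2 : Complex.normSq ((y : ℂ) * (u + Complex.I)) = y ^ 2 * (1 + u ^ 2) := by
    rw [Complex.normSq_apply]; simp; ring
  rw [e1, e2]
  congr 1
  field_simp

/-- main exponential -/
noncomputable def HH (A θ u : ℝ) : ℂ :=
  Complex.exp (((2 * A - A * u ^ 2 / (1 + u ^ 2) : ℝ) : ℂ) + ((-(θ + A * u ^ 3 / (1 + u ^ 2)) : ℝ) : ℂ) * Complex.I)

theorem psi_main {δ : ℝ} {n : ℕ} {y A : ℝ} (h : Par δ n y A) (u : ℝ) :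
    Psi δ y n (1 / 3 + y * u) = HH A (2 * Real.pi * n / 3 + δ * Real.pi / 18) u *
      Complex.exp (δ * LL (nq (tw (y * (u + Complex.I))))) := by
  have hy := h.y0
  have him : ((y : ℂ) * (u + Complex.I)).im = y := by simp
  have hq : qq (1 / 3 + y * u) y = nq (1 / 3 + y * (u + Complex.I)) := by
    rw [qq, nq]; congr 1; push_cast; ring
  have hm := main_rel (y * (u + Complex.I)) (by rw [him]; exact hy)
  rw [Psi, hq, hm, HH, ← Complex.exp_add]
  congr 1
  have hu : (1 + (u:ℂ) ^ 2) ≠ 0 := by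
    have : (1 + u ^ 2 : ℝ) ≠ 0 := by positivity
    exact_mod_cast this
  have hyc : (y : ℂ) ≠ 0 := by exact_mod_cast hy.ne'
  have hw : (u + Complex.I) ≠ 0 := by
    intro h0
    have := congrArg Complex.im h0
    simp at this
  have hinv : 1 / (9 * (y * (u + Complex.I))) = (u - Complex.I) / (9 * y * (1 + u ^ 2)) := by
    rw [div_eq_div_iff (mul_ne_zero (by norm_num) (mul_ne_zero hyc hw)) (mul_ne_zero (mul_ne_zero (by norm_num) hyc) hu)]
    linear_combination (9 * y) * Complex.I_sq
  rw [hinv]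
  have hA1 : (A : ℂ) = 2 * Real.pi * (n - δ / 12) * y := by exact_mod_cast h.An
  have hA2 : (Real.pi * δ / 6 : ℂ) / (9 * y * (1 + u ^ 2)) = A / (1 + u ^ 2) := by
    have : (A : ℂ) = Real.pi * δ / (54 * y) := by exact_mod_cast h.Ay
    rw [this]; field_simp; ring
  push_cast
  have hu2 : (A : ℂ) * u ^ 2 / (1 + u ^ 2) = A - A / (1 + u ^ 2) := by field_simp; ring
  have hu3 : (A : ℂ) * u ^ 3 / (1 + u ^ 2) = A * u - A / (1 + u ^ 2) * u := by field_simp; ring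
  rw [hu2, hu3]
  have e1 : (δ : ℂ) * (LL (nq (tw (y * (u + Complex.I)))) + Real.pi * Complex.I / 6 * (y * (u + Complex.I) + (u - Complex.I) / (9 * y * (1 + u ^ 2))) -
      Real.pi * Complex.I / 18) = δ * LL (nq (tw (y * (u + Complex.I)))) + (Real.pi * δ / 6) * Complex.I * (y * (u + Complex.I)) 
      + ((Real.pi * δ / 6 : ℂ) / (9 * y * (1 + u ^ 2))) * (Complex.I * (u - Complex.I)) - δ * Real.pi * Complex.I / 18 := by ring
  rw [e1, hA2]
  linear_combination (Complex.I * u - 1) * hA1 + (Real.pi * δ / 6 * y - A / (1 + u ^ 2)) * Complex.I_sq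


theorem HH_norm (A θ u : ℝ) : ‖HH A θ u‖ = Real.exp (2 * A - A * u ^ 2 / (1 + u ^ 2)) := by
  rw [HH, Complex.norm_exp]
  congr 1
  rw [Complex.add_re, Complex.re_ofReal_mul, Complex.ofReal_re, Complex.I_re]
  ring

theorem main_err {δ : ℝ} {n : ℕ} {y A : ℝ} (h : Par δ n y A) (u : ℝ) (hu : u ^ 2 ≤ 3) :
    |(Psi δ y n (1 / 3 + y * u)).re - (HH A (2 * Real.pi * n / 3 + δ * Real.pi / 18) u).re| ≤ 3.1 * Real.exp (A / 4) := by
  set q := nq (tw (y * (u + Complex.I))) with hq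
  set H := HH A (2 * Real.pi * n / 3 + δ * Real.pi / 18) u with hH
  have hy := h.y0
  have hd := h.d0
  have hd3 := h.d3
  have hA := h.A0
  have hu1 : 0 < 1 + u ^ 2 := by positivity
  set E := 2 * Real.pi / (9 * y * (1 + u ^ 2)) with hE
  have hEA : E = 12 * A / (δ * (1 + u ^ 2)) := by
    rw [hE, h.Ay]; field_simp; ring
  have hEge : 4 * A / (1 + u ^ 2) ≤ E := by
    rw [hEA, div_le_div_iff₀ hu1 (by positivity)]
    have : 0 ≤ A * (1 + u ^ 2) := by positivity
    nlinarith
  have hA4 : A ≤ 4 * A / (1 + u ^ 2) := by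
    rw [le_div_iff₀ hu1]; nlinarith
  have hE11 : 11 ≤ E := by linarith
  have hr : ‖q‖ = Real.exp (-E) := by rw [hq, wq_norm y u hy]
  have hrs : ‖q‖ ≤ 0.0001 := by
    rw [hr]
    have h1 : Real.exp (-E) ≤ Real.exp (-11) := Real.exp_le_exp.2 (by linarith)
    have h2 : Real.exp (-11) = (Real.exp 1 ^ 11)⁻¹ := by rw [Real.exp_neg, ← Real.exp_nat_mul]; norm_num
    have h3 : (2.7 : ℝ) ^ 11 ≤ Real.exp 1 ^ 11 := pow_le_pow_left₀ (by norm_num) (by linarith [Real.exp_one_gt_d9]) 11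
    have h4 : (Real.exp 1 ^ 11)⁻¹ ≤ ((2.7 : ℝ) ^ 11)⁻¹ := inv_anti₀ (by norm_num) h3
    have h5 : ((2.7 : ℝ) ^ 11)⁻¹ ≤ 0.0001 := by norm_num
    linarith
  have hr0 : 0 ≤ ‖q‖ := norm_nonneg q
  have hL := LL_add_le q (by linarith)
  have hL2 : ‖LL q‖ ≤ 1.001 * ‖q‖ := by
    have h1 : ‖LL q‖ ≤ ‖LL q + q‖ + ‖q‖ := by
      have := norm_sub_le (LL q + q) q
      simpa using this
    have h2 : ‖q‖ / (1 - ‖q‖) ^ 2 ≤ 1.001 * ‖q‖ := by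
      rw [div_le_iff₀ (by nlinarith)]
      have : 1 ≤ 1.001 * (1 - ‖q‖) ^ 2 := by nlinarith
      nlinarith
    linarith
  set z : ℂ := δ * LL q with hz
  have hzn : ‖z‖ ≤ 3.003 * ‖q‖ := by
    rw [hz, norm_mul, Complex.norm_real, Real.norm_of_nonneg hd.le]
    nlinarith [norm_nonneg (LL q)]
  have hz1 : ‖z‖ ≤ 1 := by linarith
  have he := Complex.norm_exp_sub_one_sub_id_le hz1
  have he2 : ‖Complex.exp z - 1‖ ≤ 3.1 * ‖q‖ := by
    have h1 : ‖Complex.exp z - 1‖ ≤ ‖Complex.exp z - 1 - z‖ + ‖z‖ := by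
      have := norm_add_le (Complex.exp z - 1 - z) z
      simpa using this
    nlinarith [norm_nonneg z]
  have hp := psi_main h u
  rw [← hq, ← hH, ← hz] at hp
  have h6 : (Psi δ y n (1 / 3 + y * u)).re - H.re = (H * (Complex.exp z - 1)).re := by
    rw [hp, ← Complex.sub_re]; congr 1; ring
  rw [h6]
  refine le_trans (Complex.abs_re_le_norm _) ?_
  rw [norm_mul, hH, HH_norm]
  have h7 : Real.exp (2 * A - A * u ^ 2 / (1 + u ^ 2)) * Real.exp (-E) ≤ Real.exp (A / 4) := by
    rw [← Real.exp_add]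
    apply Real.exp_le_exp.2
    have h8 : A * u ^ 2 / (1 + u ^ 2) = A - (4 * A / (1 + u ^ 2)) / 4 := by field_simp; ring
    linarith
  rw [hr] at he2
  have h9 := mul_le_mul_of_nonneg_left he2 (Real.exp_pos (2 * A - A * u ^ 2 / (1 + u ^ 2))).le
  linarith

/-- odd kernel -/
noncomputable def ks (A u : ℝ) : ℝ := Real.exp (-(A * u ^ 2 / (1 + u ^ 2))) * Real.sin (A * u ^ 3 / (1 + u ^ 2))

theorem ks_cont (A : ℝ) : Continuous (ks A) := by
  have h : ∀ u : ℝ, 1 + u ^ 2 ≠ 0 := fun u => by positivity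
  unfold ks
  fun_prop (disch := exact h _)

theorem HH_re (A θ u : ℝ) : (HH A θ u).re = Real.exp (2 * A) * Real.cos θ * kr A u - Real.exp (2 * A) * Real.sin θ * ks A u := by
  rw [HH, Complex.exp_add, Complex.exp_ofReal_mul_I, ← Complex.ofReal_exp, Complex.re_ofReal_mul]
  rw [kr, ks]
  rw [show 2 * A - A * u ^ 2 / (1 + u ^ 2) = 2 * A + -(A * u ^ 2 / (1 + u ^ 2)) by ring, Real.exp_add]
  rw [Complex.add_re, Complex.ofReal_re, Complex.re_ofReal_mul, Complex.I_re, Real.cos_neg, Real.cos_add]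
  ring

theorem int_even (f : ℝ → ℝ) (hf : Continuous f) (he : ∀ x, f (-x) = f x) (a : ℝ) :
    ∫ x in (-a)..a, f x = 2 * ∫ x in (0:ℝ)..a, f x := by
  have h := intervalIntegral.integral_comp_neg (a := 0) (b := a) f
  simp_rw [he] at h
  rw [← intervalIntegral.integral_add_adjacent_intervals (hf.intervalIntegrable (-a) 0) (hf.intervalIntegrable 0 a)]
  rw [neg_zero] at h
  rw [← h]; ring

theorem int_odd (f : ℝ → ℝ) (ho : ∀ x, f (-x) = - f x) (a : ℝ) :
    ∫ x in (-a)..a, f x = 0 := by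
  have h := intervalIntegral.integral_comp_neg (a := -a) (b := a) f
  simp_rw [ho] at h
  rw [intervalIntegral.integral_neg, neg_neg] at h
  linarith

theorem HH_int (A θ : ℝ) : ∫ u in (-√3)..√3, (HH A θ u).re = 2 * Real.exp (2 * A) * Real.cos θ * ∫ u in (0:ℝ)..√3, kr A u := by
  simp_rw [HH_re]
  rw [intervalIntegral.integral_sub (((kr_cont A).const_mul _).intervalIntegrable _ _) (((ks_cont A).const_mul _).intervalIntegrable _ _),
    intervalIntegral.integral_const_mul, intervalIntegral.integral_const_mul,
    int_even (kr A) (kr_cont A) (fun x => ?_), int_odd (ks A) (fun x => ?_)]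
  · ring
  · rw [ks, ks, ← mul_neg, ← Real.sin_neg]; ring_nf
  · rw [kr, kr, ← Real.cos_neg]; ring_nf

theorem HH_cont (A θ : ℝ) : Continuous (fun u => (HH A θ u).re) := by
  simp_rw [HH_re]
  exact ((kr_cont A).const_mul _).sub ((ks_cont A).const_mul _)

theorem circle {δ : ℝ} {c : ℕ → ℝ} (hc : ∀ q : ℂ, ‖q‖ < 1 →
      HasSum (fun m : ℕ => (c m : ℂ) * q ^ m) (Complex.exp ((δ : ℂ) * LL q))) {n : ℕ} {y A : ℝ} (h : Par δ n y A) :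
    |c n - 4 * y * Real.exp (2 * A) * Real.cos (2 * Real.pi * n / 3 + δ * Real.pi / 18) * ∫ u in (0:ℝ)..√3, kr A u| ≤
      1.0289 * Real.exp (5 * A / 4) := by
  have hy := h.y0
  have hy1 := h.y1
  have hA := h.A0
  have hs3 : √3 ^ 2 = 3 := Real.sq_sqrt (by norm_num)
  have hs0 : 0 < √3 := by positivity
  have hs1 : √3 ≤ 1.733 := by rw [Real.sqrt_le_left (by norm_num)]; norm_num
  set f : ℝ → ℝ := fun x => (Psi δ y n x).re with hf
  have hfc : Continuous f := Complex.continuous_re.comp (Psi_cont δ y hy n)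
  have h0 := cauchy_half δ c hc n y hy
  set a := 1 / 3 + y * (-√3) with ha
  set b := 1 / 3 + y * √3 with hb
  have ha0 : 0 ≤ a := by rw [ha]; nlinarith
  have hb0 : b ≤ 1 / 2 := by rw [hb]; nlinarith
  have h1 : ∫ x in (0:ℝ)..(1/2), f x = (∫ x in (0:ℝ)..a, f x) + (∫ x in a..b, f x) + ∫ x in b..(1/2), f x := by
    rw [intervalIntegral.integral_add_adjacent_intervals (hfc.intervalIntegrable _ _) (hfc.intervalIntegrable _ _),
     intervalIntegral.integral_add_adjacent_intervals (hfc.intervalIntegrable _ _) (hfc.intervalIntegrable _ _)]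
  have hab : a ≤ b := by rw [ha, hb]; nlinarith
  have hO1 : |∫ x in (0:ℝ)..a, f x| ≤ Real.exp (0.0275 + 5 * A / 4) * (a - 0) := by
    apply abs_int_le _ _ _ _ ha0
    intro x hx
    apply off_bound h x hx.1 (by linarith [hx.2])
    have : y * √3 ≤ 1 / 3 - x := by have := hx.2; rw [ha] at this; linarith
    have h2 := pow_le_pow_left₀ (by positivity) this 2
    rw [mul_pow, hs3] at h2
    nlinarith
  have hO2 : |∫ x in b..(1/2), f x| ≤ Real.exp (0.0275 + 5 * A / 4) * (1 / 2 - b) := by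
    apply abs_int_le _ _ _ _ hb0
    intro x hx
    apply off_bound h x (by linarith [hx.1]) hx.2
    have : y * √3 ≤ x - 1 / 3 := by have := hx.1; rw [hb] at this; linarith
    have h2 := pow_le_pow_left₀ (by positivity) this 2
    rw [mul_pow, hs3] at h2
    nlinarith
  have hM : ∫ x in a..b, f x = y * ∫ u in (-√3)..√3, f (1 / 3 + y * u) := by
    rw [ha, hb]
    exact (intervalIntegral.mul_integral_comp_add_mul (f := f) (a := -√3) (b := √3) y (1/3)).symm
  set θ := 2 * Real.pi * n / 3 + δ * Real.pi / 18 with hθ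
  have hg : Continuous (fun u => f (1 / 3 + y * u)) := by fun_prop
  have hD := intervalIntegral.integral_sub (hg.intervalIntegrable (μ := MeasureTheory.volume) (-√3) √3) ((HH_cont A θ).intervalIntegrable (-√3) √3)
  have hDb := abs_int_le (fun u => f (1 / 3 + y * u) - (HH A θ u).re) (-√3) √3 (3.1 * Real.exp (A / 4)) (by linarith) (by
    intro u hu
    apply main_err h u
    have := hu.1
    have := hu.2
    nlinarith)
  rw [hD, HH_int] at hDb
  set K := ∫ u in (0:ℝ)..√3, kr A u
  set J := ∫ u in (-√3)..√3, f (1 / 3 + y * u)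
  have hfe : (fun x => (Psi δ y n x).re) = f := rfl
  rw [h1, hM] at h0
  have e1 : c n - 4 * y * Real.exp (2 * A) * Real.cos θ * K = 2 * (∫ x in (0:ℝ)..a, f x) + 2 * (∫ x in b..(1/2), f x) + 2 * y * (J - 2 * Real.exp (2 * A) * Real.cos θ * K) := by
    rw [h0]; ring
  rw [e1]
  have hab2 : b - a = 2 * (y * √3) := by rw [ha, hb]; ring
  have hX : Real.exp (0.0275 + 5 * A / 4) ≤ 1.0289 * Real.exp (5 * A / 4) := by
    rw [Real.exp_add]
    gcongr
    have := Real.exp_bound' (x := 0.0275) (by norm_num) (by norm_num) (n := 3) (by norm_num)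
    norm_num [Finset.sum_range_succ, Nat.factorial] at this ⊢
    linarith
  have hsm : 3.1 * Real.exp (A / 4) * (√3 - -√3) * 2 * y ≤ Real.exp (0.0275 + 5 * A / 4) * (2 * (b - a)) := by
    have h2 : 3.1 * Real.exp (A / 4) ≤ Real.exp (0.0275 + 5 * A / 4) := by
      have h3 : Real.exp (0.0275 + 5 * A / 4) = Real.exp (0.0275 + A) * Real.exp (A / 4) := by
        rw [← Real.exp_add]; congr 1; ring
      rw [h3]
      have h4 := Real.add_one_le_exp (0.0275 + A)
      have h5 := Real.exp_pos (A / 4)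
      nlinarith
    rw [hab2]
    have h6 : 0 ≤ y * √3 := by positivity
    have h7 := mul_le_mul_of_nonneg_right h2 h6
    nlinarith
  have hyD : |2 * y * (J - 2 * Real.exp (2 * A) * Real.cos θ * K)| ≤ 3.1 * Real.exp (A / 4) * (√3 - -√3) * 2 * y := by
    rw [abs_mul, abs_of_pos (by positivity : 0 < 2 * y)]
    have := mul_le_mul_of_nonneg_left hDb (by positivity : 0 ≤ 2 * y)
    linarith
  have hT := abs_add_le (2 * (∫ x in (0:ℝ)..a, f x) + 2 * (∫ x in b..(1/2), f x)) (2 * y * (J - 2 * Real.exp (2 * A) * Real.cos θ * K))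
  have hT2 := abs_add_le (2 * (∫ x in (0:ℝ)..a, f x)) (2 * (∫ x in b..(1/2), f x))
  rw [abs_mul, abs_mul, abs_two] at hT2
  linarith


/-- the expected sign -/
noncomputable def esg (n : ℕ) : ℝ := if n % 3 = 0 then 1 else -1

theorem cos_low (δ : ℝ) (h0 : 0 < δ) (h3 : δ < 3) (n : ℕ) :
    0.162 * (3 - δ) ≤ esg n * Real.cos (2 * Real.pi * n / 3 + δ * Real.pi / 18) := by
  have hp := Real.pi_pos
  have hp1 := Real.pi_gt_d6
  have hp2 := Real.pi_lt_d6
  have hφ0 : 0 < δ * Real.pi / 18 := by positivity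
  have hφ1 : δ * Real.pi / 18 ≤ Real.pi / 6 := by nlinarith
  have hdiv := Nat.div_add_mod n 3
  set k := n / 3
  have hlt : n % 3 < 3 := Nat.mod_lt _ (by norm_num)
  have hcases : n % 3 = 0 ∨ n % 3 = 1 ∨ n % 3 = 2 := by omega
  rcases hcases with hm | hm | hm
  · have hn : (n : ℝ) = 3 * k := by rw [hm] at hdiv; exact_mod_cast hdiv.symm
    have e : 2 * Real.pi * n / 3 + δ * Real.pi / 18 = δ * Real.pi / 18 + k * (2 * Real.pi) := by rw [hn]; ring
    rw [e, Real.cos_add_nat_mul_two_pi, esg, if_pos hm, one_mul]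
    have h1 := Real.cos_le_cos_of_nonneg_of_le_pi hφ0.le (by linarith : Real.pi / 3 ≤ Real.pi) (by linarith)
    rw [Real.cos_pi_div_three] at h1
    linarith
  · have hn : (n : ℝ) = 3 * k + 1 := by rw [hm] at hdiv; exact_mod_cast hdiv.symm
    have e : 2 * Real.pi * n / 3 + δ * Real.pi / 18 = (Real.pi - (Real.pi / 3 - δ * Real.pi / 18)) + k * (2 * Real.pi) := by rw [hn]; ring
    rw [e, Real.cos_add_nat_mul_two_pi, esg, if_neg (by omega), Real.cos_pi_sub]
    have h1 := Real.cos_le_cos_of_nonneg_of_le_pi (by linarith : 0 ≤ Real.pi / 3 - δ * Real.pi / 18) (by linarith : Real.pi / 3 ≤ Real.pi) (by linarith)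
    rw [Real.cos_pi_div_three] at h1
    linarith
  · have hn : (n : ℝ) = 3 * k + 2 := by rw [hm] at hdiv; exact_mod_cast hdiv.symm
    have e : 2 * Real.pi * n / 3 + δ * Real.pi / 18 = ((Real.pi / 2 - (3 - δ) * Real.pi / 18) + Real.pi) + k * (2 * Real.pi) := by rw [hn]; ring
    rw [e, Real.cos_add_nat_mul_two_pi, esg, if_neg (by omega), Real.cos_add_pi, Real.cos_pi_div_two_sub]
    set x := (3 - δ) * Real.pi / 18 with hx
    have hx0 : 0 < x := by
      have : 0 < 3 - δ := by linarith
      positivity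
    have hx1 : x ≤ 0.5236 := by rw [hx]; nlinarith
    have h1 := Real.sin_gt_sub_cube hx0
    have h2 : 0.1745 * (3 - δ) ≤ x := by rw [hx]; nlinarith
    have h3 : x ^ 2 ≤ 0.2742 := by nlinarith
    have h4 : x ^ 3 = x * x ^ 2 := by ring
    nlinarith

theorem mono_aux (A A1 : ℝ) (h1 : 2 ≤ A1) (h : A1 ≤ A) : A * √A ≤ A1 * √A1 * Real.exp (0.75 * (A - A1)) := by
  have h2 : A ≤ A1 * Real.exp (0.5 * (A - A1)) := by
    have := Real.add_one_le_exp (0.5 * (A - A1))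
    nlinarith
  have h3 : √A ≤ √A1 * Real.exp (0.25 * (A - A1)) := by
    rw [← Real.sqrt_sq (Real.exp_pos (0.25 * (A - A1))).le, ← Real.sqrt_mul (by linarith)]
    apply Real.sqrt_le_sqrt
    rw [← Real.exp_nat_mul]
    convert h2 using 3
    push_cast; ring
  have h4 := mul_le_mul h2 h3 (Real.sqrt_nonneg _) (by positivity)
  have h5 : Real.exp (0.75 * (A - A1)) = Real.exp (0.5 * (A - A1)) * Real.exp (0.25 * (A - A1)) := by
    rw [← Real.exp_add]; congr 1; ring
  rw [h5]
  linarith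

theorem analytic {δ : ℝ} {c : ℕ → ℝ} (hc : ∀ q : ℂ, ‖q‖ < 1 →
      HasSum (fun m : ℕ => (c m : ℂ) * q ^ m) (Complex.exp ((δ : ℂ) * LL q))) {n : ℕ} {y A : ℝ} (h : Par δ n y A)
    (hd : δ < 3) (κ A1 : ℝ) (hκ : κ ≤ δ * (3 - δ)) (hA1 : 2 ≤ A1) (hA : A1 ≤ A)
    (hnum : 1.0289 * (A1 * √A1) < 0.01978 * κ * Real.exp (0.75 * A1)) : 0 < esg n * c n := by
  have h1 := circle hc h
  have hy := h.y0
  have hd0 := h.d0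
  have hAp : 0 < A := by linarith
  have hK := kr_int_num A h.A0
  set K := ∫ u in (0:ℝ)..√3, kr A u
  have hco := cos_low δ h.d0 hd n
  set C := Real.cos (2 * Real.pi * n / 3 + δ * Real.pi / 18)
  have hsA : 0 < √A := Real.sqrt_pos.2 hAp
  have hm := mono_aux A A1 hA1 hA
  have hexp : Real.exp (0.75 * A) = Real.exp (0.75 * A1) * Real.exp (0.75 * (A - A1)) := by
    rw [← Real.exp_add]; congr 1; ring
  have hE := Real.exp_pos (0.75 * (A - A1))
  have hfin : 1.0289 * (A * √A) < 0.01978 * (δ * (3 - δ)) * Real.exp (0.75 * A) := by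
    have h2 : 1.0289 * (A * √A) < 0.01978 * κ * Real.exp (0.75 * A) := by
      rw [hexp]
      have := mul_lt_mul_of_pos_right hnum hE
      linarith
    have h3 := mul_le_mul_of_nonneg_right hκ (Real.exp_pos (0.75 * A)).le
    linarith
  have hE2 : Real.exp (2 * A) = Real.exp (5 * A / 4) * Real.exp (0.75 * A) := by
    rw [← Real.exp_add]; congr 1; ring
  have h3d : 0 < 3 - δ := by linarith
  have hKC : 0.162 * (3 - δ) * (0.525 / √A) ≤ esg n * C * K :=
    mul_le_mul hco hK (by positivity) (le_trans (by positivity) hco)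
  have hyA : y = Real.pi * δ / (54 * A) := by
    have := h.Ay
    field_simp
    rw [eq_div_iff (by positivity)] at this
    linarith
  have hmain : 1.0289 * Real.exp (5 * A / 4) < 4 * y * Real.exp (2 * A) * (esg n * C * K) := by
    have h4 := mul_le_mul_of_nonneg_left hKC (by positivity : 0 ≤ 4 * y * Real.exp (2 * A))
    refine lt_of_lt_of_le ?_ h4
    rw [hE2, hyA]
    have e : 4 * (Real.pi * δ / (54 * A)) * (Real.exp (5 * A / 4) * Real.exp (0.75 * A)) * (0.162 * (3 - δ) * (0.525 / √A)) =
      Real.exp (5 * A / 4) * ((4 * 0.162 * 0.525 / 54 * Real.pi * (δ * (3 - δ)) * Real.exp (0.75 * A)) / (A * √A)) := by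
      field_simp
    rw [e, mul_comm]
    apply mul_lt_mul_of_pos_left _ (Real.exp_pos _)
    rw [lt_div_iff₀ (by positivity)]
    refine lt_of_lt_of_le hfin ?_
    have : 0.01978 ≤ 4 * 0.162 * 0.525 / 54 * Real.pi := by linarith [Real.pi_gt_d6]
    gcongr
  have hs : |esg n| = 1 := by unfold esg; split_ifs <;> simp
  have h5 : |esg n * (c n - 4 * y * Real.exp (2 * A) * C * K)| ≤ 1.0289 * Real.exp (5 * A / 4) := by
    rw [abs_mul, hs, one_mul]; exact h1
  have h6 := (abs_le.1 h5).1
  have h7 : esg n * (c n - 4 * y * Real.exp (2 * A) * C * K) = esg n * c n - 4 * y * Real.exp (2 * A) * (esg n * C * K) := by ring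
  rw [h7] at h6
  linarith

theorem par_exists (δ : ℝ) (h0 : 0 < δ) (h3 : δ ≤ 3) (n : ℕ) (hn : 158 ≤ n) (A1 : ℝ) (hA1 : 11 ≤ A1)
    (h : A1 ^ 2 ≤ 0.36554 * (δ * n - δ ^ 2 / 12)) : ∃ y A, Par δ n y A ∧ A1 ≤ A := by
  have hnR : (158 : ℝ) ≤ n := by exact_mod_cast hn
  set m : ℝ := n - δ / 12 with hm
  have hm0 : 157 ≤ m := by rw [hm]; linarith
  set y := √(δ / (108 * m)) with hy
  have hy0 : 0 < y := by apply Real.sqrt_pos.2; positivity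
  have hy2 : y ^ 2 = δ / (108 * m) := Real.sq_sqrt (by positivity)
  have hp := Real.pi_pos
  have hp1 := Real.pi_gt_d6
  have hA : A1 ≤ 2 * Real.pi * m * y := by
    refine (pow_le_pow_iff_left₀ (by linarith) (by positivity) two_ne_zero).1 ?_
    have e : (2 * Real.pi * m * y) ^ 2 = Real.pi ^ 2 / 27 * (δ * m) := by
      rw [mul_pow, hy2]; field_simp; ring
    rw [e]
    have h1 : δ * m = δ * n - δ ^ 2 / 12 := by rw [hm]; ring
    rw [h1]
    refine le_trans h ?_
    rw [← h1]
    have : 0.36554 ≤ Real.pi ^ 2 / 27 := by nlinarith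
    gcongr
  refine ⟨y, 2 * Real.pi * m * y, ⟨h0, h3, hy0, ?_, by linarith, ?_, rfl⟩, hA⟩
  · rw [hy]
    apply Real.sqrt_le_iff.2
    refine ⟨by norm_num, ?_⟩
    rw [div_le_iff₀ (by positivity)]
    linarith
  · rw [eq_div_iff (by positivity)]
    have e : 2 * Real.pi * m * y * (54 * y) = 108 * Real.pi * m * y ^ 2 := by ring
    rw [e, hy2]
    field_simp

theorem exp_low (k : ℕ) : (2.7182818 : ℝ) ^ k ≤ Real.exp k := by
  have : Real.exp (k : ℝ) = Real.exp 1 ^ k := by rw [← Real.exp_nat_mul, mul_one]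
  rw [this]
  exact pow_le_pow_left₀ (by norm_num) (by linarith [Real.exp_one_gt_d9]) k

theorem sign_all (δ : ℝ) (hδ0 : 0.227 ≤ δ) (hδ1 : δ ≤ 2.9999) (c : ℕ → ℝ) (hc : ∀ q : ℂ, ‖q‖ < 1 →
      HasSum (fun m : ℕ => (c m : ℂ) * q ^ m) (Complex.exp ((δ : ℂ) * LL q))) (n : ℕ) (hn : 158 ≤ n) :
    0 < esg n * c n := by
  have hd0 : 0 < δ := by linarith
  rcases le_total δ 2.8 with h | h
  · by_cases h2 : δ * n < 332
    · rw [c_eq δ c hc n]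
      exact sign_small_1 δ hδ0 n hn h2
    · push Not at h2
      obtain ⟨y, A, hP, hA⟩ := par_exists δ hd0 (by linarith) n hn 11 le_rfl (by nlinarith)
      apply analytic hc hP (by linarith) 0.56 11 (by nlinarith) (by norm_num) hA
      have h3 : √11 ≤ 3.3167 := by rw [Real.sqrt_le_left (by norm_num)]; norm_num
      have h4 := exp_low 8
      have h5 : Real.exp (0.75 * 11) = Real.exp ((8 : ℕ) : ℝ) * Real.exp 0.25 := by
        rw [← Real.exp_add]; congr 1; norm_num
      have h6 : 1.25 ≤ Real.exp 0.25 := by linarith [Real.add_one_le_exp 0.25]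
      have h7 := Real.quadratic_le_exp_of_nonneg (x := 0.25) (by norm_num)
      rw [h5]
      have h8 := mul_le_mul h4 h7 (by norm_num) (Real.exp_pos _).le
      norm_num at h8 ⊢
      linarith
  · by_cases h2 : δ * n < 1577
    · rw [c_eq δ c hc n]
      exact sign_small_2 δ h hδ1 n hn h2
    · push Not at h2
      obtain ⟨y, A, hP, hA⟩ := par_exists δ hd0 (by linarith) n hn 24 (by norm_num) (by nlinarith)
      apply analytic hc hP (by linarith) 0.00029 24 (by nlinarith) (by norm_num) hA
      have h3 : √24 ≤ 5 := by rw [Real.sqrt_le_left (by norm_num)]; norm_num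
      have h4 := exp_low 18
      have h5 : Real.exp (0.75 * 24) = Real.exp ((18 : ℕ) : ℝ) := by congr 1; norm_num
      rw [h5]
      norm_num at h4 ⊢
      linarith


end B3

/-- partial confirmation of the sign-pattern conjecture: for
`0.227 ≤ δ ≤ 2.9999` and all `n ≥ 158`, the Borwein coefficients `c₃^{(δ)}` satisfy
`c₃^{(δ)}(n) · c₃^{(δ)}(n+3) > 0`. -/
theorem borwein3_sign_pattern (δ : ℝ) (hδ0 : 0.227 ≤ δ) (hδ1 : δ ≤ 2.9999)
    (c : ℕ → ℝ)
    (hc : ∀ q : ℂ, ‖q‖ < 1 →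
      HasSum (fun m : ℕ => (c m : ℂ) * q ^ m)
        (Complex.exp ((δ : ℂ) *
          ∑' m : ℕ, if 3 ∣ (m + 1) then 0 else Complex.log (1 - q ^ (m + 1)))))
    (n : ℕ) (hn : 158 ≤ n) :
    0 < c n * c (n + 3) := by
  have h1 := B3.sign_all δ hδ0 hδ1 c hc n hn
  have h2 := B3.sign_all δ hδ0 hδ1 c hc (n + 3) (by omega)
  have e : B3.esg (n + 3) = B3.esg n := by
    unfold B3.esg
    rw [Nat.add_mod_right]
  rw [e] at h2
  have h3 := mul_pos h1 h2
  have hs : B3.esg n * B3.esg n = 1 := by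
    unfold B3.esg
    split_ifs <;> norm_num
  have h4 : B3.esg n * c n * (B3.esg n * c (n + 3)) = (B3.esg n * B3.esg n) * (c n * c (n + 3)) := by ring
  rw [h4, hs, one_mul] at h3
  exact h3
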